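/- Let R be a commutative ring with identity whose additive group is a free abelian group of finite rank n, and let p be a prime. Then the generating function Σ_{l≥0} a_R(p^l) X^l ∈ ℤ⟦X⟧ is a rational function of X: there exist polynomials P, Q ∈ ℤ[X] with Q(0) = 1 such that Q(X) · Σ_{l≥0} a_R(p^l) X^l = P(X) as formal power series. -/

import Mathlib

/-- `idealCount R k` is the number of ideals `I` of `R` such that `R ⧸ I` is finite
with exactly `k` elements. -/
noncomputable def idealCount (R : Type) [CommRing R] (k : ℕ) : ℕ :=
  Set.ncard {I : Ideal R | Nat.card (R ⧸ I) = k}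

section PartA1
open Filter Topology
open scoped NNReal ENNReal

namespace IdealZeta

set_option linter.unusedSectionVars false

section division
variable {K : Type} [NontriviallyNormedField K] [CompleteSpace K]
variable {ι : Type} [Fintype ι] [DecidableEq ι]

/-- projection killing coordinate `i` -/
noncomputable def killL (K : Type) [NontriviallyNormedField K] (ι : Type) [Fintype ι] [DecidableEq ι]
    (i : ι) : (ι → K) →L[K] (ι → K) :=
  ContinuousLinearMap.pi fun j => if j = i then 0 else ContinuousLinearMap.proj j

theorem killL_apply (i : ι) (z : ι → K) : killL K ι i z = Function.update z i 0 := by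
  ext j
  by_cases h : j = i
  · subst h; simp [killL]
  · simp [killL, h]

theorem killL_norm_le (i : ι) : ‖killL K ι i‖ ≤ 1 := by
  apply ContinuousLinearMap.opNorm_le_bound _ zero_le_one
  intro z
  rw [killL_apply, one_mul]
  refine (pi_norm_le_iff_of_nonneg (norm_nonneg _)).2 fun j => ?_
  by_cases h : j = i
  · subst h; simp
  · simpa [h] using norm_le_pi_norm z j

/-- divided difference series -/
noncomputable def divSeries (i : ι) (q : FormalMultilinearSeries K (ι → K) K) :
    FormalMultilinearSeries K (ι → K) K := fun n =>
  ∑ k : Fin (n + 1), ((q (n + 1)).curryMid k (Pi.single i 1)).compContinuousLinearMap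
    (fun j => if j.castSucc < k then ContinuousLinearMap.id K (ι → K) else killL K ι i)

theorem divSeries_apply (i : ι) (q : FormalMultilinearSeries K (ι → K) K) (n : ℕ) (z : ι → K) :
    z i * divSeries i q n (fun _ => z) =
      q (n + 1) (fun _ => z) - q (n + 1) (fun _ => Function.update z i 0) := by
  set w := Function.update z i 0 with hw
  let v : ℕ → Fin (n + 1) → (ι → K) := fun k j => if (j : ℕ) < k then z else w
  have hzw : z i • (Pi.single i 1 : ι → K) = z - w := by
    ext j
    by_cases h : j = i
    · subst h; simp [hw]
    · simp [hw, h]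
  have key : ∀ k : Fin (n + 1), z i * ((q (n + 1)).curryMid k (Pi.single i 1)).compContinuousLinearMap
    (fun j => if j.castSucc < k then ContinuousLinearMap.id K (ι → K) else killL K ι i) (fun _ => z)
     = q (n + 1) (v (k + 1)) - q (n + 1) (v k) := by
    intro k
    rw [ContinuousMultilinearMap.compContinuousLinearMap_apply,
      ContinuousMultilinearMap.curryMid_apply]
    have e1 : v (k + 1) = Function.update (v k) k z := by
      ext1 j
      by_cases h : j = k
      · subst h; simp [v]
      · have : (j : ℕ) < k + 1 ↔ (j : ℕ) < k := by
          have : (j : ℕ) ≠ k := fun hh => h (Fin.ext hh)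
          omega
        simp [v, h, this]
    have e2 : v k = Function.update (v k) k w := by
      ext1 j
      by_cases h : j = k
      · subst h; simp [v]
      · simp [h]
    have e3 : (k.insertNth (Pi.single i 1 : ι → K) (fun j : Fin n =>
        (if j.castSucc < k then ContinuousLinearMap.id K (ι → K) else killL K ι i) z))
        = Function.update (v k) k (Pi.single i 1) := by
      rw [Fin.insertNth_eq_iff]
      refine ⟨by simp, ?_⟩
      ext1 j
      simp only [Fin.removeNth, Function.update_of_ne (Fin.succAbove_ne k j)]
      by_cases h : j.castSucc < k
      · have h' : ((k.succAbove j : Fin (n+1)) : ℕ) < k := by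
          rw [Fin.succAbove_of_castSucc_lt _ _ h]; exact h
        simp [v, h, h']
      · have h' : ¬ ((k.succAbove j : Fin (n+1)) : ℕ) < k := by
          rw [Fin.succAbove_of_le_castSucc _ _ (not_lt.1 h)]
          have := not_lt.1 h
          have : (k : ℕ) ≤ j := this
          simp; omega
        simp [v, h, h', killL_apply, hw]
    rw [e3]
    conv_rhs => rw [e1]; arg 2; rw [e2]
    rw [← ContinuousMultilinearMap.map_update_sub, ← hzw, ContinuousMultilinearMap.map_update_smul,
      smul_eq_mul]
  rw [divSeries, sum_apply, Finset.mul_sum, Finset.sum_congr rfl (fun k _ => key k),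
    Fin.sum_univ_eq_sum_range (fun k => q (n + 1) (v (k + 1)) - q (n + 1) (v k)), Finset.sum_range_sub (fun k => (q (n + 1)) (v k))]
  have h0 : v 0 = fun _ => w := by ext1 j; simp [v]
  have h1 : v (n + 1) = fun _ => z := by ext1 j; simp only [v, if_pos j.2]
  rw [h0, h1]

theorem divSeries_norm (i : ι) (q : FormalMultilinearSeries K (ι → K) K) (n : ℕ) :
    ‖divSeries i q n‖ ≤ (n + 1) * ‖q (n + 1)‖ := by
  refine (norm_sum_le _ _).trans ?_
  refine (Finset.sum_le_card_nsmul _ _ ‖q (n+1)‖ ?_).trans ?_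
  · intro k _
    refine (ContinuousMultilinearMap.norm_compContinuousLinearMap_le _ _).trans ?_
    have h1 : ∏ j : Fin n, ‖(if j.castSucc < k then ContinuousLinearMap.id K (ι → K) else killL K ι i)‖ ≤ 1 := by
      apply Finset.prod_le_one
      · intros; positivity
      · intro j _
        split_ifs
        · exact ContinuousLinearMap.norm_id_le
        · exact killL_norm_le i
    have h2 : ‖(q (n + 1)).curryMid k (Pi.single i 1)‖ ≤ ‖q (n + 1)‖ := by
      refine (ContinuousLinearMap.le_opNorm _ _).trans ?_
      rw [ContinuousMultilinearMap.norm_curryMid]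
      have : ‖(Pi.single i 1 : ι → K)‖ ≤ 1 := by
        refine (pi_norm_le_iff_of_nonneg zero_le_one).2 fun j => ?_
        by_cases h : j = i
        · subst h; simp
        · simp [h]
      exact mul_le_of_le_one_right (norm_nonneg _) this
    calc _ ≤ ‖q (n+1)‖ * 1 := by gcongr
      _ = _ := mul_one _
  · simp

theorem divSeries_radius_pos (i : ι) (q : FormalMultilinearSeries K (ι → K) K) (h : 0 < q.radius) :
    0 < (divSeries i q).radius := by
  obtain ⟨r, hr0, hr⟩ := ENNReal.lt_iff_exists_nnreal_btwn.1 h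
  have hr0' : 0 < r := by exact_mod_cast hr0
  obtain ⟨C, hC, hb⟩ := q.norm_mul_pow_le_of_lt_radius hr
  have : ((r / 2 : ℝ≥0) : ℝ≥0∞) ≤ (divSeries i q).radius := by
    apply FormalMultilinearSeries.le_radius_of_bound _ (2 * C / r)
    intro n
    have h1 := divSeries_norm i q n
    have h2 := hb (n + 1)
    have h3 : ((n : ℝ) + 1) ≤ 2 ^ (n + 1) := by
      have := @Nat.lt_two_pow_self (n+1)
      exact_mod_cast this.le
    have hrr : (0:ℝ) < r := hr0'
    push_cast
    rw [div_pow]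
    rw [pow_succ] at h2 h3
    calc ‖divSeries i q n‖ * ((r:ℝ) ^ n / 2 ^ n) ≤ ((2 ^ n * 2) * ‖q (n + 1)‖) * ((r:ℝ) ^ n / 2 ^ n) := by
          gcongr; exact h1.trans (by gcongr)
      _ = 2 * (‖q (n + 1)‖ * ((r:ℝ) ^ n * r)) / r := by field_simp
      _ ≤ 2 * C / r := by gcongr
  refine lt_of_lt_of_le ?_ this
  simpa using hr0'.ne'

theorem division0 {F : (ι → K) → K} {a : ι → K} (hF : AnalyticAt K F a) (i : ι) :
    ∃ g : (ι → K) → K, AnalyticAt K g a ∧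
      ∀ᶠ x in 𝓝 a, F x = F (Function.update x i (a i)) + (x i - a i) * g x := by
  obtain ⟨q, r, hq⟩ := hF
  have hpos : 0 < (divSeries i q).radius := divSeries_radius_pos i q (hq.r_pos.trans_le hq.r_le)
  have hb := (divSeries i q).hasFPowerSeriesOnBall hpos
  refine ⟨fun x => (divSeries i q).sum (x - a), ?_, ?_⟩
  · have h := hb.comp_sub a
    rw [zero_add] at h
    exact ⟨_, _, h⟩
  · have hr : 0 < min r (divSeries i q).radius := lt_min hq.r_pos hpos
    have hball : Metric.eball a (min r (divSeries i q).radius) ∈ 𝓝 a := Metric.eball_mem_nhds _ hr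
    filter_upwards [hball] with x hx
    set z := x - a with hz
    have hxz : x = a + z := by simp [hz]
    have hzr : z ∈ Metric.eball (0 : ι → K) (min r (divSeries i q).radius) := by
      rw [Metric.mem_eball, edist_zero_right]
      rwa [Metric.mem_eball, edist_eq_enorm_sub] at hx
    have hz1 : z ∈ Metric.eball (0 : ι → K) r := Metric.eball_subset_eball (min_le_left _ _) hzr
    have hz2 : z ∈ Metric.eball (0 : ι → K) (divSeries i q).radius :=
      Metric.eball_subset_eball (min_le_right _ _) hzr
    have hw1 : Function.update z i 0 ∈ Metric.eball (0 : ι → K) r := by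
      rw [Metric.mem_eball, edist_zero_right] at hz1 ⊢
      refine lt_of_le_of_lt ?_ hz1
      rw [enorm_le_iff_norm_le, ← killL_apply]
      refine ((killL K ι i).le_opNorm z).trans ?_
      exact mul_le_of_le_one_left (norm_nonneg _) (killL_norm_le i)
    have s1 := hq.hasSum hz1
    have s2 := hq.hasSum hw1
    have s3 := (hb.hasSum hz2).mul_left (z i)
    rw [zero_add] at s3
    have s12 := s1.sub s2
    rw [← hasSum_nat_add_iff' 1] at s12
    have e : (fun n => z i * divSeries i q n (fun _ => z)) =
      fun n => q (n + 1) (fun _ => z) - q (n + 1) (fun _ => Function.update z i 0) := by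
      ext n; exact divSeries_apply i q n z
    rw [e] at s3
    have := s3.unique s12
    simp only [Finset.range_one, Finset.sum_singleton] at this
    have e0 : q 0 (fun _ => z) = q 0 (fun _ => Function.update z i 0) := by
      congr 1; ext1 j; exact j.elim0
    rw [e0, sub_self, sub_zero] at this
    have e5 : a + Function.update z i 0 = Function.update x i (a i) := by
      ext j
      by_cases h : j = i
      · subst h; simp
      · simp [h, hz]
    rw [e5, ← hxz] at this
    have e6 : x i - a i = z i := by simp [hz]
    rw [e6, this]; ring

end division
end IdealZeta
end PartA1

section PartA2
open Filter Topology
open scoped NNReal ENNReal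

namespace IdealZeta

set_option linter.unusedSectionVars false

section identity
variable {K : Type} [NontriviallyNormedField K] [CompleteSpace K]
variable {E : Type} [NormedAddCommGroup E] [NormedSpace K E]

theorem identity_lemma {f : E → K} {a : E} (hf : AnalyticAt K f a) :
    (∀ᶠ z in 𝓝 a, f z = 0) ∨ (∀ᶠ z in 𝓝 a, ¬ ∀ᶠ w in 𝓝 z, f w = 0) := by
  obtain ⟨q, r0, hq0⟩ := hf
  obtain ⟨r, hr0, hr⟩ := ENNReal.lt_iff_exists_nnreal_btwn.1 hq0.r_pos
  have hq := hq0.mono hr0 hr.le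
  have hrpos : 0 < r := by exact_mod_cast hr0
  by_cases h : ∃ z, ‖z - a‖₊ < r / 2 ∧ ∀ᶠ w in 𝓝 z, f w = 0
  · left
    obtain ⟨z, hz, hw⟩ := h
    have hzr : (‖z - a‖₊ : ℝ≥0∞) < r := by
      have : ‖z - a‖₊ < r := hz.trans (NNReal.half_lt_self hrpos.ne')
      exact_mod_cast this
    have hc := hq.changeOrigin hzr
    rw [add_sub_cancel] at hc
    have h0 : HasFPowerSeriesAt (0 : E → K) (q.changeOrigin (z - a)) z :=
      hc.hasFPowerSeriesAt.congr hw
    have hlt : (‖z - a‖₊ : ℝ≥0∞) < (r : ℝ≥0∞) - ‖z - a‖₊ := by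
      have : ‖z - a‖₊ < r - ‖z - a‖₊ := by
        rw [lt_tsub_iff_left]
        calc _ < r / 2 + r / 2 := add_lt_add hz hz
          _ = r := add_halves r
      exact_mod_cast this
    have hmem : Metric.eball z ((r : ℝ≥0∞) - ‖z - a‖₊) ∈ 𝓝 a := by
      apply Metric.isOpen_eball.mem_nhds
      rw [Metric.mem_eball, edist_comm, edist_eq_enorm_sub]
      exact hlt
    filter_upwards [hmem] with w hw
    have hw' : w - z ∈ Metric.eball (0 : E) ((r : ℝ≥0∞) - ‖z - a‖₊) := by
      rw [Metric.mem_eball, edist_zero_right]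
      rwa [Metric.mem_eball, edist_eq_enorm_sub] at hw
    have hs := hc.hasSum hw'
    simp only [h0.apply_eq_zero, add_sub_cancel] at hs
    exact (hs.unique hasSum_zero)
  · right
    push Not at h
    have : Metric.ball a (r / 2 : ℝ≥0) ∈ 𝓝 a := Metric.ball_mem_nhds _ (by positivity)
    filter_upwards [this] with z hz
    rw [Metric.mem_ball, dist_eq_norm] at hz
    intro hh
    have := h z (by exact_mod_cast hz)
    exact this (hh.mono fun w hw => by simp [hw])

theorem domain_lemma {f g : E → K} {a : E} (hf : AnalyticAt K f a) (hg : AnalyticAt K g a)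
    (h : ∀ᶠ z in 𝓝 a, f z * g z = 0) : (∀ᶠ z in 𝓝 a, f z = 0) ∨ (∀ᶠ z in 𝓝 a, g z = 0) := by
  rcases identity_lemma hf with h1 | h1
  · exact Or.inl h1
  · right
    by_contra hcon
    rw [not_eventually] at hcon
    obtain ⟨z, hz0, hz1, hz2, hz3⟩ :=
      (hcon.and_eventually (h1.and (h.eventually_nhds.and hg.eventually_continuousAt))).exists
    apply hz1
    filter_upwards [hz2, hz3.eventually_ne hz0] with w hw hw'
    exact (mul_eq_zero.1 hw).resolve_right hw'

theorem domain_prod {κ : Type} (s : Finset κ) {f : κ → E → K} {a : E}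
    (hf : ∀ k ∈ s, AnalyticAt K (f k) a)
    (h : ∀ᶠ z in 𝓝 a, ∏ k ∈ s, f k z = 0) : ∃ k ∈ s, (∀ᶠ z in 𝓝 a, f k z = 0) := by
  classical
  induction s using Finset.induction_on with
  | empty => exact absurd h.self_of_nhds (by simp)
  | insert k s hk ih =>
    simp only [Finset.prod_insert hk] at h
    rcases domain_lemma (hf k (by simp))
      (Finset.analyticAt_fun_prod s fun n hn => hf n (by simp [hn])) h with h1 | h1
    · exact ⟨k, by simp, h1⟩
    · obtain ⟨k', hk', h2⟩ := ih (fun n hn => hf n (by simp [hn])) h1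
      exact ⟨k', by simp [hk'], h2⟩

end identity

section pd
variable {K : Type} [NontriviallyNormedField K] [CompleteSpace K]
variable {ι : Type} [Fintype ι] [DecidableEq ι]

theorem analyticAt_update {G : (ι → K) → K} {a : ι → K} (i : ι) (hG : AnalyticAt K G a) :
    AnalyticAt K (fun x => Function.update x i (G x)) a := by
  rw [analyticAt_pi_iff]
  intro j
  by_cases h : j = i
  · subst h; simpa using hG
  · simp only [Function.update_of_ne h]
    exact (ContinuousLinearMap.proj (R := K) (φ := fun _ : ι => K) j).analyticAt a

theorem analyticAt_coord (a : ι → K) (j : ι) : AnalyticAt K (fun x : ι → K => x j) a :=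
  (ContinuousLinearMap.proj (R := K) (φ := fun _ : ι => K) j).analyticAt a

/-- partial derivative -/
noncomputable def pd (i : ι) (F : (ι → K) → K) : (ι → K) → K :=
  fun x => fderiv K F x (Pi.single i 1)

theorem pd_analyticAt {F : (ι → K) → K} {a : ι → K} (i : ι) (hF : AnalyticAt K F a) :
    AnalyticAt K (pd i F) a := by
  have h1 := hF.fderiv
  exact ((ContinuousLinearMap.apply K K (Pi.single i 1 : ι → K)).analyticAt _).comp h1

theorem pd_iter_analyticAt {F : (ι → K) → K} {a : ι → K} (i : ι) (k : ℕ) (hF : AnalyticAt K F a) :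
    AnalyticAt K ((pd i)^[k] F) a := by
  induction k with
  | zero => exact hF
  | succ k ih => rw [Function.iterate_succ_apply']; exact pd_analyticAt i ih

theorem hasDerivAt_update' (x : ι → K) (i : ι) (t : K) :
    HasDerivAt (fun t => Function.update x i t) (Pi.single i 1) t := by
  rw [hasDerivAt_pi]
  intro j
  by_cases h : j = i
  · subst h; simpa using hasDerivAt_id' t
  · simpa [h] using hasDerivAt_const t (x j)

theorem deriv_update {F : (ι → K) → K} {x : ι → K} {t : K} (i : ι)
    (hF : AnalyticAt K F (Function.update x i t)) :
    deriv (fun t => F (Function.update x i t)) t = pd i F (Function.update x i t) := by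
  have h := hF.differentiableAt.hasFDerivAt.comp_hasDerivAt t (hasDerivAt_update' x i t)
  exact h.deriv

theorem iteratedDeriv_update {F : (ι → K) → K} (i : ι) (k : ℕ) : ∀ {x : ι → K} {t : K}
    (_ : AnalyticAt K F (Function.update x i t)),
    iteratedDeriv k (fun t => F (Function.update x i t)) t = (pd i)^[k] F (Function.update x i t) := by
  induction k with
  | zero => intro x t _; simp
  | succ k ih =>
    intro x t hF
    rw [iteratedDeriv_succ, Function.iterate_succ_apply']
    have hc : Continuous (fun t => Function.update x i t) := by fun_prop
    have hev : ∀ᶠ t' in 𝓝 t, AnalyticAt K F (Function.update x i t') :=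
      hc.continuousAt.eventually hF.eventually_analyticAt
    have : iteratedDeriv k (fun t => F (Function.update x i t)) =ᶠ[𝓝 t]
        fun t' => (pd i)^[k] F (Function.update x i t') := by
      filter_upwards [hev] with t' ht'
      exact ih ht'
    rw [this.deriv_eq, deriv_update i (pd_iter_analyticAt i k hF)]

/-- implicit function theorem -/
theorem implicit {h : (ι → K) → K} {a : ι → K} (i : ι) (hh : AnalyticAt K h a) (h0 : h a = 0)
    (h1 : pd i h a ≠ 0) : ∃ ψ : (ι → K) → K, AnalyticAt K ψ a ∧ ψ a = a i ∧
      (∀ x t, ψ (Function.update x i t) = ψ x) ∧ ∀ᶠ x in 𝓝 a, h (Function.update x i (ψ x)) = 0 := by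
  let Θ : (ι → K) → (ι → K) := fun x => Function.update x i (h x)
  have hΘ : AnalyticAt K Θ a := analyticAt_update i hh
  have hinj : Function.Injective (fderiv K Θ a) := by
    rw [injective_iff_map_eq_zero]
    intro v hv
    have hcomp : ∀ j, (fderiv K Θ a v) j = fderiv K (fun x => Θ x j) a v := by
      intro j
      rw [fderiv_pi (fun j => ((analyticAt_pi_iff.1 hΘ) j).differentiableAt)]
      rfl
    have hj : ∀ j, j ≠ i → v j = 0 := by
      intro j hj
      have h2 := hcomp j
      rw [hv] at h2
      simp only [Θ, Function.update_of_ne hj] at h2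
      rw [show (fun x : ι → K => x j) = (ContinuousLinearMap.proj (R := K) (φ := fun _ : ι => K) j) from rfl,
        ContinuousLinearMap.fderiv] at h2
      exact h2.symm
    have hv' : v = v i • Pi.single i 1 := by
      ext j
      by_cases hji : j = i
      · subst hji; simp
      · simp [hji, hj j hji]
    have h2 := hcomp i
    rw [hv] at h2
    simp only [Θ, Function.update_self, Pi.zero_apply] at h2
    rw [hv', map_smul, smul_eq_mul, eq_comm, mul_eq_zero] at h2
    rw [hv', h2.resolve_right h1, zero_smul]
  let e : (ι → K) ≃L[K] (ι → K) :=
    (LinearEquiv.ofInjectiveEndo (fderiv K Θ a : (ι → K) →ₗ[K] (ι → K)) hinj).toContinuousLinearEquiv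
  have he : (e : (ι → K) →L[K] (ι → K)) = fderiv K Θ a := by
    ext v j; rfl
  have hs : HasStrictFDerivAt Θ (e : (ι → K) →L[K] (ι → K)) a := by
    rw [he]; exact hΘ.hasStrictFDerivAt
  let Φ := (hs.toOpenPartialHomeomorph Θ).symm
  have hΦan : AnalyticAt K Φ (Θ a) := by
    have := (hs.toOpenPartialHomeomorph Θ).analyticAt_symm' (i := e) (a := a)
      hs.mem_toOpenPartialHomeomorph_source (by simpa using hΘ) (by simpa using he.symm)
    simpa using this
  have hΦa : Φ (Θ a) = a := hs.localInverse_apply_image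
  have hΘΦ : ∀ᶠ y in 𝓝 (Θ a), Θ (Φ y) = y := hs.eventually_right_inverse
  have hΘa : Θ a = Function.update a i 0 := by simp [Θ, h0]
  rw [hΘa] at hΦan hΦa hΘΦ
  have han : AnalyticAt K (fun x : ι → K => Function.update x i (0 : K)) a :=
    analyticAt_update i analyticAt_const
  refine ⟨fun x => Φ (Function.update x i 0) i, ?_, ?_, ?_, ?_⟩
  · exact (analyticAt_coord _ i).comp (AnalyticAt.comp (g := Φ) (f := fun x : ι → K => Function.update x i (0 : K)) hΦan han)
  · simp [hΦa]
  · intro x t; simp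
  · have := han.continuousAt.eventually hΘΦ
    filter_upwards [this] with x hx
    have e1 : Function.update x i (Φ (Function.update x i 0) i) = Φ (Function.update x i 0) := by
      ext j
      by_cases hj : j = i
      · subst hj; simp
      · have := congrFun hx j
        simpa [Θ, hj] using this.symm
    rw [e1]
    have := congrFun hx i
    simpa [Θ] using this

end pd
end IdealZeta
end PartA2

section PartB1
open Filter Topology
open scoped NNReal ENNReal

namespace IdealZeta

set_option linter.unusedSectionVars false

section res
variable {p : ℕ} [Fact p.Prime] {ι : Type} [Fintype ι] [DecidableEq ι]

/-- the unit polydisc -/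
def Bx (p : ℕ) [Fact p.Prime] (ι : Type) : Set (ι → ℚ_[p]) := {x | ∀ i, ‖x i‖ ≤ 1}

/-- the norm is a monomial on the polydisc -/
def Mono (F : (ι → ℚ_[p]) → ℚ_[p]) : Prop :=
  ∃ (α : ι → ℕ) (κ : ℝ), 0 < κ ∧ ∀ x ∈ Bx p ι, ‖F x‖ = κ * ∏ i, ‖x i‖ ^ α i

/-- analytic on the polydisc -/
def LA (F : (ι → ℚ_[p]) → ℚ_[p]) : Prop := AnalyticOnNhd ℚ_[p] F (Bx p ι)

/-- nowhere locally zero -/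
def NLZ (F : (ι → ℚ_[p]) → ℚ_[p]) : Prop := ∀ x ∈ Bx p ι, ¬ ∀ᶠ z in 𝓝 x, F z = 0

/-- resolution trees -/
inductive Res (s : Finset ι) : ((ι → ℚ_[p]) → ℚ_[p]) → Prop
  | mono (F : (ι → ℚ_[p]) → ℚ_[p]) (h : Mono F) : Res s F
  | sub (F : (ι → ℚ_[p]) → ℚ_[p]) (i : ι) (hi : i ∈ s)
      (h : ∀ b : ℚ_[p], ‖b‖ ≤ 1 → Res s (fun x => F (Function.update x i (b + p * x i)))) : Res s F
  | blow (F : (ι → ℚ_[p]) → ℚ_[p]) (i j : ι) (hi : i ∈ s) (hj : j ∈ s) (hij : i ≠ j)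
      (h1 : Res s (fun x => x i * F (Function.update x j (x i * x j))))
      (h2 : Res s (fun x => x j * F (Function.update x i (p * x j * x i)))) : Res s F
  | shift (F : (ι → ℚ_[p]) → ℚ_[p]) (i : ι) (hi : i ∈ s) (φ : (ι → ℚ_[p]) → ℚ_[p])
      (hφ : LA φ) (hφi : ∀ x t, φ (Function.update x i t) = φ x) (hφs : DependsOn φ (s : Set ι))
      (hφ1 : ∀ x ∈ Bx p ι, ‖φ x‖ ≤ 1)
      (h : Res s (fun x => F (Function.update x i (x i + φ x)))) : Res s F
  | pow (F : (ι → ℚ_[p]) → ℚ_[p]) (i : ι) (hi : i ∈ s) (m : ℕ) (hm : 1 ≤ m)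
      (h : ∀ ε : ℚ_[p], ε ≠ 0 → ‖ε‖ ≤ 1 →
        Res s (fun x => x i ^ (m - 1) * F (Function.update x i (ε * x i ^ m)))) : Res s F

theorem norm_p_le : ‖(p : ℚ_[p])‖ ≤ 1 := by
  exact Padic.norm_p_lt_one.le

theorem Bx_update {x : ι → ℚ_[p]} (hx : x ∈ Bx p ι) (i : ι) {t : ℚ_[p]} (ht : ‖t‖ ≤ 1) :
    Function.update x i t ∈ Bx p ι := by
  intro j
  by_cases h : j = i
  · subst h; simpa using ht
  · simpa [h] using hx j

theorem norm_add_le_one {a b : ℚ_[p]} (ha : ‖a‖ ≤ 1) (hb : ‖b‖ ≤ 1) : ‖a + b‖ ≤ 1 :=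
  (Padic.nonarchimedean a b).trans (max_le ha hb)

theorem norm_mul_le_one {a b : ℚ_[p]} (ha : ‖a‖ ≤ 1) (hb : ‖b‖ ≤ 1) : ‖a * b‖ ≤ 1 := by
  rw [norm_mul]; exact mul_le_one₀ ha (norm_nonneg _) hb

theorem norm_pow_le_one {a : ℚ_[p]} (ha : ‖a‖ ≤ 1) (n : ℕ) : ‖a ^ n‖ ≤ 1 := by
  rw [norm_pow]; exact pow_le_one₀ (norm_nonneg _) ha

theorem Bx_isOpen : IsOpen (Bx p ι) := by
  have : Bx p ι = ⋂ i, (fun x : ι → ℚ_[p] => x i) ⁻¹' (Metric.closedBall 0 1) := by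
    ext x; simp [Bx]
  rw [this]
  apply isOpen_iInter_of_finite
  intro i
  exact (IsUltrametricDist.isOpen_closedBall _ one_ne_zero).preimage (continuous_apply i)

theorem Bx_mem_nhds {x : ι → ℚ_[p]} (hx : x ∈ Bx p ι) : Bx p ι ∈ 𝓝 x := Bx_isOpen.mem_nhds hx

theorem Res.congr {s : Finset ι} {F : (ι → ℚ_[p]) → ℚ_[p]} (h : Res s F) :
    ∀ {G : (ι → ℚ_[p]) → ℚ_[p]}, (∀ x ∈ Bx p ι, ‖F x‖ = ‖G x‖) → Res s G := by
  induction h with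
  | mono F h =>
    intro G hG
    obtain ⟨α, κ, hκ, h⟩ := h
    exact .mono _ ⟨α, κ, hκ, fun x hx => by rw [← hG x hx, h x hx]⟩
  | sub F i hi h ih =>
    intro G hG
    exact .sub _ i hi fun b hb => ih b hb fun x hx =>
      hG _ (Bx_update hx i (norm_add_le_one hb (norm_mul_le_one norm_p_le (hx i))))
  | blow F i j hi hj hij h1 h2 ih1 ih2 =>
    intro G hG
    refine .blow _ i j hi hj hij (ih1 fun x hx => ?_) (ih2 fun x hx => ?_)
    · rw [norm_mul, norm_mul, hG _ (Bx_update hx j (norm_mul_le_one (hx i) (hx j)))]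
    · rw [norm_mul, norm_mul, hG _ (Bx_update hx i
        (norm_mul_le_one (norm_mul_le_one norm_p_le (hx j)) (hx i)))]
  | shift F i hi φ hφ hφi hφs hφ1 h ih =>
    intro G hG
    exact .shift _ i hi φ hφ hφi hφs hφ1 (ih fun x hx =>
      hG _ (Bx_update hx i (norm_add_le_one (hx i) (hφ1 x hx))))
  | pow F i hi m hm h ih =>
    intro G hG
    refine .pow _ i hi m hm fun ε hε hε1 => ih ε hε hε1 fun x hx => ?_
    rw [norm_mul, norm_mul, hG _ (Bx_update hx i (norm_mul_le_one hε1 (norm_pow_le_one (hx i) m)))]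

/-- abstract properties of moves -/
structure IsMove (s : Finset ι) (π : (ι → ℚ_[p]) → (ι → ℚ_[p])) (J : (ι → ℚ_[p]) → ℚ_[p]) : Prop where
  maps : ∀ x ∈ Bx p ι, π x ∈ Bx p ι
  vert : ∀ i, i ∉ s → ∀ x t, π (Function.update x i t) = Function.update (π x) i t
  an : AnalyticOnNhd ℚ_[p] π (Bx p ι)
  jan : LA J
  jdep : DependsOn J (s : Set ι)
  dep : ∀ x y : ι → ℚ_[p], (∀ i ∈ s, x i = y i) → ∀ i ∈ s, π x i = π y i

theorem isMove_update {s : Finset ι} {i : ι} (hi : i ∈ s) {G J : (ι → ℚ_[p]) → ℚ_[p]}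
    (hG : LA G) (hJ : LA J) (hGs : DependsOn G (s : Set ι)) (hJs : DependsOn J (s : Set ι))
    (hG1 : ∀ x ∈ Bx p ι, ‖G x‖ ≤ 1) : IsMove s (fun x => Function.update x i (G x)) J where
  maps x hx := Bx_update hx i (hG1 x hx)
  vert j hj x t := by
    have hij : i ≠ j := fun h => hj (h ▸ hi)
    have : G (Function.update x j t) = G x := hGs fun k hk => by
      have : k ≠ j := fun h => hj (h ▸ hk)
      simp [this]
    rw [this, Function.update_comm hij]
  an x hx := analyticAt_update i (hG x hx)
  jan := hJ
  jdep := hJs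
  dep x y h j hj := by
    by_cases hji : j = i
    · subst hji; simpa using hGs fun k hk => h k hk
    · simpa [hji] using h j hj

theorem LA_coord (i : ι) : LA (fun x : ι → ℚ_[p] => x i) := fun x _ => analyticAt_coord x i
theorem LA_const (c : ℚ_[p]) : LA (fun _ : ι → ℚ_[p] => c) := fun _ _ => analyticAt_const
theorem LA.mul {F G : (ι → ℚ_[p]) → ℚ_[p]} (hF : LA F) (hG : LA G) : LA (fun x => F x * G x) :=
  fun x hx => (hF x hx).mul (hG x hx)
theorem LA.add {F G : (ι → ℚ_[p]) → ℚ_[p]} (hF : LA F) (hG : LA G) : LA (fun x => F x + G x) :=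
  fun x hx => (hF x hx).add (hG x hx)
theorem LA.sub {F G : (ι → ℚ_[p]) → ℚ_[p]} (hF : LA F) (hG : LA G) : LA (fun x => F x - G x) :=
  fun x hx => (hF x hx).sub (hG x hx)
theorem LA.pow {F : (ι → ℚ_[p]) → ℚ_[p]} (hF : LA F) (n : ℕ) : LA (fun x => F x ^ n) :=
  fun x hx => (hF x hx).pow n
theorem LA.prod {κ : Type} (t : Finset κ) {F : κ → (ι → ℚ_[p]) → ℚ_[p]} (hF : ∀ k ∈ t, LA (F k)) :
    LA (fun x => ∏ k ∈ t, F k x) :=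
  fun x hx => Finset.analyticAt_fun_prod t fun k hk => hF k hk x hx
theorem LA.sum {κ : Type} (t : Finset κ) {F : κ → (ι → ℚ_[p]) → ℚ_[p]} (hF : ∀ k ∈ t, LA (F k)) :
    LA (fun x => ∑ k ∈ t, F k x) :=
  fun x hx => Finset.analyticAt_fun_sum t fun k hk => hF k hk x hx
theorem LA.comp_move {s : Finset ι} {π J} {F : (ι → ℚ_[p]) → ℚ_[p]} (hF : LA F) (h : IsMove s π J) :
    LA (fun x => F (π x)) :=
  fun x hx => AnalyticAt.comp (hF _ (h.maps x hx)) (h.an x hx)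

theorem dep_const (s : Set ι) (c : ℚ_[p]) : DependsOn (fun _ : ι → ℚ_[p] => c) s := fun _ _ _ => rfl
theorem dep_coord {s : Set ι} {i : ι} (hi : i ∈ s) : DependsOn (fun x : ι → ℚ_[p] => x i) s :=
  fun _ _ h => h i hi
theorem dep_op₂ {s : Set ι} {F G : (ι → ℚ_[p]) → ℚ_[p]} (o : ℚ_[p] → ℚ_[p] → ℚ_[p])
    (hF : DependsOn F s) (hG : DependsOn G s) : DependsOn (fun x => o (F x) (G x)) s :=
  fun _ _ h => by simp only [hF h, hG h]
theorem dep_op₁ {s : Set ι} {F : (ι → ℚ_[p]) → ℚ_[p]} (o : ℚ_[p] → ℚ_[p])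
    (hF : DependsOn F s) : DependsOn (fun x => o (F x)) s :=
  fun _ _ h => by simp only [hF h]
theorem dep_prod {κ : Type} {s : Set ι} (t : Finset κ) {F : κ → (ι → ℚ_[p]) → ℚ_[p]}
    (hF : ∀ k ∈ t, DependsOn (F k) s) : DependsOn (fun x => ∏ k ∈ t, F k x) s :=
  fun _ _ h => Finset.prod_congr rfl fun k hk => hF k hk h
theorem dep_move {s : Finset ι} {π J} {F : (ι → ℚ_[p]) → ℚ_[p]} (hF : DependsOn F (s : Set ι))
    (h : IsMove s π J) : DependsOn (fun x => F (π x)) (s : Set ι) :=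
  fun x y hxy => hF fun i hi => h.dep x y hxy i hi

theorem Res.transfer {s' s : Finset ι} (hs : s' ⊆ s)
    (Rel : ((ι → ℚ_[p]) → ℚ_[p]) → ((ι → ℚ_[p]) → ℚ_[p]) → Prop)
    (hmove : ∀ π J H F, IsMove s' π J → Rel H F → Rel (fun x => J x * H (π x)) (fun x => J x * F (π x)))
    (hbase : ∀ H F, Mono H → Rel H F → Res s F) {H : (ι → ℚ_[p]) → ℚ_[p]} (hH : Res s' H) :
    ∀ F, Rel H F → Res s F := by
  induction hH with
  | mono H h => exact fun F hF => hbase H F h hF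
  | sub H i hi h ih =>
    intro F hF
    refine .sub _ i (hs hi) fun b hb => ih b hb _ ?_
    have := hmove (fun x => Function.update x i (b + p * x i)) (fun _ => 1) H F
      (isMove_update hi ((LA_const _).add ((LA_const _).mul (LA_coord i))) (LA_const _)
        (dep_op₁ (fun y => b + (p : ℚ_[p]) * y) (dep_coord hi)) (dep_const _ _)
        (fun x hx => norm_add_le_one hb (norm_mul_le_one norm_p_le (hx i)))) hF
    simpa using this
  | blow H i j hi hj hij h1 h2 ih1 ih2 =>
    intro F hF
    refine .blow _ i j (hs hi) (hs hj) hij (ih1 _ ?_) (ih2 _ ?_)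
    · exact hmove (fun x => Function.update x j (x i * x j)) (fun x => x i) H F
        (isMove_update hj ((LA_coord i).mul (LA_coord j)) (LA_coord i)
          (dep_op₂ (· * ·) (dep_coord hi) (dep_coord hj)) (dep_coord hi)
          (fun x hx => norm_mul_le_one (hx i) (hx j))) hF
    · exact hmove (fun x => Function.update x i (p * x j * x i)) (fun x => x j) H F
        (isMove_update hi (((LA_const _).mul (LA_coord j)).mul (LA_coord i)) (LA_coord j)
          (dep_op₂ (fun a b => p * a * b) (dep_coord hj) (dep_coord hi)) (dep_coord hj)
          (fun x hx => norm_mul_le_one (norm_mul_le_one norm_p_le (hx j)) (hx i))) hF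
  | shift H i hi φ hφ hφi hφs hφ1 h ih =>
    intro F hF
    refine .shift _ i (hs hi) φ hφ hφi (fun x y hxy => hφs fun k hk => hxy k (hs hk)) hφ1 (ih _ ?_)
    have := hmove (fun x => Function.update x i (x i + φ x)) (fun _ => 1) H F
      (isMove_update hi ((LA_coord i).add hφ) (LA_const _)
        (dep_op₂ (· + ·) (dep_coord hi) hφs) (dep_const _ _)
        (fun x hx => norm_add_le_one (hx i) (hφ1 x hx))) hF
    simpa using this
  | pow H i hi m hm h ih =>
    intro F hF
    refine .pow _ i (hs hi) m hm fun ε hε hε1 => ih ε hε hε1 _ ?_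
    exact hmove (fun x => Function.update x i (ε * x i ^ m)) (fun x => x i ^ (m - 1)) H F
        (isMove_update hi ((LA_const _).mul ((LA_coord i).pow m)) ((LA_coord i).pow _)
          (dep_op₁ (fun a => ε * a ^ m) (dep_coord hi)) (dep_op₁ (fun a => a ^ (m-1)) (dep_coord hi))
          (fun x hx => norm_mul_le_one hε1 (norm_pow_le_one (hx i) m))) hF

/-- box map -/
noncomputable def bx (c : ι → ℚ_[p]) (e : ι → ℕ) (x : ι → ℚ_[p]) : ι → ℚ_[p] := fun i => c i + (p : ℚ_[p]) ^ e i * x i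

theorem Res.recenter1 {s : Finset ι} {F : (ι → ℚ_[p]) → ℚ_[p]} {c : ι → ℚ_[p]} {e : ι → ℕ} {i : ι} (hi : i ∈ s)
    {b : ℚ_[p]} (hb : ‖b‖ ≤ 1) (h : Res s (fun x => F (bx c e x))) :
    Res s (fun x => F (bx (Function.update c i (c i + (p : ℚ_[p]) ^ e i * b)) e x)) := by
  refine .shift _ i hi (fun _ => -b) (LA_const _) (fun _ _ => rfl) (dep_const _ _) (fun x _ => by simpa using hb) ?_
  convert h using 3 with x
  ext j
  by_cases hj : j = i
  · subst hj; simp [bx]; ring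
  · simp [bx, hj]

theorem Res.recenter {s t : Finset ι} (hts : t ⊆ s) {F : (ι → ℚ_[p]) → ℚ_[p]} {e : ι → ℕ} :
    ∀ {c b : ι → ℚ_[p]}, (∀ i ∈ t, ‖b i‖ ≤ 1) → Res s (fun x => F (bx c e x)) →
    Res s (fun x => F (bx (fun i => if i ∈ t then c i + (p : ℚ_[p]) ^ e i * b i else c i) e x)) := by
  induction t using Finset.induction_on with
  | empty => intro c b _ h; simpa using h
  | insert k t hk ih =>
    intro c b hb h
    have h1 := ih (fun i hi => hts (Finset.mem_insert_of_mem hi)) (c := c) (b := b) (fun i hi => hb i (by simp [hi])) h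
    have h2 := Res.recenter1 (hts (Finset.mem_insert_self k t)) (hb k (by simp)) h1
    convert h2 using 4 with x
    ext j
    by_cases hj : j = k
    · subst hj; simp [hk]
    · simp [hj]

theorem Res.refine {s t : Finset ι} (hts : t ⊆ s) {F : (ι → ℚ_[p]) → ℚ_[p]} :
    ∀ {c : ι → ℚ_[p]} {e : ι → ℕ}, (∀ b ∈ Bx p ι, Res s (fun x => F (bx
      (fun i => if i ∈ t then c i + (p : ℚ_[p]) ^ e i * b i else c i)
      (fun i => if i ∈ t then e i + 1 else e i) x))) →
    Res s (fun x => F (bx c e x)) := by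
  induction t using Finset.induction_on with
  | empty => intro c e h; simpa using h 0 (fun i => by simp)
  | insert k t hk ih =>
    intro c e h
    refine .sub _ k (hts (Finset.mem_insert_self k t)) fun b hb => ?_
    have := ih (fun i hi => hts (Finset.mem_insert_of_mem hi))
      (c := Function.update c k (c k + (p : ℚ_[p]) ^ e k * b)) (e := Function.update e k (e k + 1)) ?_
    · convert this using 3 with x
      ext j
      by_cases hj : j = k
      · subst hj; simp [bx]; ring
      · simp [bx, hj]
    · intro b' hb'
      convert h (Function.update b' k b) (Bx_update hb' k hb) using 4 with x
      · ext j
        by_cases hj : j = k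
        · subst hj; simp [hk]
        · simp [hj]
      · ext j
        by_cases hj : j = k
        · subst hj; simp [hk]
        · simp [hj]

theorem konig (Good : (ι → ℚ_[p]) → ℕ → Prop) (t : Finset ι)
    (hrec : ∀ a ∈ Bx p ι, ∀ m, (∀ b ∈ Bx p ι,
      Good (fun i => if i ∈ t then a i + (p : ℚ_[p]) ^ m * b i else a i) (m + 1)) → Good a m)
    (hcong : ∀ a ∈ Bx p ι, ∀ b ∈ Bx p ι, ∀ m, Good a m →
      Good (fun i => if i ∈ t then a i + (p : ℚ_[p]) ^ m * b i else a i) m)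
    (hloc : ∀ a ∈ Bx p ι, ∃ m, Good a m) : ∀ a ∈ Bx p ι, Good a 0 := by
  intro a ha
  by_contra hcon
  let St := {c : (ι → ℚ_[p]) × ℕ // c.1 ∈ Bx p ι ∧ ¬ Good c.1 c.2}
  have step : ∀ c : St, ∃ b ∈ Bx p ι,
      ¬ Good (fun i => if i ∈ t then c.1.1 i + (p : ℚ_[p]) ^ c.1.2 * b i else c.1.1 i) (c.1.2 + 1) := by
    intro c
    by_contra hh
    push Not at hh
    exact c.2.2 (hrec _ c.2.1 _ hh)
  choose b hb hbad using step
  have hmem : ∀ a ∈ Bx p ι, ∀ b ∈ Bx p ι, ∀ m : ℕ,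
      (fun i => if i ∈ t then a i + (p : ℚ_[p]) ^ m * b i else a i) ∈ Bx p ι := by
    intro a ha b hb m i
    by_cases h : i ∈ t
    · simpa [h] using norm_add_le_one (ha i) (norm_mul_le_one (norm_pow_le_one norm_p_le m) (hb i))
    · simpa [h] using ha i
  let next : St → St := fun c => ⟨((fun i => if i ∈ t then c.1.1 i + (p : ℚ_[p]) ^ c.1.2 * b c i else c.1.1 i), c.1.2 + 1), hmem _ c.2.1 _ (hb c) c.1.2, hbad c⟩
  let seq : ℕ → St := fun n => next^[n] ⟨(a, 0), ha, hcon⟩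
  have hseq : ∀ n, seq (n + 1) = next (seq n) := fun n => Function.iterate_succ_apply' _ _ _
  have hlev : ∀ n, (seq n).1.2 = n := by
    intro n
    induction n with
    | zero => rfl
    | succ n ih => rw [hseq]; simp [next, ih]
  have hd : ∀ n k i, ‖(seq (n + k)).1.1 i - (seq n).1.1 i‖ ≤ ‖(p : ℚ_[p]) ^ n‖ := by
    intro n k i
    induction k with
    | zero => simp
    | succ k ih =>
      have e1 : (seq (n + (k + 1))).1.1 i - (seq n).1.1 i =
        ((seq (n + k + 1)).1.1 i - (seq (n + k)).1.1 i) + ((seq (n + k)).1.1 i - (seq n).1.1 i) := by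
        rw [← add_assoc]; ring
      rw [e1]
      refine (Padic.nonarchimedean _ _).trans (max_le ?_ ih)
      rw [hseq]
      simp only [next, hlev]
      split_ifs with h
      · rw [add_sub_cancel_left, pow_add, norm_mul, norm_mul]
        calc _ ≤ ‖(p : ℚ_[p]) ^ n‖ * 1 * 1 := by
              gcongr
              · exact norm_pow_le_one norm_p_le k
              · exact hb _ i
          _ = _ := by ring
      · simp
  have hdn : ∀ n i, i ∉ t → (seq n).1.1 i = a i := by
    intro n i hi
    induction n with
    | zero => rfl
    | succ n ih => rw [hseq]; simp [next, hi, ih]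
  have hlim0 : Tendsto (fun n : ℕ => ‖(p : ℚ_[p]) ^ n‖) atTop (𝓝 0) := by
    simp only [norm_pow]
    exact tendsto_pow_atTop_nhds_zero_of_lt_one (norm_nonneg _) Padic.norm_p_lt_one
  have hc : ∀ i, ∃ l, Tendsto (fun n => (seq n).1.1 i) atTop (𝓝 l) := by
    intro i
    apply cauchySeq_tendsto_of_complete
    rw [Metric.cauchySeq_iff']
    intro ε hε
    obtain ⟨N, hN⟩ := ((hlim0.eventually (gt_mem_nhds hε))).exists
    refine ⟨N, fun n hn => ?_⟩
    obtain ⟨k, rfl⟩ := Nat.exists_eq_add_of_le hn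
    rw [dist_eq_norm]
    exact (hd N k i).trans_lt hN
  choose l hl using hc
  have hdl : ∀ n i, ‖l i - (seq n).1.1 i‖ ≤ ‖(p : ℚ_[p]) ^ n‖ := by
    intro n i
    have : Tendsto (fun k => ‖(seq (n + k)).1.1 i - (seq n).1.1 i‖) atTop (𝓝 ‖l i - (seq n).1.1 i‖) := by
      have h1 := (hl i).comp (tendsto_add_atTop_nat n)
      have h2 : (fun k => (seq (n + k)).1.1 i) = (fun n => (seq n).1.1 i) ∘ fun k => k + n := by
        ext k; simp [add_comm]
      rw [← h2] at h1
      exact (h1.sub_const _).norm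
    exact le_of_tendsto this (Eventually.of_forall fun k => hd n k i)
  have hlB : l ∈ Bx p ι := by
    intro i
    have := hdl 0 i
    have e : l i = (l i - (seq 0).1.1 i) + (seq 0).1.1 i := by ring
    rw [e]
    exact norm_add_le_one (by simpa using this) ((seq 0).2.1 i)
  obtain ⟨m, hm⟩ := hloc l hlB
  have hpm : (p : ℚ_[p]) ^ m ≠ 0 := pow_ne_zero _ (by exact_mod_cast (Fact.out : p.Prime).ne_zero)
  have := hcong l hlB (fun i => ((seq m).1.1 i - l i) / (p : ℚ_[p]) ^ m) (fun i => by
    rw [norm_div, div_le_one (norm_pos_iff.2 hpm), norm_sub_rev]; exact hdl m i) m hm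
  have e : (fun i => if i ∈ t then l i + (p : ℚ_[p]) ^ m * (((seq m).1.1 i - l i) / (p : ℚ_[p]) ^ m) else l i)
      = (seq m).1.1 := by
    ext i
    split_ifs with h
    · field_simp; ring
    · rw [hdn m i h]
      exact tendsto_nhds_unique (hl i) (by simp only [hdn _ i h]; exact tendsto_const_nhds)
  rw [e] at this
  have h3 := (seq m).2.2
  rw [hlev] at h3
  exact h3 this

end res
end IdealZeta
end PartB1

section PartB2
open Filter Topology
open scoped NNReal ENNReal

namespace IdealZeta

set_option linter.unusedSectionVars false

section res
variable {p : ℕ} [Fact p.Prime] {ι : Type} [Fintype ι] [DecidableEq ι]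

/-- restrict a center to `t` -/
noncomputable def ctr (t : Finset ι) (a : ι → ℚ_[p]) : ι → ℚ_[p] := fun i => if i ∈ t then a i else 0
/-- exponent `m` on `t` -/
def exq (t : Finset ι) (m : ℕ) : ι → ℕ := fun i => if i ∈ t then m else 0

theorem bx_zero (x : ι → ℚ_[p]) : bx 0 0 x = x := by ext i; simp [bx]

theorem Res.localize {s t : Finset ι} (hts : t ⊆ s) {G : (ι → ℚ_[p]) → ℚ_[p]}
    (h : ∀ a ∈ Bx p ι, ∃ m, Res s (fun x => G (bx (ctr t a) (exq t m) x))) : Res s G := by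
  have key := konig (fun a m => Res s (fun x => G (bx (ctr t a) (exq t m) x))) t ?_ ?_ h 0 (fun i => by simp)
  · convert key using 3 with x
    conv_lhs => rw [← bx_zero x]
    congr 1
    · ext i; simp [ctr]
    · ext i; simp [exq]
  · intro a ha m hb
    apply Res.refine hts
    intro b hbB
    convert hb b hbB using 4 with x
    · ext i; by_cases hi : i ∈ t <;> simp [ctr, exq, hi]
    · ext i; by_cases hi : i ∈ t <;> simp [exq, hi]
  · intro a ha b hb m hm
    have := Res.recenter hts (b := b) (fun i _ => hb i) hm
    convert this using 4 with x
    ext i; by_cases hi : i ∈ t <;> simp [ctr, exq, hi]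

theorem digit {b : ℚ_[p]} (hb : ‖b‖ ≤ 1) : ∃ k < p, ∃ b' : ℚ_[p], ‖b'‖ ≤ 1 ∧ b = k + p * b' := by
  obtain ⟨B, rfl⟩ : ∃ B : ℤ_[p], (B : ℚ_[p]) = b := ⟨⟨b, hb⟩, rfl⟩
  obtain ⟨n, hn, h⟩ := PadicInt.exists_mem_range B
  rw [PadicInt.maximalIdeal_eq_span_p, Ideal.mem_span_singleton] at h
  obtain ⟨c, hc⟩ := h
  refine ⟨n, hn, c, c.2, ?_⟩
  have := congrArg (fun z : ℤ_[p] => (z : ℚ_[p])) hc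
  rw [PadicInt.coe_sub, PadicInt.coe_mul, PadicInt.coe_natCast, PadicInt.coe_natCast] at this
  rw [← this]
  simp

/-- exponent `m` at `i0`, `m'` elsewhere -/
def ex2 (i0 : ι) (m m' : ℕ) : ι → ℕ := fun i => if i = i0 then m else m'

theorem bx_congr {s : Finset ι} {G : (ι → ℚ_[p]) → ℚ_[p]} (hG : DependsOn G (s : Set ι))
    {c c' : ι → ℚ_[p]} {e e' : ι → ℕ} (hc : ∀ i ∈ s, c i = c' i) (he : ∀ i ∈ s, e i = e' i) :
    (fun x => G (bx c e x)) = fun x => G (bx c' e' x) := by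
  ext x
  apply hG
  intro i hi
  simp [bx, hc i hi, he i hi]

theorem twoStage {s' : Finset ι} {i0 : ι} (hi0 : i0 ∉ s') {G : (ι → ℚ_[p]) → ℚ_[p]}
    (hG : DependsOn G (insert i0 s' : Finset ι))
    (h : ∀ a ∈ Bx p ι, ∃ m m1, ∀ m' ≥ m1, Res (insert i0 s') (fun x => G (bx a (ex2 i0 m m') x))) :
    Res (insert i0 s') G := by
  apply Res.localize (t := s') (Finset.subset_insert _ _)
  have key := konig (fun a m => ∃ m1, ∀ m' ≥ m1, Res (insert i0 s') (fun x => G (bx a (ex2 i0 m m') x)))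
    {i0} ?_ ?_ h
  · intro a ha
    obtain ⟨m1, hm1⟩ := key (Function.update a i0 0) (Bx_update ha i0 (by simp))
    refine ⟨m1, ?_⟩
    convert hm1 m1 le_rfl using 1
    apply bx_congr hG
    · intro i hi
      by_cases hii : i = i0
      · subst hii; simp [ctr, hi0]
      · have : i ∈ s' := by simpa [hii] using hi
        simp [ctr, this, hii]
    · intro i hi
      by_cases hii : i = i0
      · subst hii; simp [exq, ex2, hi0]
      · have : i ∈ s' := by simpa [hii] using hi
        simp [exq, ex2, this, hii]
  · intro a ha m hb
    have hk : ∀ k : ℕ, ∃ m1, ∀ m' ≥ m1, Res (insert i0 s')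
        (fun x => G (bx (fun i => if i ∈ ({i0} : Finset ι) then a i + (p : ℚ_[p]) ^ m * k else a i) (ex2 i0 (m+1) m') x)) :=
      fun k => hb (fun _ => (k : ℚ_[p])) (fun i => by
        simpa using Padic.norm_int_le_one (p := p) k)
    choose f hf using hk
    refine ⟨(Finset.range p).sup f, fun m' hm' => ?_⟩
    apply Res.refine (t := {i0}) (by simp)
    intro b hbB
    obtain ⟨k, hk, b', hb', hbk⟩ := digit (hbB i0)
    have h1 := hf k m' ((Finset.le_sup (f := f) (Finset.mem_range.2 hk)).trans hm')
    have h2 := Res.recenter (t := {i0}) (by simp) (b := fun _ => b') (fun _ _ => hb') h1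
    convert h2 using 4 with x
    · ext i
      by_cases hi : i = i0
      · subst hi; simp [ex2, hbk]; ring
      · simp [hi]
    · ext i
      by_cases hi : i = i0
      · subst hi; simp [ex2]
      · simp [hi, ex2]
  · rintro a ha b hb m ⟨m1, hm1⟩
    refine ⟨m1, fun m' hm' => ?_⟩
    have h2 := Res.recenter (t := {i0}) (by simp) (b := b) (fun i _ => hb i) (hm1 m' hm')
    convert h2 using 4 with x
    ext i
    by_cases hi : i = i0
    · subst hi; simp [ex2]
    · simp [hi]

end res
end IdealZeta
end PartB2

section PartB3
open Filter Topology
open scoped NNReal ENNReal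

namespace IdealZeta

set_option linter.unusedSectionVars false

section res
variable {p : ℕ} [Fact p.Prime] {ι : Type} [Fintype ι] [DecidableEq ι]

theorem p_ne : (p : ℚ_[p]) ≠ 0 := by exact_mod_cast (Fact.out : p.Prime).ne_zero

theorem eventually_of_ne {g1 g2 : (ι → ℚ_[p]) → ℝ} {a : ι → ℚ_[p]} (i : ι)
    (h1 : ∀ᶠ x in 𝓝 a, ContinuousAt g1 x) (h2 : ∀ᶠ x in 𝓝 a, ContinuousAt g2 x)
    (h : ∀ᶠ x in 𝓝 a, x i ≠ 0 → g1 x = g2 x) : ∀ᶠ x in 𝓝 a, g1 x = g2 x := by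
  filter_upwards [h1, h2, h.eventually_nhds] with x c1 c2 hx
  by_cases hxi : x i = 0
  · have hup : Tendsto (fun t => Function.update x i t) (𝓝[≠] (0 : ℚ_[p])) (𝓝 x) := by
      have hc : Continuous (fun t : ℚ_[p] => Function.update x i t) := by fun_prop
      have := hc.tendsto 0
      rw [← hxi, Function.update_eq_self, hxi] at this
      exact this.mono_left nhdsWithin_le_nhds
    apply tendsto_nhds_unique_of_eventuallyEq (c1.tendsto.comp hup) (c2.tendsto.comp hup)
    filter_upwards [hup.eventually hx, self_mem_nhdsWithin] with t ht ht'
    exact ht (by simpa using ht')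
  · exact hx.self_of_nhds hxi

theorem germ_factor_aux {κ : Type} [DecidableEq κ] (t : Finset κ) (a : ι → ℚ_[p]) (n : ℕ) :
    ∀ (f : κ → (ι → ℚ_[p]) → ℚ_[p]) (α : ι → ℕ) (C : ℝ), (∑ i, α i = n) →
    (∀ i, α i ≠ 0 → a i = 0) → 0 < C → (∀ k ∈ t, AnalyticAt ℚ_[p] (f k) a) →
    (∀ᶠ x in 𝓝 a, ‖∏ k ∈ t, f k x‖ = C * ∏ i, ‖x i‖ ^ α i) →
    ∀ k ∈ t, ∃ (γ : ι → ℕ) (g : (ι → ℚ_[p]) → ℚ_[p]), (∀ i, γ i ≠ 0 → a i = 0) ∧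
      AnalyticAt ℚ_[p] g a ∧ g a ≠ 0 ∧ ∀ᶠ x in 𝓝 a, f k x = (∏ i, x i ^ γ i) * g x := by
  induction n with
  | zero =>
    intro f α C hα ha hC hf h k hk
    have hα0 : ∀ i, α i = 0 := by simpa using hα
    refine ⟨0, f k, by simp, hf k hk, ?_, by simp⟩
    intro h0
    have := h.self_of_nhds
    rw [Finset.prod_eq_zero hk h0] at this
    simp [hα0] at this
    exact hC.ne this
  | succ n ih =>
    intro f α C hα ha hC hf h
    obtain ⟨i, hi⟩ : ∃ i, α i ≠ 0 := by
      by_contra hh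
      push Not at hh
      simp [hh] at hα
    have hai := ha i hi
    have hupd : Function.update a i 0 = a := by rw [← hai, Function.update_eq_self]
    have hup : AnalyticAt ℚ_[p] (fun x : ι → ℚ_[p] => Function.update x i (0:ℚ_[p])) a :=
      analyticAt_update i analyticAt_const
    have hup' : Tendsto (fun x : ι → ℚ_[p] => Function.update x i (0:ℚ_[p])) (𝓝 a) (𝓝 a) := by
      have := hup.continuousAt.tendsto
      rwa [hupd] at this
    have hz : ∀ᶠ x in 𝓝 a, ∏ k ∈ t, f k (Function.update x i 0) = 0 := by
      filter_upwards [hup'.eventually h] with x hx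
      rw [← norm_eq_zero, hx, Finset.prod_eq_zero (Finset.mem_univ i), mul_zero]
      simp [hi]
    have han : ∀ k ∈ t, AnalyticAt ℚ_[p] (fun x => f k (Function.update x i 0)) a := fun k hk =>
      AnalyticAt.fun_comp (g := f k) (by rw [hupd]; exact hf k hk) hup
    obtain ⟨k0, hk0, hk0z⟩ := domain_prod t han hz
    obtain ⟨g, hg, hgf⟩ := division0 (hf k0 hk0) i
    let f' : κ → (ι → ℚ_[p]) → ℚ_[p] := Function.update f k0 g
    have hfg : ∀ᶠ x in 𝓝 a, f k0 x = x i * g x := by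
      filter_upwards [hk0z, hgf] with x h1 h2
      rw [h2, hai, h1]; simp
    have hf'an : ∀ k ∈ t, AnalyticAt ℚ_[p] (f' k) a := by
      intro k hk
      by_cases hkk : k = k0
      · subst hkk; simpa [f'] using hg
      · simpa [f', hkk] using hf k hk
    let α' := Function.update α i (α i - 1)
    have hprodα : ∀ x : ι → ℚ_[p], ∏ j, ‖x j‖ ^ α j = ‖x i‖ * ∏ j, ‖x j‖ ^ α' j := by
      intro x
      rw [← Finset.mul_prod_erase Finset.univ _ (Finset.mem_univ i),
        ← Finset.mul_prod_erase Finset.univ (fun j => ‖x j‖ ^ α' j) (Finset.mem_univ i)]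
      simp only [α', Function.update_self]
      rw [← mul_assoc, ← pow_succ', Nat.sub_add_cancel (Nat.one_le_iff_ne_zero.2 hi)]
      congr 1
      apply Finset.prod_congr rfl
      intro j hj
      rw [Function.update_of_ne (Finset.ne_of_mem_erase hj)]
    have hsum : ∑ j, α' j = n := by
      have h1 := Finset.add_sum_erase Finset.univ α (Finset.mem_univ i)
      have h2 := Finset.add_sum_erase Finset.univ α' (Finset.mem_univ i)
      have h3 : ∑ j ∈ Finset.univ.erase i, α' j = ∑ j ∈ Finset.univ.erase i, α j :=
        Finset.sum_congr rfl fun j hj => by simp [α', Finset.ne_of_mem_erase hj]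
      have h4 : α' i = α i - 1 := by simp [α']
      omega
    have hα'a : ∀ j, α' j ≠ 0 → a j = 0 := by
      intro j hj
      by_cases hji : j = i
      · rw [hji, hai]
      · exact ha j (by simpa [α', hji] using hj)
    have hprodf : ∀ᶠ x in 𝓝 a, ∏ k ∈ t, f k x = x i * ∏ k ∈ t, f' k x := by
      filter_upwards [hfg] with x hx
      rw [← Finset.mul_prod_erase t _ hk0, ← Finset.mul_prod_erase t (fun k => f' k x) hk0, hx]
      simp only [f', Function.update_self]
      rw [mul_assoc]
      congr 2
      apply Finset.prod_congr rfl
      intro j hj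
      rw [Function.update_of_ne (Finset.ne_of_mem_erase hj)]
    have hnew : ∀ᶠ x in 𝓝 a, ‖∏ k ∈ t, f' k x‖ = C * ∏ j, ‖x j‖ ^ α' j := by
      apply eventually_of_ne i
      · filter_upwards [(Finset.analyticAt_fun_prod t hf'an).eventually_continuousAt] with x hx
        exact hx.norm
      · refine Eventually.of_forall fun x => ?_
        exact (continuous_const.mul (continuous_finsetProd _ fun j _ =>
          ((continuous_apply j).norm.pow _))).continuousAt
      · filter_upwards [h, hprodf] with x h1 h2 h3
        rw [h2, norm_mul, hprodα] at h1
        have : ‖x i‖ ≠ 0 := by simpa using h3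
        apply mul_left_cancel₀ this
        rw [h1]; ring
    have IH := ih f' α' C hsum hα'a hC hf'an hnew
    intro k hk
    obtain ⟨γ, g', h1, h2, h3, h4⟩ := IH k hk
    by_cases hkk : k = k0
    · subst hkk
      refine ⟨Function.update γ i (γ i + 1), g', ?_, h2, h3, ?_⟩
      · intro j hj
        by_cases hji : j = i
        · rw [hji, hai]
        · exact h1 j (by simpa [hji] using hj)
      · filter_upwards [h4, hfg] with x hx hx2
        have e : f' k x = g x := by simp [f']
        rw [hx2, ← e, hx, ← mul_assoc]
        congr 1
        rw [← Finset.mul_prod_erase Finset.univ _ (Finset.mem_univ i),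
          ← Finset.mul_prod_erase Finset.univ (fun j => x j ^ (Function.update γ i (γ i + 1)) j) (Finset.mem_univ i)]
        simp only [Function.update_self]
        rw [← mul_assoc, ← pow_succ']
        congr 1
        apply Finset.prod_congr rfl
        intro j hj
        rw [Function.update_of_ne (Finset.ne_of_mem_erase hj)]
    · refine ⟨γ, g', h1, h2, h3, ?_⟩
      simpa [f', hkk] using h4

theorem germ_factor {κ : Type} (t : Finset κ) (a : ι → ℚ_[p])
    (f : κ → (ι → ℚ_[p]) → ℚ_[p]) (α : ι → ℕ) (C : ℝ) (hC : 0 < C)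
    (hf : ∀ k ∈ t, AnalyticAt ℚ_[p] (f k) a)
    (h : ∀ᶠ x in 𝓝 a, ‖∏ k ∈ t, f k x‖ = C * ∏ i, ‖x i‖ ^ α i) :
    ∀ k ∈ t, ∃ (γ : ι → ℕ) (g : (ι → ℚ_[p]) → ℚ_[p]), (∀ i, γ i ≠ 0 → a i = 0) ∧
      AnalyticAt ℚ_[p] g a ∧ g a ≠ 0 ∧ ∀ᶠ x in 𝓝 a, f k x = (∏ i, x i ^ γ i) * g x := by
  classical
  refine germ_factor_aux t a _ f (fun i => if a i = 0 then α i else 0)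
    (C * ∏ i, if a i = 0 then 1 else ‖a i‖ ^ α i) rfl ?_ ?_ hf ?_
  · intro i hi
    by_contra hh
    simp [hh] at hi
  · refine mul_pos hC (Finset.prod_pos fun i _ => ?_)
    split_ifs with h
    · exact one_pos
    · exact pow_pos (norm_pos_iff.2 h) _
  · have hn : ∀ᶠ x in 𝓝 a, ∀ i, a i ≠ 0 → ‖x i‖ = ‖a i‖ := by
      rw [eventually_all]
      intro i
      by_cases hi : a i = 0
      · simp [hi]
      · have hb : Metric.ball (a i) ‖a i‖ ∈ 𝓝 (a i) := Metric.ball_mem_nhds _ (norm_pos_iff.2 hi)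
        filter_upwards [(continuous_apply i).continuousAt.eventually hb] with x hx _
        have hx' : ‖x i - a i‖ < ‖a i‖ := by simpa [dist_eq_norm] using hx
        have := Padic.add_eq_max_of_ne (p := p) (q := x i - a i) (r := a i) hx'.ne
        rw [sub_add_cancel] at this
        rw [this, max_eq_right hx'.le]
    filter_upwards [h, hn] with x hx hx2
    rw [hx, mul_assoc, ← Finset.prod_mul_distrib]
    congr 1
    apply Finset.prod_congr rfl
    intro i _
    by_cases hi : a i = 0
    · simp [hi]
    · simp [hi, hx2 i hi]

theorem norm_p_pos : 0 < ‖(p : ℚ_[p])‖ := norm_pos_iff.2 p_ne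

theorem eventually_small (c1 c2 : ℝ) (h1 : 0 < c1) {α β : ℕ} (hαβ : α < β) :
    ∀ᶠ N : ℕ in atTop, c2 * (‖(p : ℚ_[p])‖ ^ N) ^ β < c1 * (‖(p : ℚ_[p])‖ ^ N) ^ α := by
  have h0 : Tendsto (fun N : ℕ => c2 * (‖(p : ℚ_[p])‖ ^ N) ^ (β - α)) atTop (𝓝 0) := by
    have := (tendsto_pow_atTop_nhds_zero_of_lt_one (norm_nonneg _) (Padic.norm_p_lt_one (p := p)))
    have := (this.pow (β - α)).const_mul c2
    rwa [zero_pow (by omega), mul_zero] at this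
  filter_upwards [h0.eventually (gt_mem_nhds h1)] with N hN
  have hp : 0 < ‖(p : ℚ_[p])‖ ^ N := pow_pos norm_p_pos N
  obtain ⟨d, rfl⟩ := Nat.exists_eq_add_of_lt hαβ
  rw [show α + d + 1 - α = d + 1 by omega] at hN
  calc c2 * (‖(p : ℚ_[p])‖ ^ N) ^ (α + d + 1) = (c2 * (‖(p : ℚ_[p])‖ ^ N) ^ (d + 1)) * (‖(p : ℚ_[p])‖ ^ N) ^ α := by ring
    _ < c1 * (‖(p : ℚ_[p])‖ ^ N) ^ α := by
      apply mul_lt_mul_of_pos_right hN (pow_pos hp _)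

theorem eq_of_pow_eventually {c1 c3 : ℝ} (h1 : 0 < c1) (h3 : 0 < c3) {α γ : ℕ}
    (h : ∀ᶠ N : ℕ in atTop, c1 * (‖(p : ℚ_[p])‖ ^ N) ^ α = c3 * (‖(p : ℚ_[p])‖ ^ N) ^ γ) : α = γ ∧ c1 = c3 := by
  have hαγ : α = γ := by
    rcases lt_trichotomy α γ with hl | hl | hl
    · obtain ⟨N, hN, hN'⟩ := (h.and (eventually_small (p := p) c1 c3 h1 hl)).exists
      exact absurd hN hN'.ne'
    · exact hl
    · obtain ⟨N, hN, hN'⟩ := (h.and (eventually_small (p := p) c3 c1 h3 hl)).exists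
      exact absurd hN hN'.ne
  refine ⟨hαγ, ?_⟩
  subst hαγ
  obtain ⟨N, hN⟩ := h.exists
  exact mul_right_cancel₀ (pow_pos (pow_pos norm_p_pos N) _).ne' hN

/-- test point -/
theorem prod_test1 (α : ι → ℕ) (i : ι) (y : ℚ_[p]) :
    ∏ k, ‖Function.update (1 : ι → ℚ_[p]) i y k‖ ^ α k = ‖y‖ ^ α i := by
  rw [Finset.prod_eq_single i]
  · simp
  · intro b _ hb; simp [hb]
  · simp

theorem prod_test2 (α : ι → ℕ) {i j : ι} (hij : i ≠ j) (y z : ℚ_[p]) :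
    ∏ k, ‖Function.update (Function.update (1 : ι → ℚ_[p]) i y) j z k‖ ^ α k = ‖y‖ ^ α i * ‖z‖ ^ α j := by
  rw [← Finset.mul_prod_erase _ _ (Finset.mem_univ j), Finset.prod_eq_single i]
  · simp [hij]; ring
  · intro b hb hbi; simp [hbi, Finset.ne_of_mem_erase hb]
  · intro h; simp [hij] at h

theorem one_mem_Bx : (1 : ι → ℚ_[p]) ∈ Bx p ι := fun i => by simp

theorem comparable {e1 e2 : (ι → ℚ_[p]) → ℚ_[p]} {α β : ι → ℕ} {c1 c2 : ℝ} (hc1 : 0 < c1) (hc2 : 0 < c2)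
    (h1 : ∀ x ∈ Bx p ι, ‖e1 x‖ = c1 * ∏ i, ‖x i‖ ^ α i)
    (h2 : ∀ x ∈ Bx p ι, ‖e2 x‖ = c2 * ∏ i, ‖x i‖ ^ β i)
    (h3 : (∀ x ∈ Bx p ι, e1 x = e2 x) ∨ Mono (fun x => e1 x - e2 x)) : α ≤ β ∨ β ≤ α := by
  by_contra hcon
  push Not at hcon
  obtain ⟨hn1, hn2⟩ := hcon
  rw [Pi.le_def] at hn1 hn2
  push Not at hn1 hn2
  obtain ⟨j, hj⟩ := hn1
  obtain ⟨i, hi⟩ := hn2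
  have hij : i ≠ j := by rintro rfl; omega
  have hpN : ∀ N : ℕ, ‖(p : ℚ_[p]) ^ N‖ ≤ 1 := fun N => norm_pow_le_one norm_p_le N
  have t1 : ∀ k (N : ℕ), Function.update (1 : ι → ℚ_[p]) k ((p : ℚ_[p]) ^ N) ∈ Bx p ι :=
    fun k N => Bx_update one_mem_Bx k (hpN N)
  rcases h3 with h3 | ⟨γ, c3, hc3, h3⟩
  · have := eq_of_pow_eventually (p := p) hc1 hc2 (α := α i) (γ := β i) (Eventually.of_forall fun N => by
      have a1 := h1 _ (t1 i N)
      have a2 := h2 _ (t1 i N)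
      rw [prod_test1, norm_pow] at a1 a2
      rw [← a1, ← a2, h3 _ (t1 i N)])
    omega
  · have h3 : ∀ x ∈ Bx p ι, ‖e1 x - e2 x‖ = c3 * ∏ i, ‖x i‖ ^ γ i := h3
    have A := eq_of_pow_eventually (p := p) hc1 hc3 (α := α i) (γ := γ i) (by
      filter_upwards [eventually_small (p := p) c1 c2 hc1 hi] with N hN
      have a1 := h1 _ (t1 i N)
      have a2 := h2 _ (t1 i N)
      have a3 := h3 _ (t1 i N)
      rw [prod_test1, norm_pow] at a1 a2 a3
      rw [← a1, ← a2] at hN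
      rw [← a1, ← a3, sub_eq_add_neg, Padic.add_eq_max_of_ne (by rw [norm_neg]; exact hN.ne'), norm_neg,
        max_eq_left hN.le])
    have B := eq_of_pow_eventually (p := p) hc2 hc3 (α := β j) (γ := γ j) (by
      filter_upwards [eventually_small (p := p) c2 c1 hc2 hj] with N hN
      have a1 := h1 _ (t1 j N)
      have a2 := h2 _ (t1 j N)
      have a3 := h3 _ (t1 j N)
      rw [prod_test1, norm_pow] at a1 a2 a3
      rw [← a1, ← a2] at hN
      rw [← a2, ← a3, sub_eq_add_neg, Padic.add_eq_max_of_ne (by rw [norm_neg]; exact hN.ne), norm_neg,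
        max_eq_right hN.le])
    have t2 : Function.update (Function.update (1 : ι → ℚ_[p]) i (p : ℚ_[p])) j (p : ℚ_[p]) ∈ Bx p ι :=
      Bx_update (Bx_update one_mem_Bx i norm_p_le) j norm_p_le
    have a1 := h1 _ t2
    have a2 := h2 _ t2
    have a3 := h3 _ t2
    rw [prod_test2 _ hij, ← pow_add] at a1 a2 a3
    have hq0 := norm_p_pos (p := p)
    have hq1 := Padic.norm_p_lt_one (p := p)
    obtain ⟨A1, A2⟩ := A
    obtain ⟨B1, B2⟩ := B
    rw [A2] at a1
    rw [B2] at a2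
    have hle : ∀ n, γ i + γ j < n → c3 * ‖(p : ℚ_[p])‖ ^ n < c3 * ‖(p : ℚ_[p])‖ ^ (γ i + γ j) := fun n hn =>
      mul_lt_mul_of_pos_left (pow_lt_pow_right_of_lt_one₀ hq0 hq1 hn) hc3
    have hna := Padic.nonarchimedean (e1 (Function.update (Function.update (1 : ι → ℚ_[p]) i (p : ℚ_[p])) j (p : ℚ_[p])))
      (-(e2 (Function.update (Function.update (1 : ι → ℚ_[p]) i (p : ℚ_[p])) j (p : ℚ_[p]))))
    rw [← sub_eq_add_neg, norm_neg, a1, a2, a3] at hna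
    rcases le_max_iff.1 hna with hh | hh
    · exact absurd hh (not_le.2 (hle _ (by omega)))
    · exact absurd hh (not_le.2 (hle _ (by omega)))

theorem eventually_box {a : ι → ℚ_[p]} {P : (ι → ℚ_[p]) → Prop} (h : ∀ᶠ x in 𝓝 a, P x) :
    ∃ M : ℕ, ∀ e : ι → ℕ, (∀ i, M ≤ e i) → ∀ x ∈ Bx p ι, P (bx a e x) := by
  obtain ⟨ε, hε, hP⟩ := Metric.eventually_nhds_iff.1 h
  have := (tendsto_pow_atTop_nhds_zero_of_lt_one (norm_nonneg _) (Padic.norm_p_lt_one (p := p)))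
  obtain ⟨M, hM⟩ := (this.eventually (gt_mem_nhds hε)).exists
  refine ⟨M, fun e he x hx => hP ?_⟩
  rw [dist_pi_lt_iff hε]
  intro i
  rw [dist_eq_norm]
  simp only [bx, add_sub_cancel_left, norm_mul, norm_pow]
  calc ‖(p : ℚ_[p])‖ ^ e i * ‖x i‖ ≤ ‖(p : ℚ_[p])‖ ^ M * 1 := by
        gcongr ?_ * ?_
        · exact pow_le_pow_of_le_one (norm_nonneg _) norm_p_le (he i)
        · exact hx i
    _ < ε := by rwa [mul_one]

theorem bx_analytic (a : ι → ℚ_[p]) (e : ι → ℕ) (x : ι → ℚ_[p]) : AnalyticAt ℚ_[p] (bx a e) x := by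
  rw [analyticAt_pi_iff]
  intro i
  exact analyticAt_const.add (analyticAt_const.mul (analyticAt_coord x i))

theorem LA_bx {F : (ι → ℚ_[p]) → ℚ_[p]} {a : ι → ℚ_[p]} {e : ι → ℕ}
    (h : ∀ x ∈ Bx p ι, AnalyticAt ℚ_[p] F (bx a e x)) : LA (fun x => F (bx a e x)) :=
  fun x hx => AnalyticAt.fun_comp (h x hx) (bx_analytic a e x)

theorem bx_isOpenMap (a : ι → ℚ_[p]) (e : ι → ℕ) (x : ι → ℚ_[p]) {P : (ι → ℚ_[p]) → Prop}
    (h : ∀ᶠ z in 𝓝 x, P (bx a e z)) : ∀ᶠ w in 𝓝 (bx a e x), P w := by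
  let inv : (ι → ℚ_[p]) → (ι → ℚ_[p]) := fun w i => (w i - a i) / (p : ℚ_[p]) ^ e i
  have hinv : ∀ w, bx a e (inv w) = w := by
    intro w; ext i
    have : (p : ℚ_[p]) ^ e i ≠ 0 := pow_ne_zero _ p_ne
    simp only [bx, inv]; field_simp; ring
  have hinv' : inv (bx a e x) = x := by
    ext i
    have : (p : ℚ_[p]) ^ e i ≠ 0 := pow_ne_zero _ p_ne
    simp only [bx, inv]; field_simp; ring
  have hc : Continuous inv := by fun_prop
  have := hc.continuousAt (x := bx a e x)
  rw [ContinuousAt, hinv'] at this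
  filter_upwards [this.eventually h] with w hw
  rwa [hinv] at hw

theorem norm_eventually_const {g : (ι → ℚ_[p]) → ℚ_[p]} {a : ι → ℚ_[p]} (hg : ContinuousAt g a) (h0 : g a ≠ 0) :
    ∀ᶠ x in 𝓝 a, ‖g x‖ = ‖g a‖ := by
  have hb : Metric.ball (g a) ‖g a‖ ∈ 𝓝 (g a) := Metric.ball_mem_nhds _ (norm_pos_iff.2 h0)
  filter_upwards [hg.eventually hb] with x hx
  have hx' : ‖g x - g a‖ < ‖g a‖ := by simpa [dist_eq_norm] using hx
  have := Padic.add_eq_max_of_ne (p := p) (q := g x - g a) (r := g a) hx'.ne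
  rw [sub_add_cancel] at this
  rw [this, max_eq_right hx'.le]

theorem shear {F : (ι → ℚ_[p]) → ℚ_[p]} {a : ι → ℚ_[p]} (hF : AnalyticAt ℚ_[p] F a)
    (h0 : ¬ ∀ᶠ x in 𝓝 a, F x = 0) (i0 : ι) :
    ∃ v : ι → ℚ_[p], v i0 = 1 ∧ (∀ i, ‖v i‖ ≤ 1) ∧ ¬ ∀ᶠ t in 𝓝 (0 : ℚ_[p]), F (a + t • v) = 0 := by
  obtain ⟨q, r, hq⟩ := id hF
  have hnl := (identity_lemma hF).resolve_left h0
  have hball : Metric.eball a r ∈ 𝓝 a := Metric.eball_mem_nhds _ hq.r_pos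
  -- a point on the axis
  have hax : Tendsto (fun t : ℚ_[p] => a + t • (Pi.single i0 1 : ι → ℚ_[p])) (𝓝[≠] 0) (𝓝 a) := by
    have hc : Continuous (fun t : ℚ_[p] => a + t • (Pi.single i0 1 : ι → ℚ_[p])) := by fun_prop
    have := hc.tendsto 0
    simp only [zero_smul, add_zero] at this
    exact this.mono_left nhdsWithin_le_nhds
  obtain ⟨t, ⟨ht1, ht2⟩, ht3⟩ := ((hax.eventually (hnl.and hball.out)).and self_mem_nhdsWithin).exists
  have ht0 : t ≠ 0 := ht3
  have hcone : ∀ᶠ w in 𝓝 (a + t • (Pi.single i0 1 : ι → ℚ_[p])), ∀ i, ‖w i - a i‖ ≤ ‖w i0 - a i0‖ ∧ w i0 - a i0 ≠ 0 := by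
    rw [eventually_all]
    intro i
    have c1 : Continuous fun w : ι → ℚ_[p] => ‖w i - a i‖ := by fun_prop
    have c2 : Continuous fun w : ι → ℚ_[p] => ‖w i0 - a i0‖ := by fun_prop
    have hne : ∀ᶠ w in 𝓝 (a + t • (Pi.single i0 1 : ι → ℚ_[p])), ‖w i0 - a i0‖ ≠ 0 := by
      apply c2.continuousAt.eventually_ne
      simpa using ht0
    by_cases hi : i = i0
    · subst hi
      filter_upwards [hne] with w hw
      exact ⟨le_rfl, by simpa using hw⟩
    · have hlt : ‖(a + t • (Pi.single i0 1 : ι → ℚ_[p])) i - a i‖ < ‖(a + t • (Pi.single i0 1 : ι → ℚ_[p])) i0 - a i0‖ := by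
        simp [hi, ht0]
      filter_upwards [hne, c1.continuousAt.eventually_lt c2.continuousAt hlt] with w hw hw'
      exact ⟨hw'.le, by simpa using hw⟩
  rw [not_eventually] at ht1
  obtain ⟨w, hw0, hw1, hw2⟩ := (ht1.and_eventually (hcone.and (Metric.isOpen_eball.mem_nhds ht2))).exists
  set y := w i0 - a i0 with hy
  have hy0 : y ≠ 0 := (hw1 i0).2
  refine ⟨fun i => (w i - a i) / y, by simp [← hy, hy0], fun i => ?_, ?_⟩
  · rw [norm_div, div_le_one (norm_pos_iff.2 hy0)]; exact (hw1 i).1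
  · intro hev
    set v : ι → ℚ_[p] := fun i => (w i - a i) / y with hv
    let Lm : ℚ_[p] →L[ℚ_[p]] (ι → ℚ_[p]) := ContinuousLinearMap.toSpanSingleton ℚ_[p] v
    have hFa : HasFPowerSeriesAt (fun z => F (a + z)) q (0 : ι → ℚ_[p]) := by
      have := hq.comp_sub (-a)
      simp only [sub_neg_eq_add, add_neg_cancel] at this
      have := this.hasFPowerSeriesAt
      simpa [add_comm] using this
    have hcomp := HasFPowerSeriesAt.compContinuousLinearMap (u := Lm) (x := 0) (f := fun z => F (a + z)) (pf := q)
      (by simpa using hFa)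
    have hz : HasFPowerSeriesAt (0 : ℚ_[p] → ℚ_[p]) (q.compContinuousLinearMap Lm) 0 := by
      apply hcomp.congr
      filter_upwards [hev] with t ht
      simpa [Lm] using ht
    have hzero : ∀ n, q n (fun _ => y • v) = 0 := by
      intro n
      have := hz.apply_eq_zero n y
      rw [FormalMultilinearSeries.compContinuousLinearMap_apply] at this
      exact this
    have hyv : y • v = w - a := by
      ext i; simp [hv]; field_simp
    have hw2' : w - a ∈ Metric.eball (0 : ι → ℚ_[p]) r := by
      rw [Metric.mem_eball, edist_zero_right]
      rwa [edist_eq_enorm_sub] at hw2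
    have hs := hq.hasSum hw2'
    rw [← hyv] at hs
    simp only [hzero] at hs
    have := hs.unique hasSum_zero
    rw [hyv, add_sub_cancel] at this
    exact hw0 this

end res
end IdealZeta
end PartB3

section PartB4
open Filter Topology
open scoped NNReal ENNReal

namespace IdealZeta

set_option linter.unusedSectionVars false

section res
variable {p : ℕ} [Fact p.Prime] {ι : Type} [Fintype ι] [DecidableEq ι]

/-- vertical order -/
noncomputable def vord (i0 : ι) (F : (ι → ℚ_[p]) → ℚ_[p]) (x : ι → ℚ_[p]) : ℕ∞ :=
  analyticOrderAt (fun t => F (Function.update x i0 t)) (x i0)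

theorem vf_an (i0 : ι) {F : (ι → ℚ_[p]) → ℚ_[p]} {x : ι → ℚ_[p]} (hF : AnalyticAt ℚ_[p] F x) :
    AnalyticAt ℚ_[p] (fun t => F (Function.update x i0 t)) (x i0) := by
  have h1 : AnalyticAt ℚ_[p] (fun t : ℚ_[p] => Function.update x i0 t) (x i0) := by
    rw [analyticAt_pi_iff]
    intro j
    by_cases h : j = i0
    · subst h
      simp only [Function.update_self]
      exact analyticAt_id
    · simpa [h] using analyticAt_const
  exact AnalyticAt.fun_comp (f := fun t : ℚ_[p] => Function.update x i0 t) (g := F) (by simpa using hF) h1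

theorem vord_le_iff {i0 : ι} {F : (ι → ℚ_[p]) → ℚ_[p]} {x : ι → ℚ_[p]} (hF : AnalyticAt ℚ_[p] F x) (d : ℕ) :
    (d : ℕ∞) ≤ vord i0 F x ↔ ∀ k < d, (pd i0)^[k] F x = 0 := by
  rw [vord, natCast_le_analyticOrderAt_iff_iteratedDeriv_eq_zero (vf_an i0 hF)]
  have : ∀ k, iteratedDeriv k (fun t => F (Function.update x i0 t)) (x i0) = (pd i0)^[k] F x := by
    intro k
    rw [iteratedDeriv_update i0 k (by simpa using hF)]
    simp
  simp only [this]

theorem vord_lt_iff {i0 : ι} {F : (ι → ℚ_[p]) → ℚ_[p]} {x : ι → ℚ_[p]} (hF : AnalyticAt ℚ_[p] F x) (d : ℕ) :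
    vord i0 F x < d ↔ ∃ k < d, (pd i0)^[k] F x ≠ 0 := by
  rw [← not_le, vord_le_iff hF]; push Not; rfl

theorem vord_ne_top_iff {i0 : ι} {F : (ι → ℚ_[p]) → ℚ_[p]} {x : ι → ℚ_[p]} (hF : AnalyticAt ℚ_[p] F x) :
    vord i0 F x ≠ ⊤ ↔ ∃ k, (pd i0)^[k] F x ≠ 0 := by
  constructor
  · intro h
    obtain ⟨d, hd⟩ := ENat.ne_top_iff_exists.1 h
    have : vord i0 F x < (d + 1 : ℕ) := by rw [← hd]; exact_mod_cast Nat.lt_succ_self d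
    obtain ⟨k, -, hk⟩ := (vord_lt_iff hF _).1 this
    exact ⟨k, hk⟩
  · rintro ⟨k, hk⟩
    have := (vord_lt_iff (i0 := i0) hF (k+1)).2 ⟨k, k.lt_succ_self, hk⟩
    exact (this.trans_le le_top).ne

theorem vord_eventually {i0 : ι} {F : (ι → ℚ_[p]) → ℚ_[p]} {x : ι → ℚ_[p]} (hF : AnalyticAt ℚ_[p] F x)
    (h : vord i0 F x ≠ ⊤) : ∀ᶠ z in 𝓝 x, vord i0 F z ≠ ⊤ := by
  obtain ⟨k, hk⟩ := (vord_ne_top_iff hF).1 h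
  have := (pd_iter_analyticAt i0 k hF).continuousAt.eventually_ne hk
  filter_upwards [this, hF.eventually_analyticAt] with z hz hz2
  exact (vord_ne_top_iff hz2).2 ⟨k, hz⟩

theorem vord_affine {i0 : ι} {F G : (ι → ℚ_[p]) → ℚ_[p]} {x z : ι → ℚ_[p]} (C α β : ℚ_[p]) (hC : C ≠ 0) (hα : α ≠ 0)
    (hz : z i0 = α * x i0 + β) (hF : AnalyticAt ℚ_[p] F z)
    (h : ∀ᶠ t in 𝓝 (x i0), G (Function.update x i0 t) = C * F (Function.update z i0 (α * t + β))) :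
    vord i0 G x = vord i0 F z := by
  have hg : AnalyticAt ℚ_[p] (fun t : ℚ_[p] => α * t + β) (x i0) := by fun_prop
  have hf := vf_an i0 hF
  rw [hz] at hf
  have h2 : vord i0 G x = analyticOrderAt ((fun _ => C) * ((fun t => F (Function.update z i0 t)) ∘ fun t => α * t + β)) (x i0) :=
    analyticOrderAt_congr h
  rw [h2, analyticOrderAt_mul analyticAt_const (AnalyticAt.comp (g := fun t => F (Function.update z i0 t)) (f := fun t => α * t + β) hf hg),
    analyticOrderAt_comp_of_deriv_ne_zero hg]
  · rw [AnalyticAt.analyticOrderAt_eq_zero analyticAt_const |>.2 hC, zero_add, vord, hz]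
  · have : deriv (fun t : ℚ_[p] => α * t + β) (x i0) = α := by simp
    rw [this]; exact hα

theorem tendsto_update (i0 : ι) (x : ι → ℚ_[p]) : Tendsto (fun t : ℚ_[p] => Function.update x i0 t) (𝓝 (x i0)) (𝓝 x) := by
  have hc : Continuous (fun t : ℚ_[p] => Function.update x i0 t) := by fun_prop
  simpa using hc.tendsto (x i0)

theorem vord_congr {i0 : ι} {F G : (ι → ℚ_[p]) → ℚ_[p]} {x : ι → ℚ_[p]} (h : ∀ᶠ z in 𝓝 x, F z = G z) :
    vord i0 F x = vord i0 G x :=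
  analyticOrderAt_congr ((tendsto_update i0 x).eventually h)

/-- polynomial part -/
theorem iterDeriv_poly (P : Polynomial ℚ_[p]) (k : ℕ) :
    iteratedDeriv k (fun t => P.eval t) = fun t => (Polynomial.derivative^[k] P).eval t := by
  induction k with
  | zero => simp
  | succ k ih =>
    rw [iteratedDeriv_succ, ih, Function.iterate_succ_apply']
    ext t
    exact Polynomial.deriv _

/-- polynomial with coefficients `c j`, `j < d` -/
noncomputable def mkP (d : ℕ) (c : ℕ → ℚ_[p]) : Polynomial ℚ_[p] :=
  ∑ j ∈ Finset.range d, Polynomial.monomial j (c j)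

theorem mkP_eval (d : ℕ) (c : ℕ → ℚ_[p]) (t : ℚ_[p]) : (mkP d c).eval t = ∑ j ∈ Finset.range d, c j * t ^ j := by
  simp [mkP, Polynomial.eval_finsetSum]

theorem mkP_coeff (d : ℕ) (c : ℕ → ℚ_[p]) (k : ℕ) : (mkP d c).coeff k = if k < d then c k else 0 := by
  simp [mkP, Polynomial.coeff_monomial]

theorem iterDeriv_wform {d : ℕ} {c : ℕ → ℚ_[p]} {u f : ℚ_[p] → ℚ_[p]} (hu : AnalyticAt ℚ_[p] u 0)
    (hf : ∀ᶠ t in 𝓝 0, f t = (∑ j ∈ Finset.range d, c j * t ^ j) + t ^ d * u t) {k : ℕ} (hk : k < d) :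
    iteratedDeriv k f 0 = k.factorial * c k := by
  have h1 : AnalyticAt ℚ_[p] (fun t : ℚ_[p] => t ^ d * u t) 0 := (analyticAt_id.pow d).mul hu
  have h2 : AnalyticAt ℚ_[p] (fun t => (mkP d c).eval t) 0 := by
    simp only [mkP_eval]
    exact Finset.analyticAt_fun_sum _ fun j _ => analyticAt_const.mul (analyticAt_id.pow j)
  have he : f =ᶠ[𝓝 0] (fun t => (mkP d c).eval t) + fun t => t ^ d * u t := by
    filter_upwards [hf] with t ht
    simp [ht, mkP_eval]
  rw [he.iteratedDeriv_eq, iteratedDeriv_add h2.contDiffAt h1.contDiffAt, iterDeriv_poly]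
  have h3 : (d : ℕ∞) ≤ analyticOrderAt (fun t : ℚ_[p] => t ^ d * u t) 0 := by
    rw [natCast_le_analyticOrderAt h1]
    exact ⟨u, hu, by simp⟩
  rw [(natCast_le_analyticOrderAt_iff_iteratedDeriv_eq_zero h1).1 h3 k hk, add_zero]
  beta_reduce
  rw [← Polynomial.coeff_zero_eq_eval_zero, Polynomial.coeff_iterate_derivative, mkP_coeff, if_pos (by omega)]
  simp [Nat.descFactorial_self]

theorem wform_order_lt {d : ℕ} {c : ℕ → ℚ_[p]} {u f : ℚ_[p] → ℚ_[p]} (hu : AnalyticAt ℚ_[p] u 0)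
    (hf : ∀ᶠ t in 𝓝 0, f t = (∑ j ∈ Finset.range d, c j * t ^ j) + t ^ d * u t) {k : ℕ} (hk : k < d)
    (hck : c k ≠ 0) : analyticOrderAt f 0 < d := by
  have h0 : AnalyticAt ℚ_[p] f 0 := by
    refine AnalyticAt.congr (f := fun t => (∑ j ∈ Finset.range d, c j * t ^ j) + t ^ d * u t) ?_ (hf.mono fun _ h => h.symm)
    exact (Finset.analyticAt_fun_sum _ fun j _ => analyticAt_const.mul (analyticAt_id.pow j)).add ((analyticAt_id.pow d).mul hu)
  rw [← not_le, natCast_le_analyticOrderAt_iff_iteratedDeriv_eq_zero h0]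
  intro h
  have := h k hk
  rw [iterDeriv_wform hu hf hk] at this
  rcases mul_eq_zero.1 this with h | h
  · exact Nat.factorial_ne_zero k (by exact_mod_cast h)
  · exact hck h

theorem wform_unit {d : ℕ} {c : ℕ → ℚ_[p]} {u f : ℚ_[p] → ℚ_[p]} (hu : AnalyticAt ℚ_[p] u 0)
    (hf : ∀ᶠ t in 𝓝 0, f t = (∑ j ∈ Finset.range d, c j * t ^ j) + t ^ d * u t)
    (h : analyticOrderAt f 0 = d) : (∀ k < d, c k = 0) ∧ u 0 ≠ 0 := by
  have hc : ∀ k < d, c k = 0 := by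
    intro k hk
    by_contra hh
    exact (wform_order_lt hu hf hk hh).ne h
  refine ⟨hc, fun hu0 => ?_⟩
  have he : f =ᶠ[𝓝 0] (fun t => t ^ d) * u := by
    filter_upwards [hf] with t ht
    rw [ht, Finset.sum_eq_zero (fun j hj => by rw [hc j (Finset.mem_range.1 hj), zero_mul]), zero_add]; rfl
  rw [analyticOrderAt_congr he, analyticOrderAt_mul (f := fun t : ℚ_[p] => t ^ d) (analyticAt_id.pow d) hu] at h
  have h1 : analyticOrderAt (fun t : ℚ_[p] => t ^ d) 0 = d := by
    have := analyticOrderAt_centeredMonomial (𝕜 := ℚ_[p]) (z₀ := 0) (n := d)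
    simpa [Pi.pow_def] using this
  have h2 : analyticOrderAt u 0 ≠ 0 := (hu.analyticOrderAt_ne_zero).2 hu0
  rw [h1] at h
  apply h2
  have h3 : (d : ℕ∞) + analyticOrderAt u 0 = d + 0 := by simpa using h
  exact ENat.add_right_injective_of_ne_top (ENat.natCast_ne_top d) h3

theorem poly_order_lt {d : ℕ} (hd : 0 < d) {b : ℕ → ℚ_[p]} {u0 t0 : ℚ_[p]} (hu : u0 ≠ 0) (ht : t0 ≠ 0)
    (hb : ∀ j, j + 1 = d → b j = 0) {f : ℚ_[p] → ℚ_[p]}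
    (hf : ∀ᶠ t in 𝓝 t0, f t = (∑ j ∈ Finset.range d, b j * t ^ j) + t ^ d * u0) :
    analyticOrderAt f t0 < d := by
  set P : Polynomial ℚ_[p] := mkP (d+1) (fun j => if j = d then u0 else b j) with hP
  have he : f =ᶠ[𝓝 t0] fun t => P.eval t := by
    filter_upwards [hf] with t ht
    rw [ht, hP, mkP_eval, Finset.sum_range_succ]
    simp only [if_true]
    congr 1
    · refine Finset.sum_congr rfl fun j hj => ?_
      rw [if_neg (Finset.mem_range.1 hj).ne]
    · ring
  have h0 : AnalyticAt ℚ_[p] (fun t => P.eval t) t0 := by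
    simp only [hP, mkP_eval]
    exact Finset.analyticAt_fun_sum _ fun j _ => analyticAt_const.mul (analyticAt_id.pow j)
  rw [analyticOrderAt_congr he, ← not_le, natCast_le_analyticOrderAt_iff_iteratedDeriv_eq_zero h0]
  intro h
  have h1 := h (d-1) (by omega)
  rw [iterDeriv_poly] at h1
  have hQ : Polynomial.derivative^[d-1] P = Polynomial.C ((d.descFactorial (d-1) : ℕ) * u0) * Polynomial.X := by
    ext m
    rw [Polynomial.coeff_iterate_derivative, hP, mkP_coeff]
    rcases m with _ | _ | m
    · have : d - 1 ≠ d := by omega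
      simp [this, hb (d-1) (by omega)]
    · have : 1 + (d - 1) = d := by omega
      simp [this]
    · have : ¬ (m + 2 + (d - 1) < d + 1) := by omega
      simp [this]
  simp only [hQ, Polynomial.eval_mul, Polynomial.eval_C, Polynomial.eval_X] at h1
  have h2 : ((d.descFactorial (d-1) : ℕ) : ℚ_[p]) ≠ 0 := by
    norm_cast
    intro h
    rw [Nat.descFactorial_eq_zero_iff_lt] at h
    omega
  exact mul_ne_zero (mul_ne_zero h2 hu) ht h1

end res
end IdealZeta
end PartB4

section PartB5
open Filter Topology
open scoped NNReal ENNReal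

namespace IdealZeta

set_option linter.unusedSectionVars false

section res
variable {p : ℕ} [Fact p.Prime] {ι : Type} [Fintype ι] [DecidableEq ι]

/-- monomial -/
noncomputable def mon (δ : ι → ℕ) (x : ι → ℚ_[p]) : ℚ_[p] := ∏ i, x i ^ δ i

theorem mon_LA (δ : ι → ℕ) : LA (mon (p := p) δ) := LA.prod _ fun i _ => (LA_coord i).pow _

theorem mon_an (δ : ι → ℕ) (x : ι → ℚ_[p]) : AnalyticAt ℚ_[p] (mon (p := p) δ) x :=
  Finset.analyticAt_fun_prod _ fun i _ => (analyticAt_coord x i).pow _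

theorem mon_dep {s : Finset ι} {δ : ι → ℕ} (h : ∀ i, i ∉ s → δ i = 0) : DependsOn (mon (p := p) δ) (s : Set ι) := by
  intro x y hxy
  refine Finset.prod_congr rfl fun i _ => ?_
  by_cases hi : i ∈ s
  · rw [hxy i hi]
  · simp [h i hi]

theorem mon_norm (δ : ι → ℕ) (x : ι → ℚ_[p]) : ‖mon δ x‖ = ∏ i, ‖x i‖ ^ δ i := by
  simp [mon, norm_prod]

theorem mon_le_one (δ : ι → ℕ) {x : ι → ℚ_[p]} (hx : x ∈ Bx p ι) : ‖mon δ x‖ ≤ 1 := by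
  rw [mon_norm]
  exact Finset.prod_le_one (fun i _ => by positivity) fun i _ => pow_le_one₀ (norm_nonneg _) (hx i)

theorem mon_zero (x : ι → ℚ_[p]) : mon 0 x = 1 := by simp [mon]

theorem mon_add (α β : ι → ℕ) (x : ι → ℚ_[p]) : mon (α + β) x = mon α x * mon β x := by
  simp [mon, pow_add, Finset.prod_mul_distrib]

theorem mon_single (i : ι) (x : ι → ℚ_[p]) : mon (Pi.single i 1) x = x i := by
  rw [mon, Finset.prod_eq_single i]
  · simp
  · intro j _ hj; simp [hj]
  · simp

/-- split off a coordinate -/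
theorem mon_split {δ : ι → ℕ} {i : ι} (h : 1 ≤ δ i) (x : ι → ℚ_[p]) :
    mon δ x = x i * mon (δ - Pi.single i 1) x := by
  rw [← mon_single i x, ← mon_add]
  congr 1
  ext j
  by_cases hj : j = i
  · subst hj; simp; omega
  · simp [hj]

theorem mon_update {δ : ι → ℕ} (i : ι) (t : ℚ_[p]) (x : ι → ℚ_[p]) :
    mon δ (Function.update x i (t * x i)) = t ^ δ i * mon δ x := by
  rw [mon, mon, ← Finset.mul_prod_erase _ _ (Finset.mem_univ i), ← Finset.mul_prod_erase _ _ (Finset.mem_univ i)]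
  rw [Function.update_self, mul_pow, mul_assoc]
  congr 2
  refine Finset.prod_congr rfl fun j hj => ?_
  rw [Function.update_of_ne (Finset.ne_of_mem_erase hj)]

theorem dep_upd {s' : Finset ι} {i0 : ι} (hi0 : i0 ∉ s') {F : (ι → ℚ_[p]) → ℚ_[p]} (h : DependsOn F (s' : Set ι))
    (x : ι → ℚ_[p]) (t : ℚ_[p]) : F (Function.update x i0 t) = F x :=
  h fun k hk => by
    have : k ≠ i0 := fun e => hi0 (e ▸ hk)
    simp [this]

theorem dep_mono {s s' : Finset ι} (hs : s' ⊆ s) {F : (ι → ℚ_[p]) → ℚ_[p]} (h : DependsOn F (s' : Set ι)) :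
    DependsOn F (s : Set ι) := fun _ _ hxy => h fun k hk => hxy k (hs hk)

/-- Weierstrass form -/
noncomputable def wf (i0 : ι) (d : ℕ) (δ : ι → ℕ) (c : ℕ → (ι → ℚ_[p]) → ℚ_[p]) (u : (ι → ℚ_[p]) → ℚ_[p])
    (x : ι → ℚ_[p]) : ℚ_[p] :=
  (∑ j ∈ Finset.range d, (mon δ x ^ (d - j) * c j x) * x i0 ^ j) + x i0 ^ d * u x

/-- normal form -/
structure NF (s' : Finset ι) (i0 : ι) (d : ℕ) (δ : ι → ℕ) (κ : ℝ) (H : (ι → ℚ_[p]) → ℚ_[p])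
    (c : ℕ → (ι → ℚ_[p]) → ℚ_[p]) (u : (ι → ℚ_[p]) → ℚ_[p]) : Prop where
  hH : LA H
  hHd : DependsOn H (s' : Set ι)
  hδ : ∀ i, i ∉ s' → δ i = 0
  hκ : 0 < κ
  hc : ∀ j, LA (c j)
  hcd : ∀ j, DependsOn (c j) (s' : Set ι)
  hc0 : ∀ j, j + 1 = d → ∀ x ∈ Bx p ι, c j x = 0
  hcκ : ∀ j < d, ∀ x ∈ Bx p ι, ‖c j x‖ ≤ κ
  hu : LA u
  hud : DependsOn u (insert i0 s' : Finset ι)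
  huκ : ∀ x ∈ Bx p ι, ‖u x‖ = κ
  hO : 0 < d → ∀ x ∈ Bx p ι, x i0 ≠ 0 → vord i0 (wf i0 d δ c u) x < d

/-- lower-order statement -/
def SHyp (p : ℕ) [Fact p.Prime] (s' : Finset ι) (i0 : ι) (d : ℕ) : Prop :=
  ∀ (H F : (ι → ℚ_[p]) → ℚ_[p]) (a : ι → ℚ_[p]), a ∈ Bx p ι → AnalyticAt ℚ_[p] H a → AnalyticAt ℚ_[p] F a →
    DependsOn H (s' : Set ι) → DependsOn F (insert i0 s' : Finset ι) → (¬ ∀ᶠ z in 𝓝 a, H z = 0) →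
    vord i0 F a < d → ∃ m m1, ∀ m' ≥ m1, Res (insert i0 s')
      (fun x => H (bx a (ex2 i0 m m') x) * F (bx a (ex2 i0 m m') x))

theorem wf_LA {i0 : ι} {d : ℕ} {δ : ι → ℕ} {c : ℕ → (ι → ℚ_[p]) → ℚ_[p]} {u : (ι → ℚ_[p]) → ℚ_[p]}
    (hc : ∀ j, LA (c j)) (hu : LA u) : LA (wf i0 d δ c u) :=
  (LA.sum _ fun j _ => (((mon_LA δ).pow _).mul (hc j)).mul ((LA_coord i0).pow j)).add
    (((LA_coord i0).pow d).mul hu)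

theorem wf_dep {s' : Finset ι} {i0 : ι} {d : ℕ} {δ : ι → ℕ} {c : ℕ → (ι → ℚ_[p]) → ℚ_[p]} {u : (ι → ℚ_[p]) → ℚ_[p]}
    (hδ : ∀ i, i ∉ s' → δ i = 0) (hc : ∀ j, DependsOn (c j) (s' : Set ι))
    (hu : DependsOn u (insert i0 s' : Finset ι)) : DependsOn (wf i0 d δ c u) (insert i0 s' : Finset ι) := by
  intro x y hxy
  have hi : x i0 = y i0 := hxy i0 (by simp)
  have hm : mon δ x = mon δ y := mon_dep hδ fun k hk => hxy k (by simpa using Or.inr hk)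
  have h1 : ∀ j, c j x = c j y := fun j => hc j fun k hk => hxy k (by simpa using Or.inr hk)
  simp only [wf, hi, hm, h1, hu hxy]

theorem Mono.nlz {F : (ι → ℚ_[p]) → ℚ_[p]} (h : Mono F) : NLZ F := by
  obtain ⟨α, κ, hκ, h⟩ := h
  intro x hx hev
  classical
  -- nearby points with all coordinates nonzero
  have ht : Tendsto (fun t : ℚ_[p] => fun i => if x i = 0 then t else x i) (𝓝[≠] 0) (𝓝 x) := by
    rw [tendsto_pi_nhds]
    intro i
    by_cases hi : x i = 0
    · simp only [hi, if_true]; exact tendsto_id.mono_left nhdsWithin_le_nhds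
    · simp only [hi, if_false]; exact tendsto_const_nhds
  obtain ⟨t, h1, h2, h3⟩ := ((ht.eventually hev).and ((ht.eventually (Bx_mem_nhds hx)).and self_mem_nhdsWithin)).exists
  have := h _ h2
  rw [h1, norm_zero] at this
  have hpos : 0 < κ * ∏ i, ‖(if x i = 0 then t else x i)‖ ^ α i := by
    refine mul_pos hκ (Finset.prod_pos fun i _ => pow_pos (norm_pos_iff.2 ?_) _)
    split_ifs with hi
    · exact h3
    · exact hi
  exact hpos.ne this

theorem Mono.mul {F G : (ι → ℚ_[p]) → ℚ_[p]} (hF : Mono F) (hG : Mono G) : Mono (fun x => F x * G x) := by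
  obtain ⟨α, κ, hκ, h⟩ := hF
  obtain ⟨β, κ', hκ', h'⟩ := hG
  refine ⟨α + β, κ * κ', mul_pos hκ hκ', fun x hx => ?_⟩
  rw [norm_mul, h x hx, h' x hx]
  simp only [Pi.add_apply, pow_add, Finset.prod_mul_distrib]
  ring

theorem Mono.coord (i : ι) : Mono (fun x : ι → ℚ_[p] => x i) :=
  ⟨Pi.single i 1, 1, one_pos, fun x _ => by rw [one_mul, ← mon_norm, mon_single]⟩

theorem Mono.const {c : ℚ_[p]} (hc : c ≠ 0) : Mono (fun _ : ι → ℚ_[p] => c) :=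
  ⟨0, ‖c‖, norm_pos_iff.2 hc, fun x _ => by simp⟩

theorem Mono.pow {F : (ι → ℚ_[p]) → ℚ_[p]} (hF : Mono F) (n : ℕ) : Mono (fun x => F x ^ n) := by
  induction n with
  | zero => simpa using Mono.const (p := p) (ι := ι) one_ne_zero
  | succ n ih => simpa [pow_succ] using ih.mul hF

theorem Mono.prod {κ : Type} (t : Finset κ) {F : κ → (ι → ℚ_[p]) → ℚ_[p]} (hF : ∀ k ∈ t, Mono (F k)) :
    Mono (fun x => ∏ k ∈ t, F k x) := by
  classical
  induction t using Finset.induction_on with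
  | empty => simpa using Mono.const (p := p) (ι := ι) one_ne_zero
  | insert k t hk ih =>
    simp only [Finset.prod_insert hk]
    exact (hF k (by simp)).mul (ih fun j hj => hF j (by simp [hj]))

theorem Mono.congr {F G : (ι → ℚ_[p]) → ℚ_[p]} (hF : Mono F) (h : ∀ x ∈ Bx p ι, ‖G x‖ = ‖F x‖) : Mono G := by
  obtain ⟨α, κ, hκ, hF⟩ := hF
  exact ⟨α, κ, hκ, fun x hx => by rw [h x hx, hF x hx]⟩

theorem Mono.comp {F : (ι → ℚ_[p]) → ℚ_[p]} (hF : Mono F) {π : (ι → ℚ_[p]) → (ι → ℚ_[p])}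
    (h1 : ∀ x ∈ Bx p ι, π x ∈ Bx p ι) (h2 : ∀ i, Mono (fun x => π x i)) : Mono (fun x => F (π x)) := by
  obtain ⟨α, κ, hκ, hF⟩ := hF
  obtain ⟨β, κ', hκ', h⟩ := Mono.prod (Finset.univ : Finset ι) (F := fun i x => π x i ^ α i) fun i _ => (h2 i).pow _
  refine ⟨β, κ * κ', mul_pos hκ hκ', fun x hx => ?_⟩
  rw [hF _ (h1 x hx), mul_assoc, ← h x hx]
  simp [norm_prod]

/-- vertical function of the Weierstrass form -/
theorem wf_vert {s' : Finset ι} {i0 : ι} (hi0 : i0 ∉ s') {d : ℕ} {δ : ι → ℕ} {c : ℕ → (ι → ℚ_[p]) → ℚ_[p]}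
    {u : (ι → ℚ_[p]) → ℚ_[p]} (hδ : ∀ i, i ∉ s' → δ i = 0) (hc : ∀ j, DependsOn (c j) (s' : Set ι))
    (x : ι → ℚ_[p]) (t : ℚ_[p]) :
    wf i0 d δ c u (Function.update x i0 t) =
      (∑ j ∈ Finset.range d, (mon δ x ^ (d - j) * c j x) * t ^ j) + t ^ d * u (Function.update x i0 t) := by
  simp only [wf, dep_upd hi0 (mon_dep hδ), dep_upd hi0 (hc _), Function.update_self]

theorem chart2_norm {s' : Finset ι} {i0 : ι} {d : ℕ} (hd : 0 < d) {δ : ι → ℕ} {κ : ℝ} {H : (ι → ℚ_[p]) → ℚ_[p]}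
    {c : ℕ → (ι → ℚ_[p]) → ℚ_[p]} {u : (ι → ℚ_[p]) → ℚ_[p]} (nf : NF s' i0 d δ κ H c u) {i : ι} (hi : 1 ≤ δ i)
    (hne : i ≠ i0) (x : ι → ℚ_[p]) (hx : x ∈ Bx p ι) :
    ‖wf i0 d δ c u (Function.update x i (p * x i0 * x i))‖ = κ * ‖x i0‖ ^ d := by
  set z := Function.update x i (p * x i0 * x i) with hz
  have hzB : z ∈ Bx p ι := Bx_update hx i (norm_mul_le_one (norm_mul_le_one norm_p_le (hx i0)) (hx i))
  have hz0 : z i0 = x i0 := by rw [hz, Function.update_of_ne hne.symm]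
  have hm : ‖mon δ z‖ ≤ ‖(p : ℚ_[p])‖ * ‖x i0‖ := by
    rw [mon_split hi, norm_mul, hz, Function.update_self, ← hz, norm_mul, norm_mul]
    calc _ ≤ ‖(p : ℚ_[p])‖ * ‖x i0‖ * 1 * 1 := by
          gcongr
          · exact hx i
          · exact mon_le_one _ hzB
      _ = _ := by ring
  have hp1 : ‖(p : ℚ_[p])‖ < 1 := Padic.norm_p_lt_one
  by_cases hy : x i0 = 0
  · have hmz : mon δ z = 0 := by
      rw [← norm_le_zero_iff]; simpa [hy] using hm
    rw [wf, hz0, hy, hmz, Finset.sum_eq_zero]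
    · simp [hd.ne']
    · intro j hj
      have : d - j ≠ 0 := by have := Finset.mem_range.1 hj; omega
      simp [this]
  · have hypos := norm_pos_iff.2 hy
    have hlt : ‖∑ j ∈ Finset.range d, (mon δ z ^ (d - j) * c j z) * z i0 ^ j‖ < κ * ‖x i0‖ ^ d := by
      refine lt_of_le_of_lt (IsUltrametricDist.norm_sum_le_of_forall_le_of_nonneg (C := ‖(p : ℚ_[p])‖ * (κ * ‖x i0‖ ^ d)) ?_ ?_) ?_
      · have := nf.hκ; positivity
      · intro j hj
        have hjd := Finset.mem_range.1 hj
        rw [norm_mul, norm_mul, norm_pow, norm_pow, hz0]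
        calc _ ≤ (‖(p : ℚ_[p])‖ * ‖x i0‖) ^ (d - j) * κ * ‖x i0‖ ^ j := by
              gcongr
              exact nf.hcκ j hjd z hzB
          _ = ‖(p : ℚ_[p])‖ ^ (d - j) * (κ * ‖x i0‖ ^ d) := by
              have : ‖x i0‖ ^ d = ‖x i0‖ ^ (d - j) * ‖x i0‖ ^ j := by rw [← pow_add]; congr 1; omega
              rw [mul_pow, this]; ring
          _ ≤ ‖(p : ℚ_[p])‖ ^ 1 * (κ * ‖x i0‖ ^ d) := by
              have := nf.hκ
              gcongr ?_ * _
              exact pow_le_pow_of_le_one (norm_nonneg _) hp1.le (by omega)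
          _ = _ := by rw [pow_one]
      · have : 0 < κ * ‖x i0‖ ^ d := mul_pos nf.hκ (pow_pos hypos _)
        nlinarith
    have h2 : ‖z i0 ^ d * u z‖ = κ * ‖x i0‖ ^ d := by
      rw [norm_mul, norm_pow, nf.huκ z hzB, hz0]; ring
    rw [wf, Padic.add_eq_max_of_ne (by rw [h2]; exact hlt.ne), h2, max_eq_right hlt.le]

theorem chart1_eq {s' : Finset ι} {i0 : ι} (hi0 : i0 ∉ s') {d : ℕ} {δ : ι → ℕ}
    {c : ℕ → (ι → ℚ_[p]) → ℚ_[p]} {u : (ι → ℚ_[p]) → ℚ_[p]} (hδ : ∀ i, i ∉ s' → δ i = 0)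
    (hc : ∀ j, DependsOn (c j) (s' : Set ι)) {i : ι} (hi : 1 ≤ δ i)
    (x : ι → ℚ_[p]) :
    wf i0 d δ c u (Function.update x i0 (x i * x i0)) =
      x i ^ d * wf i0 d (δ - Pi.single i 1) c (fun x => u (Function.update x i0 (x i * x i0))) x := by
  rw [wf_vert hi0 hδ hc, wf, mul_add, Finset.mul_sum]
  congr 1
  · refine Finset.sum_congr rfl fun j hj => ?_
    have hjd := Finset.mem_range.1 hj
    have : x i ^ d = x i ^ (d - j) * x i ^ j := by rw [← pow_add]; congr 1; omega
    rw [mon_split hi, this]; ring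
  · ring

theorem chart1_nf {s' : Finset ι} {i0 : ι} (hi0 : i0 ∉ s') {d : ℕ} {δ : ι → ℕ} {κ : ℝ} {H : (ι → ℚ_[p]) → ℚ_[p]}
    {c : ℕ → (ι → ℚ_[p]) → ℚ_[p]} {u : (ι → ℚ_[p]) → ℚ_[p]} (nf : NF s' i0 d δ κ H c u) {i : ι} (his : i ∈ s')
    (hi : 1 ≤ δ i) : NF s' i0 d (δ - Pi.single i 1) κ (fun x => x i ^ (d + 1) * H x) c
      (fun x => u (Function.update x i0 (x i * x i0))) := by
  have hne : i ≠ i0 := fun h => hi0 (h ▸ his)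
  have hmap : ∀ x ∈ Bx p ι, Function.update x i0 (x i * x i0) ∈ Bx p ι := fun x hx =>
    Bx_update hx i0 (norm_mul_le_one (hx i) (hx i0))
  have hδ' : ∀ j, j ∉ s' → (δ - Pi.single i 1 : ι → ℕ) j = 0 := by
    intro j hj; simp [nf.hδ j hj]
  have hu' : LA (fun x : ι → ℚ_[p] => u (Function.update x i0 (x i * x i0))) := fun x hx =>
    AnalyticAt.fun_comp (nf.hu _ (hmap x hx)) (analyticAt_update i0 (((LA_coord i).mul (LA_coord i0)) x hx))
  refine ⟨((LA_coord i).pow _).mul nf.hH, dep_op₂ (fun a b => a ^ (d+1) * b) (dep_coord his) nf.hHd, hδ',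
    nf.hκ, nf.hc, nf.hcd, nf.hc0, nf.hcκ, hu', ?_, fun x hx => nf.huκ _ (hmap x hx), ?_⟩
  · intro x y hxy
    apply nf.hud
    intro k hk
    have h1 : x i = y i := hxy i (by simp [his])
    have h2 : x i0 = y i0 := hxy i0 (by simp)
    by_cases hk0 : k = i0
    · subst hk0; simp [h1, h2]
    · simpa [hk0] using hxy k hk
  · intro hd x hx hx0
    by_cases hxi : x i = 0
    · have hval : ∀ t, wf i0 d (δ - Pi.single i 1) c (fun x => u (Function.update x i0 (x i * x i0)))
          (Function.update x i0 t) = (∑ j ∈ Finset.range d, (mon (δ - Pi.single i 1) x ^ (d - j) * c j x) * t ^ j)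
            + t ^ d * u (Function.update x i0 0) := by
        intro t
        rw [wf_vert hi0 hδ' nf.hcd]
        simp [hne, hxi]
      refine poly_order_lt hd (b := fun j => mon (δ - Pi.single i 1) x ^ (d - j) * c j x)
        (u0 := u (Function.update x i0 0)) ?_ hx0 ?_ (Eventually.of_forall hval)
      · rw [← norm_pos_iff, nf.huκ _ (Bx_update hx i0 (by simp))]; exact nf.hκ
      · intro j hj
        simp [nf.hc0 j hj x hx]
    · have hz := hmap x hx
      have := nf.hO hd _ hz (by simpa using ⟨hxi, hx0⟩)
      rw [← vord_affine (i0 := i0) (F := wf i0 d δ c u) (z := Function.update x i0 (x i * x i0))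
        (x := x) (G := wf i0 d (δ - Pi.single i 1) c (fun x => u (Function.update x i0 (x i * x i0))))
        ((x i ^ d)⁻¹) (x i) 0 (inv_ne_zero (pow_ne_zero _ hxi)) hxi (by simp)
        (wf_LA nf.hc nf.hu _ hz) (Eventually.of_forall fun t => ?_)] at this
      · exact this
      · have h := chart1_eq hi0 (d := d) (u := u) nf.hδ nf.hcd hi (Function.update x i0 t)
        simp only [Function.update_self, Function.update_idem, Function.update_of_ne hne] at h
        rw [Function.update_idem, add_zero, h, inv_mul_cancel_left₀ (pow_ne_zero _ hxi)]

theorem stage5 {s' : Finset ι} {i0 : ι} (hi0 : i0 ∉ s') {d : ℕ} (hd : 0 < d) (SH : SHyp p s' i0 d) {κ : ℝ} (N : ℕ) :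
    ∀ (δ : ι → ℕ) (H : (ι → ℚ_[p]) → ℚ_[p]) (c : ℕ → (ι → ℚ_[p]) → ℚ_[p]) (u : (ι → ℚ_[p]) → ℚ_[p]),
      ∑ i, δ i = N → NF s' i0 d δ κ H c u → Mono H → (∃ k < d, ∀ x ∈ Bx p ι, c k x ≠ 0) →
      Res (insert i0 s') (fun x => H x * wf i0 d δ c u x) := by
  induction N with
  | zero =>
    intro δ H c u hN nf hH ⟨k, hkd, hk⟩
    have hδ0 : δ = 0 := by
      ext i
      exact (Finset.sum_eq_zero_iff.1 hN) i (Finset.mem_univ i)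
    have hwd := wf_dep (d := d) nf.hδ nf.hcd nf.hud
    refine twoStage hi0 (G := fun x => H x * wf i0 d δ c u x)
      (dep_op₂ (· * ·) (dep_mono (Finset.subset_insert _ _) nf.hHd) hwd) fun a ha => ?_
    refine SH H (wf i0 d δ c u) a ha (nf.hH a ha) (wf_LA nf.hc nf.hu a ha) nf.hHd hwd (hH.nlz a ha) ?_
    by_cases h0 : a i0 = 0
    · rw [vord, h0]
      have hua := vf_an i0 (nf.hu a ha)
      rw [h0] at hua
      refine wform_order_lt hua (c := fun j => mon δ a ^ (d - j) * c j a)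
        (Eventually.of_forall fun t => wf_vert hi0 nf.hδ nf.hcd a t) hkd ?_
      subst hδ0
      simpa [mon_zero] using hk a ha
    · exact nf.hO hd a ha h0
  | succ N ih =>
    intro δ H c u hN nf hH hk
    obtain ⟨i, -, hi⟩ : ∃ i ∈ Finset.univ, δ i ≠ 0 := by
      by_contra hh
      push Not at hh
      rw [Finset.sum_eq_zero hh] at hN
      omega
    have his : i ∈ s' := by
      by_contra hh
      exact hi (nf.hδ i hh)
    have hi1 : 1 ≤ δ i := Nat.one_le_iff_ne_zero.2 hi
    have hne : i ≠ i0 := fun h => hi0 (h ▸ his)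
    refine .blow _ i i0 (by simp [his]) (by simp) hne ?_ ?_
    · have := ih (δ - Pi.single i 1) (fun x => x i ^ (d+1) * H x) c _ ?_ (chart1_nf hi0 nf his hi1)
        (((Mono.coord i).pow _).mul hH) hk
      · refine this.congr fun x hx => ?_
        rw [chart1_eq hi0 nf.hδ nf.hcd hi1, dep_upd hi0 nf.hHd]
        congr 1; ring
      · have h2 : ∑ j, δ j = ∑ j, (δ - Pi.single i 1 : ι → ℕ) j + ∑ j, (Pi.single i 1 : ι → ℕ) j := by
          rw [← Finset.sum_add_distrib]
          refine Finset.sum_congr rfl fun j _ => ?_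
          by_cases hj : j = i
          · subst hj; simp; omega
          · simp [hj]
        rw [Finset.sum_pi_single'] at h2
        simp only [Finset.mem_univ, if_true] at h2
        omega
    · apply Res.mono
      have hmap : ∀ x ∈ Bx p ι, Function.update x i (p * x i0 * x i) ∈ Bx p ι := fun x hx =>
        Bx_update hx i (norm_mul_le_one (norm_mul_le_one norm_p_le (hx i0)) (hx i))
      have h1 : Mono (fun x : ι → ℚ_[p] => H (Function.update x i (p * x i0 * x i))) := by
        refine hH.comp (π := fun x => Function.update x i (p * x i0 * x i)) hmap fun j => ?_
        by_cases hj : j = i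
        · subst hj
          simpa using ((Mono.const p_ne).mul (Mono.coord i0)).mul (Mono.coord j)
        · simpa [hj] using Mono.coord j
      have h2 : Mono (fun x : ι → ℚ_[p] => wf i0 d δ c u (Function.update x i (p * x i0 * x i))) := by
        obtain ⟨β, κ', hκ', h⟩ := (Mono.coord (p := p) i0).pow d
        refine ⟨β, κ * κ', mul_pos nf.hκ hκ', fun x hx => ?_⟩
        rw [chart2_norm hd nf hi1 hne x hx, mul_assoc, ← h x hx, norm_pow]
      exact (Mono.coord i0).mul (h1.mul h2)

end res
end IdealZeta
end PartB5

section PartB6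
open Filter Topology
open scoped NNReal ENNReal

namespace IdealZeta

set_option linter.unusedSectionVars false

section res
variable {p : ℕ} [Fact p.Prime] {ι : Type} [Fintype ι] [DecidableEq ι]

theorem IsMove.coord {s' : Finset ι} {i0 : ι} (hi0 : i0 ∉ s') {π : (ι → ℚ_[p]) → (ι → ℚ_[p])} {J : (ι → ℚ_[p]) → ℚ_[p]}
    (h : IsMove s' π J) (x : ι → ℚ_[p]) : π x i0 = x i0 := by
  have := congrFun (h.vert i0 hi0 x (x i0)) i0
  simpa using this

theorem wf_comp {s' : Finset ι} {i0 : ι} (hi0 : i0 ∉ s') {d : ℕ}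
    {c : ℕ → (ι → ℚ_[p]) → ℚ_[p]} {u : (ι → ℚ_[p]) → ℚ_[p]} {π : (ι → ℚ_[p]) → (ι → ℚ_[p])} {J : (ι → ℚ_[p]) → ℚ_[p]}
    (h : IsMove s' π J) (x : ι → ℚ_[p]) :
    wf i0 d 0 (fun j x => c j (π x)) (fun x => u (π x)) x = wf i0 d 0 c u (π x) := by
  simp only [wf, mon_zero, h.coord hi0]

theorem NF.comp {s' : Finset ι} {i0 : ι} (hi0 : i0 ∉ s') {d : ℕ} {κ : ℝ} {H : (ι → ℚ_[p]) → ℚ_[p]}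
    {c : ℕ → (ι → ℚ_[p]) → ℚ_[p]} {u : (ι → ℚ_[p]) → ℚ_[p]} (nf : NF s' i0 d 0 κ H c u)
    {π : (ι → ℚ_[p]) → (ι → ℚ_[p])} {J : (ι → ℚ_[p]) → ℚ_[p]} (h : IsMove s' π J) :
    NF s' i0 d 0 κ (fun x => J x * H (π x)) (fun j x => c j (π x)) (fun x => u (π x)) := by
  refine ⟨h.jan.mul (nf.hH.comp_move h), dep_op₂ (· * ·) h.jdep (dep_move nf.hHd h), fun _ _ => rfl, nf.hκ,
    fun j => (nf.hc j).comp_move h, fun j => dep_move (nf.hcd j) h, fun j hj x hx => nf.hc0 j hj _ (h.maps x hx),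
    fun j hj x hx => nf.hcκ j hj _ (h.maps x hx), nf.hu.comp_move h, ?_, fun x hx => nf.huκ _ (h.maps x hx), ?_⟩
  · intro x y hxy
    apply nf.hud
    intro k hk
    by_cases hk0 : k = i0
    · subst hk0; rw [h.coord hi0, h.coord hi0]; exact hxy k hk
    · have hks : k ∈ s' := by simpa [hk0] using hk
      exact h.dep x y (fun i hi => hxy i (by simp [hi])) k hks
  · intro hd x hx hx0
    have := nf.hO hd (π x) (h.maps x hx) (by rwa [h.coord hi0])
    rw [vord] at this ⊢
    simp only [wf_comp hi0 h, h.vert i0 hi0]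
    rwa [h.coord hi0] at this

theorem NF.congr {s' : Finset ι} {i0 : ι} {d : ℕ} {κ : ℝ} {H : (ι → ℚ_[p]) → ℚ_[p]} {δ : ι → ℕ}
    {c c' : ℕ → (ι → ℚ_[p]) → ℚ_[p]} {u : (ι → ℚ_[p]) → ℚ_[p]} (nf : NF s' i0 d 0 κ H c u)
    (hδ : ∀ i, i ∉ s' → δ i = 0) (hc' : ∀ j, LA (c' j)) (hcd' : ∀ j, DependsOn (c' j) (s' : Set ι))
    (hc0' : ∀ j, j + 1 = d → ∀ x ∈ Bx p ι, c' j x = 0) (hcκ' : ∀ j < d, ∀ x ∈ Bx p ι, ‖c' j x‖ ≤ κ)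
    (heq : ∀ j < d, ∀ x ∈ Bx p ι, c j x = mon δ x ^ (d - j) * c' j x) :
    NF s' i0 d δ κ H c' u ∧ ∀ x ∈ Bx p ι, wf i0 d 0 c u x = wf i0 d δ c' u x := by
  have hw : ∀ x ∈ Bx p ι, wf i0 d 0 c u x = wf i0 d δ c' u x := by
    intro x hx
    simp only [wf, mon_zero]
    congr 1
    refine Finset.sum_congr rfl fun j hj => ?_
    rw [one_pow, one_mul, heq j (Finset.mem_range.1 hj) x hx]
  refine ⟨⟨nf.hH, nf.hHd, hδ, nf.hκ, hc', hcd', hc0', hcκ', nf.hu, nf.hud, nf.huκ, fun hd x hx hx0 => ?_⟩, hw⟩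
  rw [← vord_congr (F := wf i0 d 0 c u)]
  · exact nf.hO hd x hx hx0
  · filter_upwards [Bx_mem_nhds hx] with z hz using hw z hz

/-- the simultaneous power map -/
noncomputable def powMap (t : Finset ι) (D : ℕ) (ε : ι → ℚ_[p]) (x : ι → ℚ_[p]) : ι → ℚ_[p] :=
  fun i => if i ∈ t then ε i * x i ^ D else x i

theorem powMap_move {s' : Finset ι} (D : ℕ) {ε : ι → ℚ_[p]} (hε : ∀ i, ‖ε i‖ ≤ 1) :
    IsMove s' (powMap s' D ε) (fun x => ∏ i ∈ s', x i ^ (D - 1)) where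
  maps x hx i := by
    by_cases hi : i ∈ s'
    · simpa [powMap, hi] using norm_mul_le_one (hε i) (norm_pow_le_one (hx i) D)
    · simpa [powMap, hi] using hx i
  vert i hi x t := by
    ext j
    by_cases hj : j = i
    · subst hj; simp [powMap, hi]
    · simp [powMap, hj]
  an x hx := by
    rw [analyticAt_pi_iff]
    intro i
    by_cases hi : i ∈ s'
    · simp only [powMap, hi, if_true]
      exact analyticAt_const.mul ((analyticAt_coord x i).pow D)
    · simp only [powMap, hi, if_false]
      exact analyticAt_coord x i
  jan := LA.prod _ fun i _ => (LA_coord i).pow _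
  jdep := dep_prod _ fun i hi => dep_op₁ (fun a => a ^ (D-1)) (dep_coord hi)
  dep x y h i hi := by simp [powMap, hi, h i hi]

theorem Res.powAll {s t : Finset ι} (hts : t ⊆ s) {D : ℕ} (hD : 1 ≤ D) : ∀ {F : (ι → ℚ_[p]) → ℚ_[p]},
    (∀ ε : ι → ℚ_[p], (∀ i, ε i ≠ 0) → (∀ i, ‖ε i‖ ≤ 1) →
      Res s (fun x => (∏ i ∈ t, x i ^ (D - 1)) * F (powMap t D ε x))) → Res s F := by
  induction t using Finset.induction_on with
  | empty =>
    intro F h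
    have := h (fun _ => 1) (fun _ => one_ne_zero) (fun _ => by simp)
    refine this.congr fun x hx => ?_
    have e : powMap ∅ D (fun _ => 1) x = x := by ext i; simp [powMap]
    simp [e]
  | insert k t hk ih =>
    intro F h
    apply ih (fun i hi => hts (Finset.mem_insert_of_mem hi))
    intro ε hε0 hε1
    refine .pow _ k (hts (Finset.mem_insert_self k t)) D hD fun e he he1 => ?_
    have := h (Function.update ε k e) (fun i => by
        by_cases hi : i = k
        · subst hi; simpa using he
        · simpa [hi] using hε0 i) (fun i => by
        by_cases hi : i = k
        · subst hi; simpa using he1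
        · simpa [hi] using hε1 i)
    refine this.congr fun x hx => ?_
    rw [Finset.prod_insert hk, ← mul_assoc]
    have e1 : ∏ i ∈ t, Function.update x k (e * x k ^ D) i ^ (D - 1) = ∏ i ∈ t, x i ^ (D - 1) := by
      refine Finset.prod_congr rfl fun i hi => ?_
      have : i ≠ k := fun h => hk (h ▸ hi)
      simp [this]
    have e2 : powMap (insert k t) D (Function.update ε k e) x = powMap t D ε (Function.update x k (e * x k ^ D)) := by
      ext i
      by_cases hi : i = k
      · subst hi; simp [powMap, hk]
      · simp [powMap, hi]
    rw [e1, e2]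

theorem stage4 {s' : Finset ι} {i0 : ι} (hi0 : i0 ∉ s') {d : ℕ} (SH : SHyp p s' i0 d) {κ : ℝ}
    {H : (ι → ℚ_[p]) → ℚ_[p]} {c : ℕ → (ι → ℚ_[p]) → ℚ_[p]} {u : (ι → ℚ_[p]) → ℚ_[p]}
    (nf : NF s' i0 d 0 κ H c u) (hH : Mono H) (A : Finset ℕ) (hAd : ∀ j ∈ A, j < d) (hA : A.Nonempty)
    (hA0 : ∀ j < d, j ∉ A → ∀ x ∈ Bx p ι, c j x = 0)
    (γ : ℕ → ι → ℕ) (g : ℕ → (ι → ℚ_[p]) → ℚ_[p]) (C : ℕ → ℝ)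
    (hC : ∀ j ∈ A, 0 < C j) (hγ : ∀ j ∈ A, ∀ i, i ∉ s' → γ j i = 0) (hg : ∀ j ∈ A, LA (g j))
    (hgd : ∀ j ∈ A, DependsOn (g j) (s' : Set ι)) (hgC : ∀ j ∈ A, ∀ x ∈ Bx p ι, ‖g j x‖ = C j)
    (hcg : ∀ j ∈ A, ∀ x ∈ Bx p ι, c j x = mon (γ j) x * g j x)
    (D : ℕ) (hD : 1 ≤ D) (hDd : ∀ j < d, (d - j) ∣ D)
    (hcomp : ∀ j ∈ A, ∀ k ∈ A, (D / (d - j)) • γ j ≤ (D / (d - k)) • γ k ∨ (D / (d - k)) • γ k ≤ (D / (d - j)) • γ j) :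
    Res (insert i0 s') (fun x => H x * wf i0 d 0 c u x) := by
  classical
  obtain ⟨k, hkA, hk⟩ := Finset.exists_min_image A (fun j => ∑ i, ((D / (d - j)) • γ j) i) hA
  have hmin : ∀ j ∈ A, (D / (d - k)) • γ k ≤ (D / (d - j)) • γ j := by
    intro j hj
    rcases hcomp k hkA j hj with h | h
    · exact h
    · have h1 := hk j hj
      have h2 : ∀ i ∈ Finset.univ, ((D / (d - j)) • γ j) i ≤ ((D / (d - k)) • γ k) i := fun i _ => h i
      have h3 := le_antisymm (Finset.sum_le_sum h2) h1
      intro i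
      exact ((Finset.sum_eq_sum_iff_of_le h2).1 h3 i (Finset.mem_univ i)).ge
  set δ : ι → ℕ := (D / (d - k)) • γ k with hδ
  have hd : 0 < d := lt_of_le_of_lt (Nat.zero_le _) (hAd k hkA)
  have hle : ∀ j ∈ A, ∀ i, (d - j) * δ i ≤ D * γ j i := by
    intro j hj i
    have h1 := hmin j hj i
    have h2 : D = (d - j) * (D / (d - j)) := (Nat.mul_div_cancel' (hDd j (hAd j hj))).symm
    calc (d - j) * δ i ≤ (d - j) * (D / (d - j) * γ j i) := Nat.mul_le_mul_left _ h1
      _ = ((d - j) * (D / (d - j))) * γ j i := by ring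
      _ = D * γ j i := by rw [← h2]
  have hCκ : ∀ j ∈ A, C j ≤ κ := by
    intro j hj
    have := nf.hcκ j (hAd j hj) 1 one_mem_Bx
    rw [hcg j hj 1 one_mem_Bx, norm_mul, hgC j hj 1 one_mem_Bx] at this
    simpa [mon] using this
  refine Res.powAll (t := s') (Finset.subset_insert _ _) hD fun ε hε0 hε1 => ?_
  have hm := powMap_move (s' := s') D hε1
  have nf2 := nf.comp hi0 hm
  -- monomials under the power map
  have hmon : ∀ j ∈ A, ∀ x : ι → ℚ_[p], mon (γ j) (powMap s' D ε x) =
      mon (γ j) ε * (mon δ x ^ (d - j) * mon (fun i => D * γ j i - (d - j) * δ i) x) := by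
    intro j hj x
    simp only [mon, ← Finset.prod_pow, ← Finset.prod_mul_distrib]
    refine Finset.prod_congr rfl fun i _ => ?_
    by_cases hi : i ∈ s'
    · simp only [powMap, hi, if_true]
      rw [mul_pow, ← pow_mul, ← pow_mul, ← pow_add]
      congr 2
      have := hle j hj i
      rw [mul_comm (δ i)]; omega
    · simp [hγ j hj i hi, hδ, hγ k hkA i hi]
  have hδs : ∀ i, i ∉ s' → δ i = 0 := by
    intro i hi; simp [hδ, hγ k hkA i hi]
  have hεmon : ∀ j, ‖mon (γ j) ε‖ ≤ 1 := fun j => mon_le_one _ (fun i => hε1 i)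
  let c' : ℕ → (ι → ℚ_[p]) → ℚ_[p] := fun j x => if j ∈ A then
    mon (γ j) ε * mon (fun i => D * γ j i - (d - j) * δ i) x * g j (powMap s' D ε x) else 0
  have hc'A : ∀ j ∈ A, c' j = fun x => mon (γ j) ε * mon (fun i => D * γ j i - (d - j) * δ i) x * g j (powMap s' D ε x) := by
    intro j hj; ext x; simp [c', hj]
  have hc'0 : ∀ j, j ∉ A → c' j = fun _ => 0 := by
    intro j hj; ext x; simp [c', hj]
  have heq : ∀ j < d, ∀ x ∈ Bx p ι, c j (powMap s' D ε x) = mon δ x ^ (d - j) * c' j x := by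
    intro j hj x hx
    by_cases hjA : j ∈ A
    · rw [hc'A j hjA, hcg j hjA _ (hm.maps x hx), hmon j hjA]; ring
    · rw [hc'0 j hjA, hA0 j hj hjA _ (hm.maps x hx), mul_zero]
  have q0 : ∀ j, LA (c' j) := by
    intro j
    by_cases hj : j ∈ A
    · rw [hc'A j hj]
      exact ((LA_const _).mul (mon_LA _)).mul ((hg j hj).comp_move hm)
    · rw [hc'0 j hj]; exact LA_const 0
  have q1 : ∀ j, DependsOn (c' j) (s' : Set ι) := by
    intro j
    by_cases hj : j ∈ A
    · rw [hc'A j hj]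
      refine dep_op₂ (· * ·) (dep_op₁ (fun a => mon (γ j) ε * a) (mon_dep fun i hi => ?_)) (dep_move (hgd j hj) hm)
      simp [hγ j hj i hi]
    · rw [hc'0 j hj]; exact dep_const _ 0
  have q2 : ∀ j, j + 1 = d → ∀ x ∈ Bx p ι, c' j x = 0 := by
    intro j hj x hx
    by_cases hjA : j ∈ A
    · exfalso
      have h1 := nf.hc0 j hj 1 one_mem_Bx
      rw [hcg j hjA 1 one_mem_Bx] at h1
      have h2 := hgC j hjA 1 one_mem_Bx
      simp [mon] at h1
      rw [h1, norm_zero] at h2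
      exact (hC j hjA).ne h2
    · rw [hc'0 j hjA]
  have q3 : ∀ j < d, ∀ x ∈ Bx p ι, ‖c' j x‖ ≤ κ := by
    intro j hj x hx
    by_cases hjA : j ∈ A
    · rw [hc'A j hjA, norm_mul, norm_mul, hgC j hjA _ (hm.maps x hx)]
      calc _ ≤ 1 * 1 * κ := by
            gcongr
            · exact (hC j hjA).le
            · exact hεmon j
            · exact mon_le_one _ hx
            · exact hCκ j hjA
        _ = κ := by ring
    · rw [hc'0 j hjA, norm_zero]; exact nf.hκ.le
  obtain ⟨nf3, hw⟩ := nf2.congr (c' := c') (δ := δ) hδs q0 q1 q2 q3 heq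
  have := stage5 hi0 hd SH _ δ _ c' _ rfl nf3 ?_ ⟨k, hAd k hkA, ?_⟩
  · refine this.congr fun x hx => ?_
    rw [← hw x hx, wf_comp hi0 hm, mul_assoc]
  · refine (Mono.prod s' fun i _ => (Mono.coord i).pow _).mul (hH.comp hm.maps fun i => ?_)
    by_cases hi : i ∈ s'
    · simpa [powMap, hi] using (Mono.const (hε0 i)).mul ((Mono.coord i).pow D)
    · simpa [powMap, hi] using Mono.coord i
  · intro x hx
    rw [hc'A k hkA]
    have e0 : (fun i => D * γ k i - (d - k) * δ i) = 0 := by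
      ext i
      have : D = (d - k) * (D / (d - k)) := (Nat.mul_div_cancel' (hDd k (hAd k hkA))).symm
      simp only [hδ, Pi.smul_apply, smul_eq_mul, Pi.zero_apply]
      rw [← mul_assoc, ← this, Nat.sub_self]
    simp only [e0, mon_zero, mul_one]
    refine mul_ne_zero (Finset.prod_ne_zero_iff.2 fun i _ => pow_ne_zero _ (hε0 i)) ?_
    rw [← norm_pos_iff, hgC k hkA _ (hm.maps x hx)]
    exact hC k hkA

end res
end IdealZeta
end PartB6

section PartB7
open Filter Topology
open scoped NNReal ENNReal

namespace IdealZeta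

set_option linter.unusedSectionVars false

section res
variable {p : ℕ} [Fact p.Prime] {ι : Type} [Fintype ι] [DecidableEq ι]

theorem ctr_analytic (t : Finset ι) (x : ι → ℚ_[p]) : AnalyticAt ℚ_[p] (ctr (p := p) t) x := by
  rw [analyticAt_pi_iff]
  intro i
  by_cases hi : i ∈ t
  · simp only [ctr, hi, if_true]; exact analyticAt_coord x i
  · simp only [ctr, hi, if_false]; exact analyticAt_const

theorem ctr_mem {t : Finset ι} {x : ι → ℚ_[p]} (hx : x ∈ Bx p ι) : ctr t x ∈ Bx p ι := by
  intro i
  by_cases hi : i ∈ t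
  · simpa [ctr, hi] using hx i
  · simp [ctr, hi]

theorem ctr_dep {t : Finset ι} {x y : ι → ℚ_[p]} (h : ∀ i ∈ t, x i = y i) : ctr t x = ctr t y := by
  ext i
  by_cases hi : i ∈ t
  · simp [ctr, hi, h i hi]
  · simp [ctr, hi]

theorem bx_mem {a x : ι → ℚ_[p]} {e : ι → ℕ} (ha : a ∈ Bx p ι) (hx : x ∈ Bx p ι) : bx a e x ∈ Bx p ι := by
  intro i
  exact norm_add_le_one (ha i) (norm_mul_le_one (norm_pow_le_one norm_p_le _) (hx i))

theorem bxMove {s' : Finset ι} {b : ι → ℚ_[p]} (hb : b ∈ Bx p ι) (M : ℕ) :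
    IsMove s' (bx (ctr s' b) (exq s' M)) (fun _ => 1) where
  maps x hx := bx_mem (ctr_mem hb) hx
  vert i hi x t := by
    ext j
    by_cases hj : j = i
    · subst hj; simp [bx, ctr, exq, hi]
    · simp [bx, hj]
  an x hx := bx_analytic _ _ x
  jan := LA_const 1
  jdep := dep_const _ 1
  dep x y h i hi := by simp [bx, h i hi]

theorem locMono {κ : Type} {s' : Finset ι} (t : Finset κ) {f : κ → (ι → ℚ_[p]) → ℚ_[p]}
    (hf : ∀ k ∈ t, LA (f k)) (hfd : ∀ k ∈ t, DependsOn (f k) (s' : Set ι)) (hM : Mono (fun x => ∏ k ∈ t, f k x))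
    {b : ι → ℚ_[p]} (hb : b ∈ Bx p ι) :
    ∃ M : ℕ, ∀ k ∈ t, ∃ (γ : ι → ℕ) (g : (ι → ℚ_[p]) → ℚ_[p]) (C : ℝ), 0 < C ∧ (∀ i, i ∉ s' → γ i = 0) ∧
      LA g ∧ DependsOn g (s' : Set ι) ∧ (∀ x ∈ Bx p ι, ‖g x‖ = C) ∧
      ∀ x ∈ Bx p ι, f k (bx (ctr s' b) (exq s' M) x) = mon γ x * g x := by
  classical
  obtain ⟨α, C, hC, hα⟩ := hM
  set b' : ι → ℚ_[p] := fun i => if i ∈ s' then b i else 1 with hb'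
  have hb'B : b' ∈ Bx p ι := by
    intro i
    by_cases hi : i ∈ s'
    · simpa [hb', hi] using hb i
    · simp [hb', hi]
  have hg := germ_factor t b' f α C hC (fun k hk => hf k hk b' hb'B)
    (by filter_upwards [Bx_mem_nhds hb'B] with x hx using hα x hx)
  choose! γ g h1 h2 h3 h4 using hg
  have hev : ∀ᶠ x in 𝓝 b', ∀ k ∈ t, AnalyticAt ℚ_[p] (g k) x ∧ ‖g k x‖ = ‖g k b'‖ ∧ f k x = (∏ i, x i ^ γ k i) * g k x := by
    rw [Filter.eventually_all_finset]
    intro k hk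
    filter_upwards [(h2 k hk).eventually_analyticAt, norm_eventually_const (h2 k hk).continuousAt (h3 k hk), h4 k hk] with x q1 q2 q3
    exact ⟨q1, q2, q3⟩
  obtain ⟨M, hM⟩ := eventually_box hev
  have hM := hM (fun _ => M) (fun _ => le_rfl)
  refine ⟨M, fun k hk => ?_⟩
  have hγs : ∀ i, i ∉ s' → γ k i = 0 := by
    intro i hi
    by_contra h
    have := h1 k hk i h
    simp [hb', hi] at this
  refine ⟨γ k, fun x => (∏ i, ((p : ℚ_[p]) ^ M) ^ γ k i) * g k (bx b' (fun _ => M) (ctr s' x)),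
    ‖(∏ i, ((p : ℚ_[p]) ^ M) ^ γ k i)‖ * ‖g k b'‖, ?_, hγs, ?_, ?_, ?_, ?_⟩
  · refine mul_pos (norm_pos_iff.2 ?_) (norm_pos_iff.2 (h3 k hk))
    exact Finset.prod_ne_zero_iff.2 fun i _ => pow_ne_zero _ (pow_ne_zero _ p_ne)
  · refine (LA_const _).mul fun x hx => ?_
    have q := (hM (ctr s' x) (ctr_mem hx) k hk).1
    have q2 : AnalyticAt ℚ_[p] (fun x => bx b' (fun _ => M) (ctr s' x)) x :=
      (bx_analytic b' (fun _ => M) (ctr s' x)).comp (ctr_analytic s' x)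
    exact AnalyticAt.comp (f := fun x => bx b' (fun _ => M) (ctr s' x)) q q2
  · intro x y hxy
    simp only [ctr_dep (fun i hi => hxy i hi)]
  · intro x hx
    rw [norm_mul, (hM (ctr s' x) (ctr_mem hx) k hk).2.1]
  · intro x hx
    have e1 : f k (bx (ctr s' b) (exq s' M) x) = f k (bx b' (fun _ => M) (ctr s' x)) := by
      apply hfd k hk
      intro i hi
      have hi : i ∈ s' := hi
      simp [bx, ctr, exq, hb', hi]
    rw [e1, (hM (ctr s' x) (ctr_mem hx) k hk).2.2, mon]
    rw [← mul_assoc, ← Finset.prod_mul_distrib]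
    congr 1
    refine Finset.prod_congr rfl fun i _ => ?_
    by_cases hi : γ k i = 0
    · simp [hi]
    · have hb0 := h1 k hk i hi
      have his : i ∈ s' := by by_contra h; exact hi (hγs i h)
      rw [← mul_pow]
      congr 1
      simp [bx, hb0, ctr, his]; ring

theorem Mono.of_mon {f g : (ι → ℚ_[p]) → ℚ_[p]} {γ : ι → ℕ} {C : ℝ} (hC : 0 < C) (hg : ∀ x ∈ Bx p ι, ‖g x‖ = C)
    (h : ∀ x ∈ Bx p ι, f x = mon γ x * g x) : Mono f := by
  refine ⟨γ, C, hC, fun x hx => ?_⟩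
  rw [h x hx, norm_mul, hg x hx, mon_norm, mul_comm]

/-- the property to be proved by induction on the set of variables -/
def MonH (p : ℕ) [Fact p.Prime] {ι : Type} [Fintype ι] [DecidableEq ι] (s : Finset ι) : Prop :=
  ∀ F : (ι → ℚ_[p]) → ℚ_[p], LA F → DependsOn F (s : Set ι) → NLZ F → Res s F

/-- auxiliary family -/
noncomputable def fam (d D : ℕ) (H : (ι → ℚ_[p]) → ℚ_[p]) (c : ℕ → (ι → ℚ_[p]) → ℚ_[p]) :
    Unit ⊕ (ℕ ⊕ (ℕ × ℕ)) → (ι → ℚ_[p]) → ℚ_[p]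
  | .inl _ => H
  | .inr (.inl j) => c j
  | .inr (.inr jk) => fun x => c jk.1 x ^ (D / (d - jk.1)) - c jk.2 x ^ (D / (d - jk.2))

theorem fam_LA {d D : ℕ} {H : (ι → ℚ_[p]) → ℚ_[p]} {c : ℕ → (ι → ℚ_[p]) → ℚ_[p]} (hH : LA H) (hc : ∀ j, LA (c j))
    (k : Unit ⊕ (ℕ ⊕ (ℕ × ℕ))) : LA (fam d D H c k) := by
  rcases k with k | k | ⟨j, k⟩
  · exact hH
  · exact hc k
  · exact ((hc j).pow _).sub ((hc k).pow _)

theorem fam_dep {s : Set ι} {d D : ℕ} {H : (ι → ℚ_[p]) → ℚ_[p]} {c : ℕ → (ι → ℚ_[p]) → ℚ_[p]} (hH : DependsOn H s)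
    (hc : ∀ j, DependsOn (c j) s)
    (k : Unit ⊕ (ℕ ⊕ (ℕ × ℕ))) : DependsOn (fam d D H c k) s := by
  rcases k with k | k | ⟨j, k⟩
  · exact hH
  · exact hc k
  · exact dep_op₂ (fun a b => a ^ (D / (d - j)) - b ^ (D / (d - k))) (hc j) (hc k)

theorem stage2 {s' : Finset ι} {i0 : ι} (hi0 : i0 ∉ s') {d : ℕ} (MS : MonH p s') (SH : SHyp p s' i0 d) {κ : ℝ}
    {H : (ι → ℚ_[p]) → ℚ_[p]} {c : ℕ → (ι → ℚ_[p]) → ℚ_[p]} {u : (ι → ℚ_[p]) → ℚ_[p]}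
    (nf : NF s' i0 d 0 κ H c u) (hH : NLZ H) (hc : ∀ j < d, (∀ x ∈ Bx p ι, c j x = 0) ∨ NLZ (c j))
    (he : ∀ j < d, ∀ k < d, (∀ x ∈ Bx p ι, c j x ^ (d.factorial / (d - j)) = c k x ^ (d.factorial / (d - k))) ∨
      NLZ (fun x => c j x ^ (d.factorial / (d - j)) - c k x ^ (d.factorial / (d - k)))) :
    Res (insert i0 s') (fun x => H x * wf i0 d 0 c u x) := by
  classical
  set D := d.factorial with hD
  let A : Finset ℕ := (Finset.range d).filter fun j => ¬ ∀ x ∈ Bx p ι, c j x = 0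
  let Bs : Finset (ℕ × ℕ) := (A ×ˢ A).filter fun jk => ¬ ∀ x ∈ Bx p ι, c jk.1 x ^ (D / (d - jk.1)) = c jk.2 x ^ (D / (d - jk.2))
  let T : Finset (Unit ⊕ (ℕ ⊕ (ℕ × ℕ))) := Finset.disjSum {()} (Finset.disjSum A Bs)
  have hAd : ∀ j ∈ A, j < d := fun j hj => Finset.mem_range.1 (Finset.mem_filter.1 hj).1
  have hNLZ : ∀ k ∈ T, NLZ (fam d D H c k) := by
    intro k hk
    rcases k with k | k | ⟨j, k⟩
    · exact hH
    · have hk : k ∈ A := by simpa [T] using hk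
      exact (hc k (hAd k hk)).resolve_left (Finset.mem_filter.1 hk).2
    · have hk : (j, k) ∈ Bs := by simpa [T] using hk
      have h1 := Finset.mem_filter.1 hk
      have h2 := Finset.mem_product.1 h1.1
      exact (he j (hAd j h2.1) k (hAd k h2.2)).resolve_left h1.2
  have hprodNLZ : NLZ (fun x => ∏ k ∈ T, fam d D H c k x) := by
    intro x hx h
    obtain ⟨k, hk, h'⟩ := domain_prod T (fun k _ => fam_LA nf.hH nf.hc k x hx) h
    exact hNLZ k hk x hx h'
  have hRes : Res s' (fun x => ∏ k ∈ T, fam d D H c k x) :=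
    MS _ (LA.prod _ fun k _ => fam_LA nf.hH nf.hc k) (dep_prod _ fun k _ => fam_dep nf.hHd nf.hcd k) hprodNLZ
  let Rel : ((ι → ℚ_[p]) → ℚ_[p]) → ((ι → ℚ_[p]) → ℚ_[p]) → Prop := fun H0 F0 =>
    ∃ (H : (ι → ℚ_[p]) → ℚ_[p]) (c : ℕ → (ι → ℚ_[p]) → ℚ_[p]) (u : (ι → ℚ_[p]) → ℚ_[p]),
      NF s' i0 d 0 κ H c u ∧ (∀ x, F0 x = H x * wf i0 d 0 c u x) ∧ (∀ x, H0 x = ∏ k ∈ T, fam d D H c k x) ∧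
      (∀ j < d, j ∉ A → ∀ x ∈ Bx p ι, c j x = 0) ∧
      (∀ j ∈ A, ∀ k ∈ A, (j, k) ∉ Bs → ∀ x ∈ Bx p ι, c j x ^ (D / (d - j)) = c k x ^ (D / (d - k)))
  refine Res.transfer (Finset.subset_insert i0 s') Rel ?_ ?_ hRes _ ⟨H, c, u, nf, fun _ => rfl, fun _ => rfl, ?_, ?_⟩
  · rintro π J H0 F0 hm ⟨H, c, u, nf, hF, hH0, hz, hzz⟩
    refine ⟨_, _, _, nf.comp hi0 hm, fun x => ?_, fun x => ?_, fun j hj hjA x hx => hz j hj hjA _ (hm.maps x hx),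
      fun j hj k hk hjk x hx => hzz j hj k hk hjk _ (hm.maps x hx)⟩
    · beta_reduce; rw [hF, wf_comp hi0 hm]; ring
    · beta_reduce; rw [hH0]
      simp only [T, Finset.prod_disjSum, Finset.prod_singleton, fam]
      ring
  · rintro H0 F0 hM ⟨H, c, u, nf, hF, hH0, hz, hzz⟩
    have hM' : Mono (fun x => ∏ k ∈ T, fam d D H c k x) := hM.congr fun x hx => by rw [hH0]
    apply Res.localize (Finset.subset_insert i0 s')
    intro b hb
    obtain ⟨M, hM⟩ := locMono (s' := s') T (fun k _ => fam_LA nf.hH nf.hc k) (fun k _ => fam_dep nf.hHd nf.hcd k) hM' hb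
    refine ⟨M, ?_⟩
    have hm := bxMove (s' := s') hb M
    have nf2 := nf.comp hi0 hm
    choose! γ g C h1 h2 h3 h4 h5 h6 using hM
    have hHT : Sum.inl () ∈ T := by simp [T]
    have hAT : ∀ j ∈ A, Sum.inr (Sum.inl j) ∈ T := fun j hj => by simp [T, hj]
    have hBT : ∀ jk ∈ Bs, Sum.inr (Sum.inr jk) ∈ T := fun j hj => by simpa [T] using hj
    have hMH : Mono (fun x => 1 * H (bx (ctr s' b) (exq s' M) x)) := by
      simp only [one_mul]
      exact Mono.of_mon (h1 _ hHT) (h5 _ hHT) (h6 _ hHT)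
    have hgoal : Res (insert i0 s') (fun x => (1 * H (bx (ctr s' b) (exq s' M) x)) *
        wf i0 d 0 (fun j x => c j (bx (ctr s' b) (exq s' M) x)) (fun x => u (bx (ctr s' b) (exq s' M) x)) x) := by
      by_cases hA : A.Nonempty
      · refine stage4 hi0 SH nf2 hMH A hAd hA (fun j hj hjA x hx => hz j hj hjA _ (hm.maps x hx))
          (fun j => γ (Sum.inr (Sum.inl j))) (fun j => g (Sum.inr (Sum.inl j))) (fun j => C (Sum.inr (Sum.inl j)))
          (fun j hj => h1 _ (hAT j hj)) (fun j hj => h2 _ (hAT j hj)) (fun j hj => h3 _ (hAT j hj))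
          (fun j hj => h4 _ (hAT j hj)) (fun j hj => h5 _ (hAT j hj)) (fun j hj => h6 _ (hAT j hj)) D
          (Nat.factorial_pos d) (fun j hj => Nat.dvd_factorial (by omega) (by omega)) ?_
        intro j hj k hk
        have hn : ∀ j ∈ A, ∀ x ∈ Bx p ι, ‖c j (bx (ctr s' b) (exq s' M) x) ^ (D / (d - j))‖ =
            C (Sum.inr (Sum.inl j)) ^ (D / (d - j)) * ∏ i, ‖x i‖ ^ ((D / (d - j)) • γ (Sum.inr (Sum.inl j))) i := by
          intro j hj x hx
          have := h6 _ (hAT j hj) x hx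
          simp only [fam] at this
          rw [this, norm_pow, norm_mul, h5 _ (hAT j hj) x hx, mon_norm, mul_pow, mul_comm, ← Finset.prod_pow]
          congr 1
          refine Finset.prod_congr rfl fun i _ => ?_
          rw [← pow_mul, Pi.smul_apply, smul_eq_mul, mul_comm]
        refine comparable (pow_pos (h1 _ (hAT j hj)) _) (pow_pos (h1 _ (hAT k hk)) _) (hn j hj) (hn k hk) ?_
        by_cases hB : (j, k) ∈ Bs
        · exact Or.inr (Mono.of_mon (h1 _ (hBT _ hB)) (h5 _ (hBT _ hB)) (h6 _ (hBT _ hB)))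
        · exact Or.inl fun x hx => hzz j hj k hk hB _ (hm.maps x hx)
      · refine .mono _ (hMH.mul ?_)
        obtain ⟨α, κ1, hκ1, hα⟩ := (Mono.coord (p := p) i0).pow d
        refine ⟨α, κ1 * κ, mul_pos hκ1 nf.hκ, fun x hx => ?_⟩
        have e0 : ∑ j ∈ Finset.range d, (mon 0 x ^ (d - j) * c j (bx (ctr s' b) (exq s' M) x)) * x i0 ^ j = 0 := by
          refine Finset.sum_eq_zero fun j hj => ?_
          rw [hz j (Finset.mem_range.1 hj) (fun h => hA ⟨j, h⟩) _ (hm.maps x hx)]; ring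
        simp only [wf]
        rw [e0, zero_add, norm_mul, hα x hx, nf.huκ _ (hm.maps x hx)]; ring
    refine hgoal.congr fun x hx => ?_
    rw [hF, wf_comp hi0 hm, one_mul]
  · intro j hj hjA
    by_contra h
    exact hjA (Finset.mem_filter.2 ⟨Finset.mem_range.2 hj, h⟩)
  · intro j hj k hk hjk
    by_contra h
    exact hjk (Finset.mem_filter.2 ⟨Finset.mem_product.2 ⟨hj, hk⟩, h⟩)

end res
end IdealZeta
end PartB7

section PartB8
open Filter Topology
open scoped NNReal ENNReal

namespace IdealZeta

set_option linter.unusedSectionVars false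

section res
variable {p : ℕ} [Fact p.Prime] {ι : Type} [Fintype ι] [DecidableEq ι]

/-- projection onto the coordinates in `s`, filled by `a` -/
noncomputable def prj (s : Finset ι) (a x : ι → ℚ_[p]) : ι → ℚ_[p] := fun i => if i ∈ s then x i else a i

theorem prj_an (s : Finset ι) (a x : ι → ℚ_[p]) : AnalyticAt ℚ_[p] (prj s a) x := by
  rw [analyticAt_pi_iff]
  intro i
  by_cases hi : i ∈ s
  · simp only [prj, hi, if_true]; exact analyticAt_coord x i
  · simp only [prj, hi, if_false]; exact analyticAt_const

theorem prj_self (s : Finset ι) (a : ι → ℚ_[p]) : prj s a a = a := by ext i; simp [prj]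

theorem prj_tendsto (s : Finset ι) (a : ι → ℚ_[p]) : Tendsto (prj s a) (𝓝 a) (𝓝 a) := by
  have := (prj_an s a a).continuousAt.tendsto
  rwa [prj_self] at this

theorem prj_dep {s : Finset ι} (a : ι → ℚ_[p]) {x y : ι → ℚ_[p]} (h : ∀ i ∈ (s : Set ι), x i = y i) : prj s a x = prj s a y := by
  ext i
  by_cases hi : i ∈ s
  · simp [prj, hi, h i hi]
  · simp [prj, hi]

theorem prj_upd {s : Finset ι} {i0 : ι} (h0 : i0 ∈ s) (a x : ι → ℚ_[p]) (t : ℚ_[p]) :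
    prj s a (Function.update x i0 t) = Function.update (prj s a x) i0 t := by
  ext i
  by_cases hi : i = i0
  · subst hi; simp [prj, h0]
  · simp [prj, hi]

theorem dep_prj {s : Finset ι} {F : (ι → ℚ_[p]) → ℚ_[p]} (hF : DependsOn F (s : Set ι)) (a x : ι → ℚ_[p]) :
    F (prj s a x) = F x := hF fun i hi => by
      have hi : i ∈ s := hi
      simp [prj, hi]

theorem comp_prj_an {s : Finset ι} {F : (ι → ℚ_[p]) → ℚ_[p]} {a : ι → ℚ_[p]} (hF : AnalyticAt ℚ_[p] F a) :
    AnalyticAt ℚ_[p] (fun x => F (prj s a x)) a := by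
  refine AnalyticAt.comp (f := prj s a) ?_ (prj_an s a a)
  rwa [prj_self]

theorem upd_comp_an {F G : (ι → ℚ_[p]) → ℚ_[p]} {a : ι → ℚ_[p]} (i : ι) (hF : AnalyticAt ℚ_[p] F a)
    (hG : AnalyticAt ℚ_[p] G a) (h : G a = a i) : AnalyticAt ℚ_[p] (fun x => F (Function.update x i (G x))) a := by
  refine AnalyticAt.comp (f := fun x => Function.update x i (G x)) ?_ (analyticAt_update i hG)
  simpa [h] using hF

theorem div_iter {s' : Finset ι} {i0 : ι} (hi0 : i0 ∉ s') {Θ : (ι → ℚ_[p]) → ℚ_[p]} {a : ι → ℚ_[p]}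
    (hΘ : AnalyticAt ℚ_[p] Θ a) (hd : DependsOn Θ (insert i0 s' : Finset ι)) (d : ℕ) :
    ∃ (C : ℕ → (ι → ℚ_[p]) → ℚ_[p]) (U : (ι → ℚ_[p]) → ℚ_[p]), (∀ j, AnalyticAt ℚ_[p] (C j) a) ∧
      (∀ j, DependsOn (C j) (s' : Set ι)) ∧ AnalyticAt ℚ_[p] U a ∧ DependsOn U (insert i0 s' : Finset ι) ∧
      ∀ᶠ w in 𝓝 a, Θ w = (∑ j ∈ Finset.range d, C j w * (w i0 - a i0) ^ j) + (w i0 - a i0) ^ d * U w := by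
  induction d with
  | zero =>
    refine ⟨fun _ _ => 0, Θ, fun _ => analyticAt_const, fun _ => dep_const _ _, hΘ, hd, ?_⟩
    simp
  | succ d ih =>
    obtain ⟨C, U, h1, h2, h3, h4, h5⟩ := ih
    obtain ⟨g, hg, hg2⟩ := division0 h3 i0
    refine ⟨fun j => if j = d then fun x => U (Function.update x i0 (a i0)) else C j,
      fun x => g (prj (insert i0 s') a x), fun j => ?_, fun j => ?_, comp_prj_an hg, ?_, ?_⟩
    · by_cases hj : j = d
      · simp only [hj, if_true]; exact upd_comp_an i0 h3 analyticAt_const rfl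
      · simp only [hj, if_false]; exact h1 j
    · by_cases hj : j = d
      · simp only [hj, if_true]
        intro x y hxy
        apply h4
        intro k hk
        by_cases hk0 : k = i0
        · subst hk0; simp
        · have hk : k ∈ s' := by simpa [hk0] using hk
          simp [hk0, hxy k hk]
      · simp only [hj, if_false]; exact h2 j
    · intro x y hxy
      exact congrArg g (prj_dep a hxy)
    · filter_upwards [h5, (prj_tendsto (insert i0 s') a).eventually hg2] with w hw1 hw2
      rw [dep_prj h4, ← prj_upd (by simp), dep_prj h4] at hw2
      have e : prj (insert i0 s') a w i0 = w i0 := by simp [prj]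
      rw [e] at hw2
      rw [hw1, Finset.sum_range_succ, hw2]
      have : ∑ j ∈ Finset.range d, (if j = d then fun x => U (Function.update x i0 (a i0)) else C j) w * (w i0 - a i0) ^ j
          = ∑ j ∈ Finset.range d, C j w * (w i0 - a i0) ^ j := by
        refine Finset.sum_congr rfl fun j hj => ?_
        rw [if_neg (Finset.mem_range.1 hj).ne]
      rw [this]; simp; ring

/-- straightened function -/
noncomputable def str (i0 : ι) (a : ι → ℚ_[p]) (ψ F : (ι → ℚ_[p]) → ℚ_[p]) (w : ι → ℚ_[p]) : ℚ_[p] :=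
  F (Function.update w i0 (ψ w + (w i0 - a i0)))

theorem root_lemma {s' : Finset ι} {i0 : ι} (hi0 : i0 ∉ s') {F : (ι → ℚ_[p]) → ℚ_[p]} {a : ι → ℚ_[p]} {d : ℕ}
    (hF : AnalyticAt ℚ_[p] F a) (hFd : DependsOn F (insert i0 s' : Finset ι)) (hv : vord i0 F a = d) :
    ∃ ψ : (ι → ℚ_[p]) → ℚ_[p], AnalyticAt ℚ_[p] ψ a ∧ DependsOn ψ (s' : Set ι) ∧ ψ a = a i0 ∧
      (∀ j, j + 1 = d → ∀ᶠ w in 𝓝 a, iteratedDeriv j (fun t => F (Function.update w i0 t)) (ψ w) = 0) ∧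
      (0 < d → ∀ᶠ w in 𝓝 a, w i0 ≠ a i0 → vord i0 (str i0 a ψ F) w < d) := by
  rcases Nat.eq_zero_or_pos d with rfl | hd
  · exact ⟨fun _ => a i0, analyticAt_const, dep_const _ _, rfl, by simp, by simp⟩
  obtain ⟨n, rfl⟩ : ∃ n, d = n + 1 := ⟨d - 1, by omega⟩
  set h := (pd i0)^[n] F with hh
  have hhan : AnalyticAt ℚ_[p] h a := pd_iter_analyticAt i0 n hF
  have h0 : h a = 0 := (vord_le_iff hF (n+1)).1 hv.ge n (Nat.lt_succ_self n)
  have h1 : pd i0 h a ≠ 0 := by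
    have : vord i0 F a < (n + 2 : ℕ) := by rw [hv]; exact_mod_cast Nat.lt_succ_self (n+1)
    obtain ⟨k, hk, hk2⟩ := (vord_lt_iff hF (n+2)).1 this
    have hkn : k = n + 1 := by
      by_contra hne
      exact hk2 ((vord_le_iff hF (n+1)).1 hv.ge k (by omega))
    subst hkn
    rwa [Function.iterate_succ_apply'] at hk2
  obtain ⟨ψ, p1, p2, p3, p4⟩ := implicit i0 hhan h0 h1
  -- division of h
  have hG : AnalyticAt ℚ_[p] (fun x => ψ x + (x i0 - a i0)) a :=
    p1.add ((analyticAt_coord a i0).sub analyticAt_const)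
  have hGa : (fun x => ψ x + (x i0 - a i0)) a = a i0 := by simp [p2]
  have hT : AnalyticAt ℚ_[p] (str i0 a ψ h) a := upd_comp_an i0 hhan hG hGa
  obtain ⟨g, hg, hg2⟩ := division0 hT i0
  have e1 : ∀ x, str i0 a ψ h (Function.update x i0 (a i0)) = h (Function.update x i0 (ψ x)) := by
    intro x; simp [str, p3]
  have hga : g a ≠ 0 := by
    have q1 : ∀ᶠ t in 𝓝 (a i0), h (Function.update a i0 t) = (t - a i0) * g (Function.update a i0 t) := by
      filter_upwards [(tendsto_update i0 a).eventually hg2] with t ht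
      rw [e1] at ht
      simpa [str, p3, p2, h0] using ht
    have q2 : HasDerivAt (fun t => (t - a i0) * g (Function.update a i0 t)) (1 * g (Function.update a i0 (a i0)) +
        (a i0 - a i0) * deriv (fun t => g (Function.update a i0 t)) (a i0)) (a i0) := by
      exact ((hasDerivAt_id' (a i0)).sub_const (a i0)).mul (vf_an i0 hg).differentiableAt.hasDerivAt
    have q3 := deriv_update (x := a) (t := a i0) i0 (F := h) (by simpa using hhan)
    rw [Filter.EventuallyEq.deriv_eq q1, q2.deriv] at q3
    simp at q3
    rw [q3]; exact h1
  have hev1 : ∀ᶠ v in 𝓝 a, h (Function.update v i0 (ψ v)) = 0 ∧ AnalyticAt ℚ_[p] F (Function.update v i0 (ψ v)) := by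
    refine p4.and ?_
    have : Tendsto (fun v => Function.update v i0 (ψ v)) (𝓝 a) (𝓝 a) := by
      have := (analyticAt_update i0 p1).continuousAt.tendsto
      simpa [p2] using this
    exact this.eventually hF.eventually_analyticAt
  have hev2 : ∀ᶠ v in 𝓝 a, v i0 ≠ a i0 → AnalyticAt ℚ_[p] F (Function.update v i0 (ψ v + (v i0 - a i0))) ∧
      vord i0 F (Function.update v i0 (ψ v + (v i0 - a i0))) < (n + 1 : ℕ) := by
    have t1 : Tendsto (fun v => Function.update v i0 (ψ v + (v i0 - a i0))) (𝓝 a) (𝓝 a) := by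
      have := (analyticAt_update i0 hG).continuousAt.tendsto
      simpa [p2] using this
    filter_upwards [t1.eventually hF.eventually_analyticAt, hg2, p4, hg.continuousAt.eventually_ne hga] with v r1 r2 r3 r4 hne
    refine ⟨r1, (vord_lt_iff r1 _).2 ⟨n, Nat.lt_succ_self n, ?_⟩⟩
    rw [e1, r3, zero_add] at r2
    change str i0 a ψ h v ≠ 0
    rw [r2]
    exact mul_ne_zero (sub_ne_zero.2 hne) r4
  let P := prj (insert i0 s') a
  have hψd : DependsOn (fun x => ψ (P x)) (s' : Set ι) := by
    intro x y hxy
    change ψ (P x) = ψ (P y)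
    rw [← p3 (P x) 0, ← p3 (P y) 0]
    simp only [P]
    rw [← prj_upd (by simp), ← prj_upd (by simp)]
    congr 1
    apply prj_dep
    intro k hk
    by_cases hk0 : k = i0
    · subst hk0; simp
    · have hk : k ∈ s' := by simpa [hk0] using hk
      simp [hk0, hxy k hk]
  refine ⟨fun x => ψ (P x), comp_prj_an p1, hψd, ?_, ?_, ?_⟩
  · simp [P, prj_self, p2]
  · rintro j hj
    obtain rfl : j = n := by omega
    filter_upwards [(prj_tendsto (insert i0 s') a).eventually hev1] with w hw
    have e : (fun t => F (Function.update w i0 t)) = fun t => F (Function.update (P w) i0 t) := by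
      ext t; simp only [P]; rw [← prj_upd (by simp), dep_prj hFd]
    rw [e, iteratedDeriv_update i0 j hw.2]
    exact hw.1
  · intro _
    filter_upwards [(prj_tendsto (insert i0 s') a).eventually hev2] with w hw hne
    have e : P w i0 = w i0 := by simp [P, prj]
    obtain ⟨r1, r2⟩ := hw (by change P w i0 ≠ _; rwa [e])
    refine lt_of_eq_of_lt ?_ r2
    refine vord_affine 1 1 (ψ (P w) - a i0) one_ne_zero one_ne_zero ?_ r1 ?_
    · rw [Function.update_self, show prj (insert i0 s') a w i0 = w i0 from e]
      simp only [P]; ring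
    · refine Filter.Eventually.of_forall fun t => ?_
      rw [one_mul, Function.update_idem, str, Function.update_idem, Function.update_self,
        dep_upd hi0 hψd, ← dep_prj hFd a, prj_upd (by simp)]
      congr 2; ring

end res
end IdealZeta
end PartB8

section PartB9
open Filter Topology
open scoped NNReal ENNReal

namespace IdealZeta

set_option linter.unusedSectionVars false

section res
variable {p : ℕ} [Fact p.Prime] {ι : Type} [Fintype ι] [DecidableEq ι]

theorem str_dep {s' : Finset ι} {i0 : ι} {a : ι → ℚ_[p]} {ψ F : (ι → ℚ_[p]) → ℚ_[p]}
    (hψ : DependsOn ψ (s' : Set ι)) (hF : DependsOn F (insert i0 s' : Finset ι)) :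
    DependsOn (str i0 a ψ F) (insert i0 s' : Finset ι) := by
  intro x y hxy
  apply hF
  intro k hk
  by_cases hk0 : k = i0
  · subst hk0
    simp only [Function.update_self]
    rw [hψ (fun i hi => hxy i (by simpa using Or.inr hi)), hxy k (by simp)]
  · simp [hk0, hxy k hk]

theorem str_upd {s' : Finset ι} {i0 : ι} (hi0 : i0 ∉ s') {a : ι → ℚ_[p]} {ψ F : (ι → ℚ_[p]) → ℚ_[p]}
    (hψ : DependsOn ψ (s' : Set ι)) (w : ι → ℚ_[p]) (t : ℚ_[p]) :
    str i0 a ψ F (Function.update w i0 t) = F (Function.update w i0 (ψ w + (t - a i0))) := by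
  rw [str, Function.update_idem, Function.update_self, dep_upd hi0 hψ]

theorem tendsto_add_line (i0 : ι) (w : ι → ℚ_[p]) (b : ℚ_[p]) :
    Tendsto (fun t : ℚ_[p] => Function.update w i0 (b + t)) (𝓝 0) (𝓝 (Function.update w i0 b)) := by
  have hc : Continuous (fun t : ℚ_[p] => Function.update w i0 (b + t)) := by fun_prop
  simpa using hc.tendsto 0

theorem weier {s' : Finset ι} {i0 : ι} (hi0 : i0 ∉ s') {F : (ι → ℚ_[p]) → ℚ_[p]} {a : ι → ℚ_[p]} {d : ℕ}
    (hF : AnalyticAt ℚ_[p] F a) (hFd : DependsOn F (insert i0 s' : Finset ι)) (hv : vord i0 F a = d) :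
    ∃ (ψ : (ι → ℚ_[p]) → ℚ_[p]) (C : ℕ → (ι → ℚ_[p]) → ℚ_[p]) (U : (ι → ℚ_[p]) → ℚ_[p]),
      AnalyticAt ℚ_[p] ψ a ∧ DependsOn ψ (s' : Set ι) ∧ ψ a = a i0 ∧
      (∀ j, AnalyticAt ℚ_[p] (C j) a) ∧ (∀ j, DependsOn (C j) (s' : Set ι)) ∧ (∀ j < d, C j a = 0) ∧
      AnalyticAt ℚ_[p] U a ∧ DependsOn U (insert i0 s' : Finset ι) ∧ U a ≠ 0 ∧
      AnalyticAt ℚ_[p] (str i0 a ψ F) a ∧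
      (∀ᶠ w in 𝓝 a, str i0 a ψ F w = (∑ j ∈ Finset.range d, C j w * (w i0 - a i0) ^ j) + (w i0 - a i0) ^ d * U w) ∧
      (∀ j, j + 1 = d → ∀ᶠ w in 𝓝 a, C j w = 0) ∧
      (0 < d → ∀ᶠ w in 𝓝 a, w i0 ≠ a i0 → vord i0 (str i0 a ψ F) w < d) := by
  obtain ⟨ψ, p1, p2, p3, p4, p5⟩ := root_lemma hi0 hF hFd hv
  have hG : AnalyticAt ℚ_[p] (fun x => ψ x + (x i0 - a i0)) a :=
    p1.add ((analyticAt_coord a i0).sub analyticAt_const)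
  have hT : AnalyticAt ℚ_[p] (str i0 a ψ F) a := upd_comp_an i0 hF hG (by simp [p3])
  obtain ⟨C, U, q1, q2, q3, q4, q5⟩ := div_iter hi0 hT (str_dep p2 hFd) d
  -- restriction to vertical lines
  have key : ∀ w, (∀ᶠ z in 𝓝 (Function.update w i0 (a i0)), str i0 a ψ F z =
      (∑ j ∈ Finset.range d, C j z * (z i0 - a i0) ^ j) + (z i0 - a i0) ^ d * U z) →
      ∀ᶠ t in 𝓝 (0 : ℚ_[p]), F (Function.update w i0 (ψ w + t)) =
        (∑ j ∈ Finset.range d, C j w * t ^ j) + t ^ d * U (Function.update w i0 (a i0 + t)) := by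
    intro w hw
    filter_upwards [(tendsto_add_line i0 w (a i0)).eventually hw] with t ht
    rw [str_upd hi0 p2] at ht
    simpa [dep_upd hi0 (q2 _)] using ht
  have hUan : ∀ w, AnalyticAt ℚ_[p] U (Function.update w i0 (a i0)) →
      AnalyticAt ℚ_[p] (fun t => U (Function.update w i0 (a i0 + t))) 0 := by
    intro w hw
    have h1 := vf_an (x := Function.update w i0 (a i0)) i0 hw
    simp only [Function.update_idem, Function.update_self] at h1
    have h2 : AnalyticAt ℚ_[p] (fun t : ℚ_[p] => a i0 + t) 0 := analyticAt_const.add analyticAt_id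
    refine AnalyticAt.comp (g := fun t => U (Function.update w i0 t)) (f := fun t : ℚ_[p] => a i0 + t) ?_ h2
    simpa using h1
  have hshift : ∀ w, (fun t => F (Function.update w i0 (ψ w + t))) = fun t => (fun t => F (Function.update w i0 t)) (ψ w + t) := fun _ => rfl
  have hunit : (∀ k < d, C k a = 0) ∧ (fun t => U (Function.update a i0 (a i0 + t))) 0 ≠ 0 := by
    refine wform_unit (f := fun t => F (Function.update a i0 (ψ a + t))) (hUan a (by simpa using q3)) (key a (by simpa using q5)) ?_
    have h1 := analyticOrderAt_comp_of_deriv_ne_zero (f := fun t => F (Function.update a i0 t)) (g := fun t : ℚ_[p] => ψ a + t) (z₀ := 0)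
      (analyticAt_const.add analyticAt_id) (by simp)
    have h2 : ((fun t => F (Function.update a i0 t)) ∘ fun t : ℚ_[p] => ψ a + t) = fun t => F (Function.update a i0 (ψ a + t)) := rfl
    rw [h2] at h1
    rw [h1]
    simp only [add_zero, p3]
    exact hv
  have hlast : ∀ j, j + 1 = d → ∀ᶠ w in 𝓝 a, C j w = 0 := by
    intro j hj
    have t1 : Tendsto (fun w => Function.update w i0 (a i0)) (𝓝 a) (𝓝 a) := by
      have hc : Continuous (fun w : ι → ℚ_[p] => Function.update w i0 (a i0)) := by fun_prop
      simpa using hc.tendsto a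
    filter_upwards [p4 j hj, t1.eventually q5.eventually_nhds, t1.eventually q3.eventually_analyticAt] with w h1 h2 h3
    have h4 := iterDeriv_wform (hUan w h3) (key w h2) (k := j) (by omega)
    have h5 := congrFun (iteratedDeriv_comp_const_add j (fun t => F (Function.update w i0 t)) (ψ w)) 0
    simp only [add_zero] at h5
    rw [h5, h1] at h4
    have : (j.factorial : ℚ_[p]) ≠ 0 := by exact_mod_cast j.factorial_ne_zero
    exact ((mul_eq_zero.1 h4.symm).resolve_left this)
  exact ⟨ψ, C, U, p1, p2, p3, q1, q2, hunit.1, q3, q4, by simpa using hunit.2, hT, q5, hlast, p5⟩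

theorem alt_box {κ : Type} (t : Finset κ) {s' : Finset ι} {i0 : ι} (hi0 : i0 ∉ s') {G : κ → (ι → ℚ_[p]) → ℚ_[p]}
    {a : ι → ℚ_[p]} (hG : ∀ k ∈ t, AnalyticAt ℚ_[p] (G k) a) (hd : ∀ k ∈ t, DependsOn (G k) (s' : Set ι)) :
    ∃ M, ∀ m' ≥ M, ∀ m, ∀ k ∈ t, (∀ x ∈ Bx p ι, G k (bx a (ex2 i0 m m') x) = 0) ∨
      NLZ (fun x => G k (bx a (ex2 i0 m m') x)) := by
  have hev : ∀ᶠ w in 𝓝 a, ∀ k ∈ t, ((∀ᶠ z in 𝓝 a, G k z = 0) → G k w = 0) ∧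
      ((¬ ∀ᶠ z in 𝓝 a, G k z = 0) → ¬ ∀ᶠ z in 𝓝 w, G k z = 0) := by
    rw [Filter.eventually_all_finset]
    intro k hk
    rcases identity_lemma (hG k hk) with h | h
    · filter_upwards [h] with w hw using ⟨fun _ => hw, fun h' => absurd h h'⟩
    · filter_upwards [h] with w hw using ⟨fun h' => absurd h' (h.self_of_nhds), fun _ => hw⟩
  obtain ⟨M, hM⟩ := eventually_box hev
  refine ⟨M, fun m' hm' m k hk => ?_⟩
  rw [bx_congr (hd k hk) (c := a) (c' := a) (e := ex2 i0 m m') (e' := fun _ => m') (fun _ _ => rfl)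
    (fun i hi => by simp [ex2, show i ≠ i0 from fun h => hi0 (h ▸ hi)])]
  have e : ∀ x, G k (bx a (ex2 i0 m m') x) = G k (bx a (fun _ => m') x) := fun x =>
    congrFun (bx_congr (hd k hk) (c := a) (c' := a) (e := ex2 i0 m m') (e' := fun _ => m') (fun _ _ => rfl)
    (fun i hi => by simp [ex2, show i ≠ i0 from fun h => hi0 (h ▸ hi)])) x
  by_cases hb : ∀ᶠ z in 𝓝 a, G k z = 0
  · left
    intro x hx
    rw [e]
    exact (hM (fun _ => m') (fun _ => hm') x hx k hk).1 hb
  · right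
    intro x hx h
    exact (hM (fun _ => m') (fun _ => hm') x hx k hk).2 hb (bx_isOpenMap _ _ _ h)

end res
end IdealZeta
end PartB9

section PartB10
open Filter Topology
open scoped NNReal ENNReal
namespace IdealZeta
set_option linter.unusedSectionVars false
section res
variable {p : ℕ} [Fact p.Prime] {ι : Type} [Fintype ι] [DecidableEq ι]

theorem dep_comp_bx {s : Finset ι} {F : (ι → ℚ_[p]) → ℚ_[p]} (hF : DependsOn F (s : Set ι)) (a : ι → ℚ_[p])
    (e : ι → ℕ) : DependsOn (fun x => F (bx a e x)) (s : Set ι) := fun x y h => hF fun i hi => by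
  simp only [bx, h i hi]

theorem bx_upd (a : ι → ℚ_[p]) (e : ι → ℕ) (x : ι → ℚ_[p]) (i : ι) (t : ℚ_[p]) :
    bx a e (Function.update x i t) = Function.update (bx a e x) i (a i + (p : ℚ_[p]) ^ e i * t) := by
  ext k
  rcases eq_or_ne k i with rfl | h
  · simp [bx]
  · simp [bx, h]

theorem ex2_box {i0 : ι} {a : ι → ℚ_[p]} {P : (ι → ℚ_[p]) → Prop} (h : ∀ᶠ x in 𝓝 a, P x) :
    ∃ M : ℕ, ∀ m ≥ M, ∀ m' ≥ M, ∀ x ∈ Bx p ι, P (bx a (ex2 i0 m m') x) := by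
  obtain ⟨M, hM⟩ := eventually_box h
  refine ⟨M, fun m hm m' hm' x hx => hM _ (fun i => ?_) x hx⟩
  unfold ex2; split_ifs <;> assumption

/-- version for functions not depending on `i0` -/
theorem ex2_box' {s' : Finset ι} {i0 : ι} (hi0 : i0 ∉ s') {a : ι → ℚ_[p]} {f : (ι → ℚ_[p]) → ℚ_[p]}
    (hf : DependsOn f (s' : Set ι)) {Q : ℚ_[p] → Prop} (h : ∀ᶠ x in 𝓝 a, Q (f x)) :
    ∃ M : ℕ, ∀ m, ∀ m' ≥ M, ∀ x ∈ Bx p ι, Q (f (bx a (ex2 i0 m m') x)) := by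
  obtain ⟨M, hM⟩ := eventually_box h
  refine ⟨M, fun m m' hm' x hx => ?_⟩
  have := hM (fun _ => m') (fun i => hm') x hx
  convert this using 1
  refine hf fun i hi => ?_
  have : i ≠ i0 := fun e => hi0 (e ▸ hi)
  simp [bx, ex2, this]

theorem eventually_range {d : ℕ} {a : ι → ℚ_[p]} {P : ℕ → (ι → ℚ_[p]) → Prop} (h : ∀ j < d, ∀ᶠ x in 𝓝 a, P j x) :
    ∀ᶠ x in 𝓝 a, ∀ j < d, P j x := by
  have := (Filter.eventually_all_finset (l := 𝓝 a) (p := P) (Finset.range d)).2 (fun j hj => h j (Finset.mem_range.1 hj))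
  filter_upwards [this] with x hx j hj using hx j (Finset.mem_range.2 hj)

theorem exists_range {d : ℕ} {P : ℕ → ℕ → Prop} (h : ∀ j < d, ∃ M, ∀ m ≥ M, P j m) : ∃ M, ∀ m ≥ M, ∀ j < d, P j m := by
  have h2 : ∀ j < d, ∀ᶠ m in atTop, P j m := fun j hj => eventually_atTop.2 (h j hj)
  have := (Filter.eventually_all_finset (l := atTop) (p := P) (Finset.range d)).2 (fun j hj => h2 j (Finset.mem_range.1 hj))
  obtain ⟨M, hM⟩ := eventually_atTop.1 this
  exact ⟨M, fun m hm j hj => hM m hm j (Finset.mem_range.2 hj)⟩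

theorem small_near {f : (ι → ℚ_[p]) → ℚ_[p]} {a : ι → ℚ_[p]} (hf : ContinuousAt f a) (h0 : f a = 0) {r : ℝ} (hr : 0 < r) :
    ∀ᶠ x in 𝓝 a, ‖f x‖ ≤ r := by
  have : Tendsto (fun x => ‖f x‖) (𝓝 a) (𝓝 0) := by
    have := hf.norm.tendsto; simpa [h0] using this
  filter_upwards [this.eventually (gt_mem_nhds hr)] with x hx using hx.le

theorem S_step {s' : Finset ι} {i0 : ι} (hi0 : i0 ∉ s') (MS : MonH p s') {d : ℕ} (SH : SHyp p s' i0 d) :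
    SHyp p s' i0 (d + 1) := by
  intro H F a ha hH hF hHd hFd hH0 hv
  by_cases hlt : vord i0 F a < d
  · exact SH H F a ha hH hF hHd hFd hH0 hlt
  have hveq : vord i0 F a = d := by
    apply le_antisymm _ (not_lt.1 hlt)
    have : ((d+1 : ℕ) : ℕ∞) = (d : ℕ∞) + 1 := by simp
    rw [this] at hv
    exact ENat.lt_add_one_iff (by simp) |>.1 hv
  obtain ⟨ψ, C, U, hψ, hψd, hψa, hC, hCd, hCa, hU, hUd, hUa, hS, hSe, hC1, hO⟩ := weier hi0 hF hFd hveq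
  have hP := p_ne (p := p)
  -- conditions on the box
  have hHn : ∀ᶠ z in 𝓝 a, ¬ ∀ᶠ w in 𝓝 z, H w = 0 := (identity_lemma hH).resolve_left hH0
  have hO' : ∀ᶠ w in 𝓝 a, 0 < d → w i0 ≠ a i0 → vord i0 (str i0 a ψ F) w < d := by
    by_cases hd : 0 < d
    · filter_upwards [hO hd] with w hw _ using hw
    · exact Eventually.of_forall fun w h => absurd h hd
  have hC1' := eventually_range (d := d) (a := a) (P := fun j w => j + 1 = d → C j w = 0) (by
    intro j _
    by_cases hj : j + 1 = d
    · filter_upwards [hC1 j hj] with w hw _ using hw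
    · exact Eventually.of_forall fun w h => absurd h hj)
  have hCan := eventually_range (d := d) (a := a) (P := fun j w => AnalyticAt ℚ_[p] (C j) w) (fun j _ => (hC j).eventually_analyticAt)
  obtain ⟨M, hM⟩ := ex2_box (i0 := i0) (hHn.and (hO'.and (hC1'.and (hCan.and (hSe.and (hH.eventually_analyticAt.and
    (hU.eventually_analyticAt.and (hψ.eventually_analyticAt.and (hS.eventually_analyticAt.and
    (norm_eventually_const hU.continuousAt hUa))))))))))
  set q : ℚ_[p] := (p : ℚ_[p]) ^ M with hq
  have hq0 : q ≠ 0 := pow_ne_zero _ hP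
  have hqn : 0 < ‖q‖ := norm_pos_iff.2 hq0
  -- smallness
  obtain ⟨M1, hM1⟩ := ex2_box' hi0 (Q := fun y => ‖y - a i0‖ ≤ ‖q‖) hψd
    (small_near (f := fun x => ψ x - a i0) (by have := hψ.continuousAt; fun_prop) (by simp [hψa]) hqn)
  have hUn : 0 < ‖U a‖ := norm_pos_iff.2 hUa
  obtain ⟨M2, hM2⟩ := exists_range (d := d) (P := fun j m' => ∀ m, ∀ x ∈ Bx p ι,
      ‖C j (bx a (ex2 i0 m m') x)‖ ≤ ‖q‖ ^ d * ‖U a‖) (by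
    intro j hj
    obtain ⟨M, hM⟩ := ex2_box' hi0 (Q := fun y => ‖y‖ ≤ ‖q‖ ^ d * ‖U a‖) (hCd j)
      (small_near (hC j).continuousAt (hCa j hj) (by positivity))
    exact ⟨M, fun m' hm' m => hM m m' hm'⟩)
  set G : ℕ → (ι → ℚ_[p]) → ℚ_[p] := fun j w => q ^ j * C j w with hG
  have hGan : ∀ j, AnalyticAt ℚ_[p] (G j) a := fun j => analyticAt_const.mul (hC j)
  have hGd : ∀ j, DependsOn (G j) (s' : Set ι) := fun j => by
    intro x y h; simp only [hG, hCd j h]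
  obtain ⟨M3, hM3⟩ := alt_box (Finset.range d) hi0 (G := G) (a := a) (fun j _ => hGan j) (fun j _ => hGd j)
  obtain ⟨M4, hM4⟩ := alt_box (Finset.range d ×ˢ Finset.range d) hi0
    (G := fun jk w => G jk.1 w ^ (d.factorial / (d - jk.1)) - G jk.2 w ^ (d.factorial / (d - jk.2))) (a := a)
    (fun jk _ => ((hGan _).pow _).sub ((hGan _).pow _)) (fun jk _ => by
      intro x y h; simp only [hGd _ h])
  refine ⟨M, M + M1 + M2 + M3 + M4, fun m' hm' => ?_⟩
  set e := ex2 i0 M m' with he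
  have hei : e i0 = M := by simp [he, ex2]
  have hMe : ∀ x ∈ Bx p ι, _ := fun x hx => hM M le_rfl m' (by omega) x hx
  have hM1 : ∀ x ∈ Bx p ι, _ := fun x hx => hM1 M m' (by omega) x hx
  have hM2 : ∀ j < d, ∀ x ∈ Bx p ι, _ := fun j hj x hx => hM2 m' (by omega) j hj M x hx
  have hM3 := hM3 m' (by omega) M
  have hM4 := hM4 m' (by omega) M
  rw [← he] at hM3 hM4
  simp only [← he] at hMe hM1 hM2
  have hz0 : ∀ x : ι → ℚ_[p], bx a e x i0 = q * x i0 + a i0 := fun x => by simp [bx, hei, hq]; ring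
  -- shift
  refine Res.shift _ i0 (Finset.mem_insert_self _ _) (fun x => q⁻¹ * (ψ (bx a e x) - a i0)) ?_ ?_ ?_ ?_ ?_
  · exact (LA_const _).mul ((LA_bx fun x hx => (hMe x hx).2.2.2.2.2.2.2.1).sub (LA_const _))
  · intro x t
    have := dep_upd hi0 (dep_comp_bx hψd a e) x t
    simp only [this]
  · have := dep_mono (Finset.subset_insert i0 s') (dep_comp_bx hψd a e)
    intro x y h; have := this h; simp only [] at this; simp only [this]
  · intro x hx
    rw [norm_mul, norm_inv]
    have := hM1 x hx
    rw [inv_mul_le_iff₀ hqn]; simpa using this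
  have hκ : 0 < ‖q‖ ^ d * ‖U a‖ := by positivity
  set c : ℕ → (ι → ℚ_[p]) → ℚ_[p] := fun j x => if j < d then G j (bx a e x) else 0 with hc
  set u : (ι → ℚ_[p]) → ℚ_[p] := fun x => q ^ d * U (bx a e x) with hu
  have hcj : ∀ j < d, c j = fun x => G j (bx a e x) := fun j hj => by simp [hc, hj]
  have hstr : ∀ x ∈ Bx p ι, str i0 a ψ F (bx a e x) = wf i0 d 0 c u x := by
    intro x hx
    rw [(hMe x hx).2.2.2.2.1]
    have h1 : bx a e x i0 - a i0 = q * x i0 := by rw [hz0]; ring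
    rw [h1]
    simp only [wf, hu]
    congr 1
    · refine Finset.sum_congr rfl fun j hj => ?_
      rw [hcj j (Finset.mem_range.1 hj)]
      simp [hG, mon]; ring
    · ring
  have nf : NF s' i0 d 0 (‖q‖ ^ d * ‖U a‖) (fun x => H (bx a e x)) c u := by
    refine ⟨LA_bx fun x hx => (hMe x hx).2.2.2.2.2.1, dep_comp_bx hHd a e, by simp, hκ, ?_, ?_, ?_, ?_, ?_, ?_, ?_, ?_⟩
    · intro j
      by_cases hj : j < d
      · rw [hcj j hj]
        exact (LA_const _).mul (LA_bx fun x hx => (hMe x hx).2.2.2.1 j hj)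
      · simp only [hc, hj, if_false]; exact LA_const _
    · intro j
      by_cases hj : j < d
      · rw [hcj j hj]
        exact dep_comp_bx (hGd j) a e
      · simp only [hc, hj, if_false]; intro x y _; rfl
    · intro j hj x hx
      rw [hcj j (by omega)]
      simp only [hG, (hMe x hx).2.2.1 j (by omega) hj, mul_zero]
    · intro j hj x hx
      rw [hcj j hj]
      simp only [hG, norm_mul, norm_pow]
      have h1 : ‖q‖ ^ j ≤ 1 := by
        apply pow_le_one₀ (norm_nonneg _)
        rw [hq, norm_pow]; exact pow_le_one₀ (norm_nonneg _) norm_p_le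
      calc _ ≤ 1 * ‖C j (bx a e x)‖ := by gcongr
        _ ≤ _ := by rw [one_mul]; exact hM2 j hj x hx
    · exact (LA_const _).mul (LA_bx fun x hx => (hMe x hx).2.2.2.2.2.2.1)
    · have := dep_comp_bx hUd a e
      intro x y h; have := this h; simp only [] at this; simp only [hu, this]
    · intro x hx
      simp only [hu, norm_mul, norm_pow, (hMe x hx).2.2.2.2.2.2.2.2.2]
    · intro hd x hx hx0
      have hO := (hMe x hx).2.1 hd (by
        rw [hz0]; intro h; apply hx0
        have : q * x i0 = 0 := by linear_combination h
        exact (mul_eq_zero.1 this).resolve_left hq0)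
      rw [← vord_affine (G := wf i0 d 0 c u) (x := x) 1 q (a i0) one_ne_zero hq0 (hz0 x) (hMe x hx).2.2.2.2.2.2.2.2.1] at hO
      · exact hO
      · have := (tendsto_update i0 x).eventually (Bx_mem_nhds hx)
        filter_upwards [this] with t ht
        rw [one_mul, ← hstr _ ht, bx_upd, hei, ← hq, add_comm]
  have key := stage2 hi0 MS SH nf (fun x hx h => by
      exact (hMe x hx).1 (bx_isOpenMap a e x (P := fun w => H w = 0) h))
    (fun j hj => by
      rw [hcj j hj]
      exact hM3 j (Finset.mem_range.2 hj))
    (fun j hj k hk => by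
      rw [hcj j hj, hcj k hk]
      rcases hM4 (j, k) (by simp [hj, hk]) with h | h
      · left; intro x hx; exact sub_eq_zero.1 (h x hx)
      · right; exact h)
  refine key.congr fun x hx => ?_
  rw [← hstr x hx]
  congr 1
  rw [bx_upd, dep_upd hi0 hHd]
  congr 1
  rw [str, hei, ← hq, mul_add, mul_inv_cancel_left₀ hq0, hz0]
  congr 2; ring

theorem S_all {s' : Finset ι} {i0 : ι} (hi0 : i0 ∉ s') (MS : MonH p s') : ∀ d, SHyp p s' i0 d
  | 0 => fun H F a _ _ _ _ _ _ hv => absurd hv (by simp)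
  | d + 1 => S_step hi0 MS (S_all hi0 MS d)

end res
end IdealZeta
end PartB10

section PartB11
open Filter Topology
open scoped NNReal ENNReal
namespace IdealZeta
set_option linter.unusedSectionVars false
section res
variable {p : ℕ} [Fact p.Prime] {ι : Type} [Fintype ι] [DecidableEq ι]

/-- shear map -/
noncomputable def shr (i0 : ι) (v : ι → ℚ_[p]) (T : Finset ι) (x : ι → ℚ_[p]) : ι → ℚ_[p] :=
  fun i => if i ∈ T then x i + v i * x i0 else x i

theorem Res.shiftAll {s : Finset ι} {i0 : ι} (hi0 : i0 ∈ s) {v : ι → ℚ_[p]} (hv : ∀ i, ‖v i‖ ≤ 1)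
    {F : (ι → ℚ_[p]) → ℚ_[p]} (T : Finset ι) : T ⊆ s → i0 ∉ T → Res s (fun x => F (shr i0 v T x)) → Res s F := by
  induction T using Finset.induction_on with
  | empty =>
    intro _ _ h
    have : (fun x => F (shr i0 v ∅ x)) = F := by ext x; congr 1
    rwa [this] at h
  | insert j T hj ih =>
    intro hT hi h
    have hji : j ≠ i0 := fun e => hi (by simp [e])
    refine ih (fun k hk => hT (Finset.mem_insert_of_mem hk)) (fun h' => hi (Finset.mem_insert_of_mem h')) ?_
    refine Res.shift _ j (hT (Finset.mem_insert_self _ _)) (fun x => v j * x i0) ((LA_const _).mul (LA_coord _)) ?_ ?_ ?_ ?_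
    · intro x t; simp [hji.symm]
    · intro x y h; simp [h i0 hi0]
    · intro x hx; exact norm_mul_le_one (hv j) (hx i0)
    · convert h using 3 with x
      ext k
      rcases eq_or_ne k j with rfl | hk
      · simp [shr, hj]
      · simp [shr, hk, hji.symm]

theorem shr_lin_an (i0 : ι) (v : ι → ℚ_[p]) (T : Finset ι) (a x : ι → ℚ_[p]) :
    AnalyticAt ℚ_[p] (fun x => a + shr i0 v T x) x := by
  rw [analyticAt_pi_iff]
  intro i
  simp only [Pi.add_apply, shr]
  have h1 := analyticAt_coord x i
  have h2 := analyticAt_coord x i0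
  split_ifs
  · exact analyticAt_const.add (h1.add (analyticAt_const.mul h2))
  · exact analyticAt_const.add h1

theorem Mon_all (s : Finset ι) : MonH p s := by
  induction s using Finset.induction_on with
  | empty =>
    intro F _ hd hn
    have hc : ∀ x, F x = F 0 := fun x => hd (by simp)
    refine Res.mono _ ⟨0, ‖F 0‖, ?_, fun x _ => by simp [hc x]⟩
    rw [norm_pos_iff]
    intro h
    exact hn 0 (fun i => by simp) (Eventually.of_forall fun x => by rw [hc x, h])
  | insert i0 s' hi0 ih =>
    intro F hF hFd hFn
    have hP := p_ne (p := p)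
    refine Res.localize (t := insert i0 s') subset_rfl fun a0 ha0 => ?_
    set a := ctr (insert i0 s') a0 with ha
    have haB : a ∈ Bx p ι := ctr_mem ha0
    obtain ⟨v, hv0, hv1, hv⟩ := shear (hF a haB) (hFn a haB) i0
    set G : (ι → ℚ_[p]) → ℚ_[p] := fun x => F (a + shr i0 v s' x) with hG
    have hsh0 : a + shr i0 v s' 0 = a := by ext k; simp [shr]
    have hGan : AnalyticAt ℚ_[p] G 0 :=
      AnalyticAt.fun_comp_of_eq (hF a haB) (shr_lin_an i0 v s' a 0) hsh0
    have hGt : vord i0 G 0 ≠ ⊤ := by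
      intro h
      rw [vord, analyticOrderAt_eq_top] at h
      apply hv
      simp only [Pi.zero_apply] at h
      filter_upwards [h] with t ht
      rw [← ht, hG]
      refine hFd fun k hk => ?_
      rcases Finset.mem_insert.1 hk with rfl | hk
      · simp [shr, hi0, hv0]
      · have : k ≠ i0 := fun e => hi0 (e ▸ hk)
        simp [shr, hk, this, mul_comm]
    obtain ⟨M, hM⟩ := eventually_box ((vord_eventually hGan hGt).and hGan.eventually_analyticAt)
    have hM := hM (fun _ => M) (fun _ => le_rfl)
    refine ⟨M, Res.shiftAll (Finset.mem_insert_self _ _) hv1 s' (Finset.subset_insert _ _) hi0 ?_⟩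
    have hK : (fun x => F (bx a (exq (insert i0 s') M) (shr i0 v s' x))) = fun x => G (bx 0 (fun _ => M) x) := by
      ext x
      refine hFd fun k hk => ?_
      have hk' : k ∈ insert i0 s' := hk
      simp only [bx, exq, hk', if_true, Pi.add_apply, shr, Pi.zero_apply]
      split_ifs <;> ring
    rw [hK]
    have hGd : DependsOn G (insert i0 s' : Finset ι) := by
      intro x y h
      refine hFd fun k hk => ?_
      simp only [Pi.add_apply, shr]
      rw [h k hk, h i0 (by simp)]
    refine twoStage hi0 (dep_comp_bx hGd _ _) fun b hb => ?_
    have hKan : AnalyticAt ℚ_[p] (fun x => G (bx 0 (fun _ => M) x)) b :=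
      LA_bx (fun x hx => (hM x hx).2) b hb
    have hKv : vord i0 (fun x => G (bx 0 (fun _ => M) x)) b = vord i0 G (bx 0 (fun _ => M) b) := by
      refine vord_affine 1 ((p : ℚ_[p]) ^ M) 0 one_ne_zero (pow_ne_zero _ hP) (by simp [bx]) (hM b hb).2 ?_
      refine Eventually.of_forall fun t => ?_
      rw [bx_upd]; simp
    have hKt : vord i0 (fun x => G (bx 0 (fun _ => M) x)) b ≠ ⊤ := hKv ▸ (hM b hb).1
    obtain ⟨d, hd⟩ := ENat.ne_top_iff_exists.1 hKt
    have := S_all hi0 ih (d + 1) (fun _ => 1) _ b hb analyticAt_const hKan (fun x y _ => rfl)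
      (dep_comp_bx hGd _ _) (by simpa using NeBot.ne inferInstance) (by rw [← hd]; exact_mod_cast Nat.lt_succ_self d)
    simpa using this

end res
end IdealZeta
end PartB11

section PartC1
open Filter Topology
open scoped NNReal ENNReal
namespace IdealZeta
set_option linter.unusedSectionVars false
section meas
open MeasureTheory
open scoped Classical
variable {p : ℕ} [Fact p.Prime]

noncomputable instance instMS : MeasurableSpace ℚ_[p] := borel _
instance instBS : BorelSpace ℚ_[p] := ⟨rfl⟩

/-- unit ball -/
def OO (p : ℕ) [Fact p.Prime] : Set ℚ_[p] := {x | ‖x‖ ≤ 1}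

theorem OO_eq : OO p = Metric.closedBall 0 1 := by ext x; simp [OO]

theorem OO_meas : MeasurableSet (OO p) := by rw [OO_eq]; exact Metric.isClosed_closedBall.measurableSet

/-- unit ball as positive compact -/
noncomputable def K0 (p : ℕ) [Fact p.Prime] : TopologicalSpace.PositiveCompacts ℚ_[p] where
  carrier := OO p
  isCompact' := by rw [OO_eq]; exact isCompact_closedBall 0 1
  interior_nonempty' := by
    rw [OO_eq]
    refine ⟨0, mem_interior_iff_mem_nhds.2 (Metric.closedBall_mem_nhds _ one_pos)⟩

/-- Haar measure -/
noncomputable def hm (p : ℕ) [Fact p.Prime] : Measure ℚ_[p] := Measure.addHaarMeasure (K0 p)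

noncomputable instance : (hm p).IsAddHaarMeasure := by unfold hm; infer_instance

theorem hm_OO : hm p (OO p) = 1 := Measure.addHaarMeasure_self (K₀ := K0 p)

theorem hm_scale (a : ℚ_[p]) (ha : a ≠ 0) : ∃ c : ℝ≥0∞, ∀ g : ℚ_[p] → ℝ≥0∞, ∫⁻ y, g (a * y) ∂(hm p) = c * ∫⁻ y, g y ∂(hm p) := by
  set e := Homeomorph.mulLeft₀ a ha
  have hI : (Measure.map e (hm p)).IsAddHaarMeasure := by
    refine Measure.isAddHaarMeasure_map (hm p) (AddMonoidHom.mulLeft a) ?_ ?_ ?_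
    · exact e.continuous
    · exact e.surjective
    · exact e.isClosedEmbedding.tendsto_cocompact
  have h := Measure.isAddLeftInvariant_eq_smul (Measure.map e (hm p)) (hm p)
  refine ⟨((Measure.map e (hm p)).addHaarScalarFactor (hm p) : ℝ≥0), fun g => ?_⟩
  have h2 : ∫⁻ y, g (a * y) ∂(hm p) = ∫⁻ y, g y ∂(Measure.map e (hm p)) :=
    (e.measurableEmbedding.lintegral_map g).symm
  rw [h2]
  conv_lhs => rw [h]
  rw [lintegral_smul_measure]
  rfl

/-- cosets of p -/
theorem OO_decomp (y : ℚ_[p]) : (OO p).indicator (1 : ℚ_[p] → ℝ≥0∞) y =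
    ∑ b ∈ Finset.range p, (OO p).indicator (1 : ℚ_[p] → ℝ≥0∞) ((p : ℚ_[p])⁻¹ * (-(b : ℚ_[p]) + y)) := by
  have hP := p_ne (p := p)
  have key : ∀ b : ℕ, ((p : ℚ_[p])⁻¹ * (-(b : ℚ_[p]) + y) ∈ OO p ↔ ‖y - (b : ℚ_[p])‖ < 1) := by
    intro b
    have h1 : ‖(p : ℚ_[p])⁻¹ * (-(b : ℚ_[p]) + y)‖ = p * ‖y - (b : ℚ_[p])‖ := by
      rw [norm_mul, norm_inv, Padic.norm_p, inv_inv]; congr 2; ring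
    have hp0 : (0 : ℝ) < p := by exact_mod_cast (Fact.out : p.Prime).pos
    have h2 : ‖y - (b : ℚ_[p])‖ < 1 ↔ ‖y - (b : ℚ_[p])‖ ≤ (p : ℝ) ^ (-1 : ℤ) := by
      have := Padic.norm_le_pow_iff_norm_lt_pow_add_one (y - (b : ℚ_[p])) (-1)
      rw [this]; simp
    rw [h2]
    simp only [OO, Set.mem_ofPred_eq, h1, zpow_neg_one]
    rw [← le_div_iff₀' hp0, one_div]
  have hb1 : ∀ b : ℕ, ‖(b : ℚ_[p])‖ ≤ 1 := fun b => by
    have := Padic.norm_int_le_one (p := p) b; simpa using this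
  simp only [Set.indicator_apply, key, Pi.one_apply]
  by_cases hy : y ∈ OO p
  · rw [if_pos hy]
    obtain ⟨Y, hY⟩ : ∃ Y : ℤ_[p], (Y : ℚ_[p]) = y := ⟨⟨y, hy⟩, rfl⟩
    have hmem : ∀ n : ℕ, Y - (n : ℤ_[p]) ∈ IsLocalRing.maximalIdeal ℤ_[p] ↔ ‖y - (n : ℚ_[p])‖ < 1 := by
      intro n
      rw [PadicInt.maximalIdeal_eq_span_p, Ideal.mem_span_singleton, ← PadicInt.norm_lt_one_iff_dvd, PadicInt.norm_def]
      simp [hY]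
    obtain ⟨n, ⟨hn, hn1⟩, hu⟩ := PadicInt.existsUnique_mem_range Y
    rw [Finset.sum_eq_single n]
    · rw [if_pos ((hmem n).1 hn1)]
    · intro b hb hbn
      rw [if_neg]
      intro h
      exact hbn (hu b ⟨Finset.mem_range.1 hb, (hmem b).2 h⟩)
    · intro h; exact absurd (Finset.mem_range.2 hn) h
  · rw [if_neg hy]
    symm
    apply Finset.sum_eq_zero
    intro b _
    rw [if_neg]
    intro h
    apply hy
    have : y = (y - b) + b := by ring
    simp only [OO, Set.mem_ofPred_eq]
    rw [this]
    exact norm_add_le_one h.le (hb1 b)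


theorem hm_indicator : ∫⁻ y, (OO p).indicator 1 y ∂(hm p) = 1 := by
  rw [lintegral_indicator_one OO_meas, hm_OO]

theorem scale_p (g : ℚ_[p] → ℝ≥0∞) : ∫⁻ y, g ((p : ℚ_[p])⁻¹ * y) ∂(hm p) = (p : ℝ≥0∞)⁻¹ * ∫⁻ y, g y ∂(hm p) := by
  have hP := p_ne (p := p)
  obtain ⟨c, hc⟩ := hm_scale (p : ℚ_[p])⁻¹ (inv_ne_zero hP)
  rw [hc g]
  congr 1
  have h1 : (1 : ℝ≥0∞) = p * c := by
    calc (1 : ℝ≥0∞) = ∫⁻ y, (OO p).indicator 1 y ∂(hm p) := hm_indicator.symm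
      _ = ∫⁻ y, ∑ b ∈ Finset.range p, (OO p).indicator (1 : ℚ_[p] → ℝ≥0∞) ((p : ℚ_[p])⁻¹ * (-(b : ℚ_[p]) + y)) ∂(hm p) :=
        lintegral_congr fun y => OO_decomp y
      _ = ∑ b ∈ Finset.range p, ∫⁻ y, (OO p).indicator (1 : ℚ_[p] → ℝ≥0∞) ((p : ℚ_[p])⁻¹ * (-(b : ℚ_[p]) + y)) ∂(hm p) := by
        apply lintegral_finsetSum
        intro b _
        exact (measurable_one.indicator OO_meas).comp (by fun_prop)
      _ = ∑ b ∈ Finset.range p, c := by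
        refine Finset.sum_congr rfl fun b _ => ?_
        rw [lintegral_add_left_eq_self (fun y => (OO p).indicator (1 : ℚ_[p] → ℝ≥0∞) ((p : ℚ_[p])⁻¹ * y)), hc,
          hm_indicator, mul_one]
      _ = p * c := by simp
  have hp0 : (p : ℝ≥0∞) ≠ 0 := by exact_mod_cast (Fact.out : p.Prime).ne_zero
  rw [ENNReal.eq_inv_of_mul_eq_one_left (a := c) (b := p)]
  rw [mul_comm]; exact h1.symm

/-- real scaling -/
theorem scale (a : ℚ_[p]) (ha : a ≠ 0) (g : ℚ_[p] → ℝ≥0∞) :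
    ∫⁻ y, g y ∂(hm p) = ‖a‖ₑ * ∫⁻ y, g (a * y) ∂(hm p) := by
  have hP := p_ne (p := p)
  have hp0 : (p : ℝ≥0∞) ≠ 0 := by exact_mod_cast (Fact.out : p.Prime).ne_zero
  -- units
  have hun : ∀ u : ℚ_[p], ‖u‖ = 1 → ∀ g : ℚ_[p] → ℝ≥0∞, ∫⁻ y, g y ∂(hm p) = ∫⁻ y, g (u * y) ∂(hm p) := by
    intro u hu g
    have hu0 : u ≠ 0 := by intro h; simp [h] at hu
    obtain ⟨c, hc⟩ := hm_scale u hu0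
    have h1 := hc ((OO p).indicator 1)
    have h2 : ∀ y, (OO p).indicator (1 : ℚ_[p] → ℝ≥0∞) (u * y) = (OO p).indicator 1 y := by
      intro y
      simp only [Set.indicator_apply, OO, Set.mem_ofPred_eq, norm_mul, hu, one_mul]
      rfl
    rw [lintegral_congr h2, hm_indicator, mul_one] at h1
    rw [hc, ← h1, one_mul]
  have hpw : ∀ (n : ℕ) (g : ℚ_[p] → ℝ≥0∞), ∫⁻ y, g ((p : ℚ_[p])⁻¹ ^ n * y) ∂(hm p) = (p : ℝ≥0∞)⁻¹ ^ n * ∫⁻ y, g y ∂(hm p) := by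
    intro n
    induction n with
    | zero => intro g; simp
    | succ n ih =>
      intro g
      have h1 := scale_p (p := p) (fun y => g ((p : ℚ_[p])⁻¹ ^ n * y))
      rw [ih] at h1
      rw [pow_succ, pow_succ', mul_assoc, ← h1]
      refine lintegral_congr fun y => ?_
      congr 1; ring
  have hfin : (p : ℝ≥0∞) ≠ ⊤ := by simp
  have hzp : ∀ (n : ℤ) (g : ℚ_[p] → ℝ≥0∞), ∫⁻ y, g ((p : ℚ_[p]) ^ n * y) ∂(hm p) = (p : ℝ≥0∞) ^ n * ∫⁻ y, g y ∂(hm p) := by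
    intro n g
    obtain ⟨k, rfl | rfl⟩ := n.eq_nat_or_neg
    · have := hpw k (fun y => g ((p : ℚ_[p]) ^ k * y))
      have h2 : (fun y => g ((p : ℚ_[p]) ^ k * ((p : ℚ_[p])⁻¹ ^ k * y))) = g := by
        ext y; rw [inv_pow, mul_inv_cancel_left₀ (pow_ne_zero _ hP)]
      simp only [h2] at this
      rw [this, zpow_natCast, zpow_natCast, ← mul_assoc, ← ENNReal.inv_pow,
        ENNReal.mul_inv_cancel (pow_ne_zero _ hp0) (ENNReal.pow_ne_top hfin), one_mul]
    · have := hpw k g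
      rw [inv_pow] at this
      rw [zpow_neg, zpow_natCast, this, ENNReal.zpow_neg, zpow_natCast, ENNReal.inv_pow]
  set n := a.valuation
  have hn : ‖a‖ = (p : ℝ) ^ (-n) := Padic.norm_eq_zpow_neg_valuation ha
  have hp0' : (p : ℝ) ≠ 0 := by exact_mod_cast (Fact.out : p.Prime).ne_zero
  have hu1 : ‖((p : ℚ_[p]) ^ (-n) * a)‖ = 1 := by
    rw [norm_mul, norm_zpow, Padic.norm_p, hn, ← mul_zpow, inv_mul_cancel₀ hp0', one_zpow]
  have h1 := hun _ hu1 (fun y => g ((p : ℚ_[p]) ^ n * y))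
  have h2 : ∀ y, g ((p : ℚ_[p]) ^ n * ((p : ℚ_[p]) ^ (-n) * a * y)) = g (a * y) := by
    intro y; rw [← mul_assoc, ← mul_assoc, ← zpow_add₀ hP]; simp
  rw [lintegral_congr h2, hzp] at h1
  rw [← h1, ← mul_assoc]
  have h3 : ‖a‖ₑ = (p : ℝ≥0∞) ^ (-n) := by
    rw [← ofReal_norm, hn]
    have h4 : (p : ℝ≥0) ≠ 0 := by exact_mod_cast (Fact.out : p.Prime).ne_zero
    have h5 : ((p : ℝ) ^ (-n)) = (((p : ℝ≥0) ^ (-n) : ℝ≥0) : ℝ) := by push_cast; rfl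
    rw [h5, ENNReal.ofReal_coe_nnreal, ENNReal.coe_zpow h4]
    simp
  rw [h3, ← ENNReal.zpow_add hp0 hfin]
  simp

/-- normalized measure on the unit ball -/
noncomputable def nu (p : ℕ) [Fact p.Prime] : Measure ℚ_[p] := (hm p).restrict (OO p)

instance : IsProbabilityMeasure (nu p) := ⟨by simp [nu, hm_OO]⟩

theorem nu_int (g : ℚ_[p] → ℝ≥0∞) : ∫⁻ y, g y ∂(nu p) = ∫⁻ y, (OO p).indicator g y ∂(hm p) := by
  rw [nu, lintegral_indicator OO_meas]

theorem nu_congr {f g : ℚ_[p] → ℝ≥0∞} (h : ∀ y, ‖y‖ ≤ 1 → f y = g y) : ∫⁻ y, f y ∂(nu p) = ∫⁻ y, g y ∂(nu p) := by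
  rw [nu]; exact setLIntegral_congr_fun OO_meas (fun y hy => h y hy)

theorem mv_shift (g : ℚ_[p] → ℝ≥0∞) (b : ℚ_[p]) (hb : ‖b‖ ≤ 1) : ∫⁻ y, g y ∂(nu p) = ∫⁻ y, g (y + b) ∂(nu p) := by
  rw [nu_int, nu_int, ← lintegral_add_right_eq_self _ b]
  refine lintegral_congr fun y => ?_
  simp only [Set.indicator_apply]
  congr 1
  simp only [OO, Set.mem_ofPred_eq, eq_iff_iff]
  refine ⟨fun h => ?_, fun h => norm_add_le_one h hb⟩
  have : y = (y + b) + (-b) := by ring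
  rw [this]; exact norm_add_le_one h (by simpa using hb)

theorem nu_zero : nu p {0} = 0 := by
  rw [nu, Measure.restrict_apply (by simp)]
  refine measure_mono_null Set.inter_subset_left ?_
  have h := scale (p : ℚ_[p]) p_ne (Set.indicator {0} 1)
  have h2 : ∀ y : ℚ_[p], (Set.indicator {0} (1 : ℚ_[p] → ℝ≥0∞)) (p * y) = Set.indicator {0} 1 y := by
    intro y; simp [Set.indicator_apply, (Fact.out : p.Prime).ne_zero]
  rw [lintegral_congr h2, lintegral_indicator_one (by simp)] at h
  by_contra h0
  have hle : hm p {0} ≤ 1 := by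
    rw [← hm_OO (p := p)]; exact measure_mono (by simp [OO])
  have h3 : ‖(p : ℚ_[p])‖ₑ < 1 := by
    rw [← ofReal_norm, ENNReal.ofReal_lt_one]; exact Padic.norm_p_lt_one
  have := ENNReal.mul_lt_mul_left h0 (ne_top_of_le_ne_top ENNReal.one_ne_top hle) h3
  rw [one_mul] at this
  exact absurd h this.ne'

theorem mv_ball (g : ℚ_[p] → ℝ≥0∞) (a : ℚ_[p]) (ha : ‖a‖ ≤ 1) :
    ∫⁻ y, Set.indicator {y | ‖y‖ ≤ ‖a‖} g y ∂(nu p) = ‖a‖ₑ * ∫⁻ y, g (a * y) ∂(nu p) := by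
  by_cases h0 : a = 0
  · subst h0
    simp only [enorm_zero, zero_mul]
    have : {y : ℚ_[p] | ‖y‖ ≤ ‖(0 : ℚ_[p])‖} = {0} := by ext y; simp
    rw [this, lintegral_indicator (by simp), Measure.restrict_eq_zero.2 nu_zero]
    simp
  · rw [nu_int, nu_int, scale a h0]
    congr 1
    refine lintegral_congr fun y => ?_
    have hn : 0 < ‖a‖ := norm_pos_iff.2 h0
    simp only [Set.indicator_apply, OO, Set.mem_ofPred_eq, norm_mul]
    by_cases hy : ‖y‖ ≤ 1
    · rw [if_pos (mul_le_one₀ ha (norm_nonneg _) hy), if_pos (by nlinarith), if_pos hy]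
    · rw [if_neg hy, if_neg (c := ‖a‖ * ‖y‖ ≤ ‖a‖) (by intro h; apply hy; nlinarith)]
      simp

theorem mv_sub (g : ℚ_[p] → ℝ≥0∞) (hg : Measurable g) :
    ∫⁻ y, g y ∂(nu p) = ∑ b ∈ Finset.range p, (p : ℝ≥0∞)⁻¹ * ∫⁻ y, g (b + p * y) ∂(nu p) := by
  have hP := p_ne (p := p)
  have h1 : ∀ y, (OO p).indicator g y = ∑ b ∈ Finset.range p,
      g y * (OO p).indicator (1 : ℚ_[p] → ℝ≥0∞) ((p : ℚ_[p])⁻¹ * (-(b : ℚ_[p]) + y)) := by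
    intro y; rw [← Finset.mul_sum, ← OO_decomp]; simp [Set.indicator_apply]
  rw [nu_int, lintegral_congr h1, lintegral_finsetSum]
  · refine Finset.sum_congr rfl fun b _ => ?_
    rw [nu_int, ← lintegral_add_left_eq_self _ (b : ℚ_[p]), scale (p : ℚ_[p]) hP]
    congr 1
    · rw [← ofReal_norm, Padic.norm_p, ENNReal.ofReal_inv_of_pos (by exact_mod_cast (Fact.out : p.Prime).pos)]; simp
    · refine lintegral_congr fun y => ?_
      rw [neg_add_cancel_left, inv_mul_cancel_left₀ hP]
      simp [Set.indicator_apply]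
  · intro b _
    exact hg.mul ((measurable_one.indicator OO_meas).comp (by fun_prop))

end meas
end IdealZeta
end PartC1

section PartC2
open Filter Topology
open scoped NNReal ENNReal
namespace IdealZeta
set_option linter.unusedSectionVars false
section meas
open MeasureTheory
open scoped Classical
variable {p : ℕ} [Fact p.Prime]

/-- unit sphere -/
def UU (p : ℕ) [Fact p.Prime] : Set ℚ_[p] := {x | ‖x‖ = 1}

theorem UU_meas : MeasurableSet (UU p) := by
  have : UU p = (fun x => ‖x‖) ⁻¹' {1} := by ext x; simp [UU]
  rw [this]; exact measurable_norm (measurableSet_singleton _)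

/-- measure on the sphere -/
noncomputable def ka (p : ℕ) [Fact p.Prime] : Measure ℚ_[p] := (hm p).restrict (UU p)

theorem ka_int (g : ℚ_[p] → ℝ≥0∞) : ∫⁻ y, g y ∂(ka p) = ∫⁻ y, (UU p).indicator g y ∂(hm p) := by
  rw [ka, lintegral_indicator UU_meas]

theorem UU_sub : UU p ⊆ OO p := fun _ h => le_of_eq h

instance : IsFiniteMeasure (ka p) := ⟨by
  rw [ka, Measure.restrict_apply_univ]
  exact (measure_mono UU_sub).trans_lt (by rw [hm_OO]; simp)⟩

theorem ka_congr {f g : ℚ_[p] → ℝ≥0∞} (h : ∀ y, ‖y‖ = 1 → f y = g y) : ∫⁻ y, f y ∂(ka p) = ∫⁻ y, g y ∂(ka p) := by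
  rw [ka]; exact setLIntegral_congr_fun UU_meas (fun y hy => h y hy)

theorem ka_scale (w : ℚ_[p]) (hw : ‖w‖ = 1) (g : ℚ_[p] → ℝ≥0∞) : ∫⁻ y, g (w * y) ∂(ka p) = ∫⁻ y, g y ∂(ka p) := by
  have hw0 : w ≠ 0 := by intro h; simp [h] at hw
  rw [ka_int, ka_int, scale w hw0 ((UU p).indicator g)]
  have : ‖w‖ₑ = 1 := by rw [← ofReal_norm, hw]; simp
  rw [this, one_mul]
  refine lintegral_congr fun y => ?_
  simp only [Set.indicator_apply, UU, Set.mem_ofPred_eq, norm_mul, hw, one_mul]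

theorem ka_univ_ne : ka p Set.univ ≠ 0 := by
  rw [ka, Measure.restrict_apply_univ]
  intro h
  have h1 : OO p ⊆ UU p ∪ {y | ‖y‖ ≤ ‖(p : ℚ_[p])‖} := by
    intro y hy
    rcases eq_or_lt_of_le (show ‖y‖ ≤ 1 from hy) with h | h
    · exact Or.inl h
    · right
      have := (Padic.norm_le_pow_iff_norm_lt_pow_add_one y (-1)).2 (by simpa using h)
      simpa using this
  have h2 : hm p (OO p ∩ {y | ‖y‖ ≤ ‖(p : ℚ_[p])‖}) = ‖(p : ℚ_[p])‖ₑ := by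
    have := mv_ball (p := p) 1 (p : ℚ_[p]) norm_p_le
    have hme : MeasurableSet {y : ℚ_[p] | ‖y‖ ≤ ‖(p : ℚ_[p])‖} := measurableSet_le measurable_norm measurable_const
    rw [lintegral_indicator_one hme, nu, Measure.restrict_apply hme] at this
    rw [Set.inter_comm, this]; simp
    rw [hm_OO, mul_one]
  have h3 : hm p (OO p) ≤ hm p (UU p) + hm p (OO p ∩ {y | ‖y‖ ≤ ‖(p : ℚ_[p])‖}) := by
    refine (measure_mono fun y hy => ?_).trans (measure_union_le _ _)
    rcases h1 hy with h | h
    · exact Or.inl h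
    · exact Or.inr ⟨hy, h⟩
  rw [h, h2, hm_OO, zero_add, ← ofReal_norm] at h3
  have : ENNReal.ofReal ‖(p : ℚ_[p])‖ < 1 := by
    rw [ENNReal.ofReal_lt_one]; exact Padic.norm_p_lt_one
  exact absurd h3 (not_le.2 this)

theorem mth_root (m : ℕ) (hm : 1 ≤ m) : ∃ N : ℕ, 1 ≤ N ∧ ∀ y : ℚ_[p], ‖y - 1‖ ≤ ‖(p : ℚ_[p]) ^ N‖ → ∃ w : ℚ_[p], ‖w‖ = 1 ∧ w ^ m = y := by
  have hm0 : (m : ℤ_[p]) ≠ 0 := by exact_mod_cast (by omega : m ≠ 0)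
  have hmn : 0 < ‖(m : ℤ_[p])‖ ^ 2 := by have := norm_pos_iff.2 hm0; positivity
  obtain ⟨N, hN⟩ := exists_pow_lt_of_lt_one hmn (Padic.norm_p_lt_one (p := p))
  refine ⟨N + 1, by omega, fun y hy => ?_⟩
  have hp1 := Padic.norm_p_lt_one (p := p)
  have hp0 := norm_p_pos (p := p)
  have hlt : ‖y - 1‖ < ‖(m : ℤ_[p])‖ ^ 2 := by
    refine lt_of_le_of_lt hy (lt_of_le_of_lt ?_ hN)
    rw [norm_pow]; exact pow_le_pow_of_le_one hp0.le hp1.le (by omega)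
  have hlt1 : ‖y - 1‖ < 1 := by
    refine lt_of_le_of_lt hy ?_
    rw [norm_pow]; exact pow_lt_one₀ hp0.le hp1 (by omega)
  have hy1 : ‖y‖ = 1 := by
    have := Padic.norm_eq_of_norm_sub_lt_right (z1 := y) (z2 := 1) (by simpa using hlt1)
    simpa using this
  obtain ⟨Y, rfl⟩ : ∃ Y : ℤ_[p], (Y : ℚ_[p]) = y := ⟨⟨y, hy1.le⟩, rfl⟩
  obtain ⟨z, hz, -⟩ := hensels_lemma (p := p) (R := ℤ_[p]) (F := Polynomial.X ^ m - Polynomial.C Y) (a := 1) (by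
    simp [Polynomial.derivative_X_pow]
    rw [norm_sub_rev, PadicInt.norm_def]
    simpa [PadicInt.norm_def] using hlt)
  have hz' : z ^ m = Y := by
    simpa [sub_eq_zero] using hz
  refine ⟨z, ?_, by rw [← hz']; simp⟩
  have : ‖(z : ℚ_[p])‖ ^ m = 1 := by rw [← norm_pow, ← PadicInt.coe_pow, hz', hy1]
  exact (pow_eq_one_iff_of_nonneg (norm_nonneg _) (by omega)).1 this

theorem reps (N : ℕ) (hN : 1 ≤ N) : ∃ T : Finset ℚ_[p], T.Nonempty ∧ (∀ ω ∈ T, ‖ω‖ = 1) ∧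
    (∀ u : ℚ_[p], ‖u‖ = 1 → ∃ ω ∈ T, ‖u - ω‖ ≤ ‖(p : ℚ_[p]) ^ N‖) ∧
    (∀ ω ∈ T, ∀ ω' ∈ T, ‖ω - ω'‖ ≤ ‖(p : ℚ_[p]) ^ N‖ → ω = ω') := by
  have hp0 := norm_p_pos (p := p)
  have hp1 := Padic.norm_p_lt_one (p := p)
  have hex : ∀ u : ℚ_[p], ‖u‖ = 1 → ∃ ω ∈ ((Finset.range (p ^ N)).image (fun b : ℕ => (b : ℚ_[p]))).filter (fun x => ‖x‖ = 1), ‖u - ω‖ ≤ ‖(p : ℚ_[p]) ^ N‖ := by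
    intro u hu
    obtain ⟨Y, rfl⟩ : ∃ Y : ℤ_[p], (Y : ℚ_[p]) = u := ⟨⟨u, hu.le⟩, rfl⟩
    have h1 := PadicInt.appr_spec N Y
    have h2 : ‖(Y : ℚ_[p]) - ((Y.appr N : ℕ) : ℚ_[p])‖ ≤ ‖(p : ℚ_[p]) ^ N‖ := by
      rw [← PadicInt.norm_le_pow_iff_mem_span_pow, PadicInt.norm_def] at h1
      simpa using h1
    refine ⟨_, Finset.mem_filter.2 ⟨Finset.mem_image.2 ⟨Y.appr N, Finset.mem_range.2 (PadicInt.appr_lt _ _), rfl⟩, ?_⟩, h2⟩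
    rw [← hu]
    symm
    apply Padic.norm_eq_of_norm_sub_lt_left
    rw [hu]
    refine lt_of_le_of_lt h2 ?_
    rw [norm_pow]; exact pow_lt_one₀ hp0.le hp1 (by omega)
  refine ⟨((Finset.range (p ^ N)).image (fun b : ℕ => (b : ℚ_[p]))).filter (fun x => ‖x‖ = 1), ?_, ?_, hex, ?_⟩
  · obtain ⟨ω, h, -⟩ := hex 1 (by simp); exact ⟨ω, h⟩
  · intro ω h; exact (Finset.mem_filter.1 h).2
  · intro ω h ω' h' hle
    obtain ⟨b, hb, rfl⟩ := Finset.mem_image.1 (Finset.mem_filter.1 h).1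
    obtain ⟨b', hb', rfl⟩ := Finset.mem_image.1 (Finset.mem_filter.1 h').1
    have h3 : ‖(((b : ℤ) - b' : ℤ) : ℚ_[p])‖ ≤ (p : ℝ) ^ (-N : ℤ) := by
      push_cast
      rw [norm_pow, Padic.norm_p, inv_pow] at hle
      simpa using hle
    rw [Padic.norm_int_le_pow_iff_dvd] at h3
    have h4 : (b' : ℤ) ≡ b [ZMOD ((p ^ N : ℕ) : ℤ)] := (Int.modEq_iff_dvd).2 (by exact_mod_cast h3)
    have h5 : b' ≡ b [MOD p ^ N] := Int.natCast_modEq_iff.1 h4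
    have h6 := Nat.ModEq.eq_of_lt_of_lt h5 (Finset.mem_range.1 hb') (Finset.mem_range.1 hb)
    rw [h6]

end meas
end IdealZeta
end PartC2

section PartC3
open Filter Topology
open scoped NNReal ENNReal
namespace IdealZeta
set_option linter.unusedSectionVars false
section meas
open MeasureTheory
open scoped Classical
variable {p : ℕ} [Fact p.Prime]

theorem sphere_pow (m : ℕ) (hm : 1 ≤ m) : ∃ T : Finset ℚ_[p], T.Nonempty ∧ (∀ ω ∈ T, ‖ω‖ = 1) ∧
    ∀ h : ℚ_[p] → ℝ≥0∞, Measurable h → ∑ ω ∈ T, ∫⁻ u, h (ω * u ^ m) ∂(ka p) = T.card * ∫⁻ u, h u ∂(ka p) := by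
  obtain ⟨N, hN1, hN⟩ := mth_root (p := p) m hm
  obtain ⟨T, hT0, hT1, hT2, hT3⟩ := reps (p := p) N hN1
  refine ⟨T, hT0, hT1, fun h hh => ?_⟩
  -- invariance
  have inv : ∀ v : ℚ_[p], ‖v‖ = 1 → ∑ ω ∈ T, ∫⁻ u, h (v * (ω * u ^ m)) ∂(ka p) = ∑ ω ∈ T, ∫⁻ u, h (ω * u ^ m) ∂(ka p) := by
    intro v hv
    have hσ : ∀ ω : ℚ_[p], ω ∈ T → ∃ ω' ∈ T, ‖v * ω - ω'‖ ≤ ‖(p : ℚ_[p]) ^ N‖ := fun ω hω =>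
      hT2 _ (by rw [norm_mul, hv, hT1 ω hω, one_mul])
    choose! σ hσT hσ using hσ
    have hinj : Set.InjOn σ (T : Set ℚ_[p]) := by
      intro ω hω ω' hω' he
      apply hT3 ω hω ω' hω'
      have h1 : ‖ω - ω'‖ = ‖(v * ω - σ ω) - (v * ω' - σ ω')‖ := by
        rw [he]
        have : v * ω - σ ω' - (v * ω' - σ ω') = v * (ω - ω') := by ring
        rw [this, norm_mul, hv, one_mul]
      rw [h1]
      rw [sub_eq_add_neg (v * ω - σ ω)]
      refine (Padic.nonarchimedean _ _).trans ?_
      rw [norm_neg]; exact max_le (hσ ω hω) (hσ ω' hω')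
    have himg : T.image σ = T := Finset.eq_of_subset_of_card_le
      (Finset.image_subset_iff.2 hσT) (by rw [Finset.card_image_of_injOn hinj])
    conv_rhs => rw [← himg, Finset.sum_image hinj]
    refine Finset.sum_congr rfl fun ω hω => ?_
    have hs1 := hT1 _ (hσT ω hω)
    have hs0 : σ ω ≠ 0 := by intro h; simp [h] at hs1
    obtain ⟨w, hw, hwm⟩ := hN (v * ω / σ ω) (by
      have : v * ω / σ ω - 1 = (v * ω - σ ω) / σ ω := by field_simp
      rw [this, norm_div, hs1, div_one]; exact hσ ω hω)
    rw [← ka_scale w hw (fun u => h (σ ω * u ^ m))]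
    refine lintegral_congr fun u => ?_
    rw [mul_pow, hwm]; congr 1; field_simp
  set A := ∑ ω ∈ T, ∫⁻ u, h (ω * u ^ m) ∂(ka p)
  have h1 : ∫⁻ v, A ∂(ka p) = ∑ ω ∈ T, ∫⁻ v, ∫⁻ u, h (v * (ω * u ^ m)) ∂(ka p) ∂(ka p) := by
    rw [← lintegral_finsetSum]
    · exact ka_congr fun v hv => (inv v hv).symm
    · intro ω _
      apply Measurable.lintegral_prod_right' (f := fun z : ℚ_[p] × ℚ_[p] => h (z.1 * (ω * z.2 ^ m)))
      exact hh.comp (by fun_prop)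
  have h2 : ∀ ω ∈ T, ∫⁻ v, ∫⁻ u, h (v * (ω * u ^ m)) ∂(ka p) ∂(ka p) = (∫⁻ u, h u ∂(ka p)) * ka p Set.univ := by
    intro ω hω
    rw [lintegral_lintegral_swap]
    · rw [← lintegral_const]
      refine ka_congr fun u hu => ?_
      rw [← ka_scale (ω * u ^ m) (by simp [hT1 ω hω, hu]) h]
      refine lintegral_congr fun v => by rw [mul_comm]
    · apply Measurable.aemeasurable
      exact hh.comp (by fun_prop)
  rw [Finset.sum_congr rfl h2, lintegral_const, Finset.sum_const, nsmul_eq_mul, ← mul_assoc] at h1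
  exact (ENNReal.mul_left_inj ka_univ_ne (measure_ne_top _ _)).1 h1

theorem shells (g : ℚ_[p] → ℝ≥0∞) (hg : Measurable g) :
    ∫⁻ y, g y ∂(nu p) = ∑' j : ℕ, (p : ℝ≥0∞)⁻¹ ^ j * ∫⁻ u, g ((p : ℚ_[p]) ^ j * u) ∂(ka p) := by
  have hp0 := norm_p_pos (p := p)
  have hp1 := Padic.norm_p_lt_one (p := p)
  have hP := p_ne (p := p)
  have hSm : ∀ j : ℕ, MeasurableSet {y : ℚ_[p] | ‖y‖ = ‖(p : ℚ_[p])‖ ^ j} := fun j =>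
    measurable_norm (measurableSet_singleton _)
  have h1 : ∫⁻ y, g y ∂(nu p) = ∫⁻ y, ∑' j : ℕ, Set.indicator {y : ℚ_[p] | ‖y‖ = ‖(p : ℚ_[p])‖ ^ j} g y ∂(nu p) := by
    apply lintegral_congr_ae
    have h0 : ∀ᵐ y ∂(nu p), y ≠ 0 := by
      rw [ae_iff]; simpa using nu_zero (p := p)
    have h2 : ∀ᵐ y ∂(nu p), y ∈ OO p := ae_restrict_mem OO_meas
    filter_upwards [h0, h2] with y hy hy1
    obtain ⟨j, hj⟩ : ∃ j : ℕ, ‖y‖ = ‖(p : ℚ_[p])‖ ^ j := by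
      have hv := Padic.norm_eq_zpow_neg_valuation hy
      have : 0 ≤ y.valuation := (Padic.norm_le_one_iff_val_nonneg y).1 hy1
      obtain ⟨k, hk⟩ := Int.eq_ofNat_of_zero_le this
      refine ⟨k, ?_⟩
      rw [hv, hk, Padic.norm_p, inv_pow, zpow_neg]; simp
    rw [tsum_eq_single j]
    · rw [Set.indicator_of_mem (show y ∈ {y : ℚ_[p] | ‖y‖ = ‖(p:ℚ_[p])‖^j} from hj)]
    · intro k hk
      rw [Set.indicator_of_notMem]
      intro h
      exact hk ((pow_right_injective₀ hp0 hp1.ne) ((show ‖y‖ = _ from h).symm.trans hj))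
  rw [h1, lintegral_tsum (fun j => (hg.indicator (hSm j)).aemeasurable)]
  refine tsum_congr fun j => ?_
  have hpj : ‖(p : ℚ_[p]) ^ j‖ ≤ 1 := by rw [norm_pow]; exact pow_le_one₀ hp0.le hp1.le
  have h3 := mv_ball (Set.indicator {y : ℚ_[p] | ‖y‖ = ‖(p : ℚ_[p])‖ ^ j} g) ((p : ℚ_[p]) ^ j) hpj
  rw [Set.indicator_indicator, Set.inter_eq_self_of_subset_right] at h3
  · rw [h3]
    congr 1
    · rw [← ofReal_norm, norm_pow, Padic.norm_p, ENNReal.ofReal_pow (by positivity), ENNReal.ofReal_inv_of_pos (by exact_mod_cast (Fact.out : p.Prime).pos)]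
      simp
    · rw [nu_int, ka_int]
      refine lintegral_congr fun u => ?_
      have hpp : 0 < ‖(p : ℚ_[p])‖ ^ j := pow_pos hp0 j
      have : ‖(p : ℚ_[p])‖ ^ j * ‖u‖ = ‖(p : ℚ_[p])‖ ^ j ↔ ‖u‖ = 1 := by
        rw [mul_eq_left₀ hpp.ne']
      simp only [Set.indicator_apply, OO, UU, Set.mem_ofPred_eq, norm_mul, norm_pow, this]
      split_ifs with h4 h5 h5
      · rfl
      · rfl
      · exact absurd h5.le h4
      · rfl
  · intro y hy
    simp only [Set.mem_ofPred_eq] at hy ⊢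
    rw [hy, norm_pow]

theorem mv_pow (m : ℕ) (hm : 1 ≤ m) : ∃ (T : Finset ℚ_[p]) (w : ℚ≥0), (∀ ε ∈ T, ‖ε‖ = 1) ∧
    ∀ g : ℚ_[p] → ℝ≥0∞, Measurable g → ∫⁻ y, g y ∂(nu p) = ∑ ω ∈ T, ∑ r ∈ Finset.range m,
      (((w * (p : ℚ≥0)⁻¹ ^ r : ℚ≥0) : ℝ≥0) : ℝ≥0∞) * ∫⁻ z, ‖z ^ (m - 1)‖ₑ * g (ω * (p : ℚ_[p]) ^ r * z ^ m) ∂(nu p) := by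
  obtain ⟨T, hT0, hT1, hT⟩ := sphere_pow (p := p) m hm
  have hpN : (p : ℝ≥0) ≠ 0 := by exact_mod_cast (Fact.out : p.Prime).ne_zero
  have hnp : ‖(p : ℚ_[p])‖ₑ = (p : ℝ≥0∞)⁻¹ := by
    rw [← ofReal_norm, Padic.norm_p, ENNReal.ofReal_inv_of_pos (by exact_mod_cast (Fact.out : p.Prime).pos)]
    simp
  refine ⟨T, (T.card : ℚ≥0)⁻¹, hT1, fun g hg => ?_⟩
  have hTc : (T.card : ℝ≥0) ≠ 0 := by exact_mod_cast hT0.card_pos.ne'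
  have hw : ∀ r : ℕ, ((((T.card : ℚ≥0)⁻¹ * (p : ℚ≥0)⁻¹ ^ r : ℚ≥0) : ℝ≥0) : ℝ≥0∞) = (T.card : ℝ≥0∞)⁻¹ * (p : ℝ≥0∞)⁻¹ ^ r := by
    intro r
    push_cast
    rw [ENNReal.coe_inv hTc]; simp
  set f : ℕ → ℝ≥0∞ := fun k => (p : ℝ≥0∞)⁻¹ ^ k * ∫⁻ u, g ((p : ℚ_[p]) ^ k * u) ∂(ka p) with hf
  have hsh : ∀ ω ∈ T, ∀ r, ∫⁻ z, ‖z ^ (m - 1)‖ₑ * g (ω * (p : ℚ_[p]) ^ r * z ^ m) ∂(nu p) =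
      ∑' j : ℕ, (p : ℝ≥0∞)⁻¹ ^ (j * m) * ∫⁻ u, g ((p : ℚ_[p]) ^ (r + j * m) * (ω * u ^ m)) ∂(ka p) := by
    intro ω hω r
    rw [shells]
    · refine tsum_congr fun j => ?_
      have : ∫⁻ u, ‖((p : ℚ_[p]) ^ j * u) ^ (m - 1)‖ₑ * g (ω * (p : ℚ_[p]) ^ r * ((p : ℚ_[p]) ^ j * u) ^ m) ∂(ka p) =
          ∫⁻ u, (p : ℝ≥0∞)⁻¹ ^ (j * (m - 1)) * g ((p : ℚ_[p]) ^ (r + j * m) * (ω * u ^ m)) ∂(ka p) := by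
        refine ka_congr fun u hu => ?_
        congr 1
        · have : ‖u‖ₑ = 1 := by rw [← ofReal_norm, hu]; simp
          rw [enorm_pow, enorm_mul, this, enorm_pow, hnp, mul_one, pow_mul]
        · congr 1; ring
      rw [this, lintegral_const_mul' _ _ (by simp [(Fact.out : p.Prime).ne_zero]), ← mul_assoc, ← pow_add]
      congr 2
      obtain ⟨k, rfl⟩ : ∃ k, m = k + 1 := ⟨m - 1, by omega⟩
      simp; ring
    · exact (by fun_prop : Measurable fun z : ℚ_[p] => ‖z ^ (m - 1)‖ₑ).mul (hg.comp (by fun_prop))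
  have hreg : ∑' k, f k = ∑ r ∈ Finset.range m, ∑' j : ℕ, f (r + j * m) := by
    have : NeZero m := ⟨by omega⟩
    rw [← (Nat.divModEquiv m).symm.tsum_eq f, ENNReal.tsum_prod', ENNReal.tsum_comm, tsum_fintype, Finset.sum_range]
    refine Finset.sum_congr rfl fun r _ => tsum_congr fun j => ?_
    congr 1
    simp [Nat.divModEquiv]; try ring
  rw [shells g hg]
  change ∑' k, f k = _
  rw [hreg]
  rw [Finset.sum_comm]
  refine Finset.sum_congr rfl fun r _ => ?_
  rw [Finset.sum_congr rfl (g := fun ω => (T.card : ℝ≥0∞)⁻¹ * ((p : ℝ≥0∞)⁻¹ ^ r *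
      ∑' j : ℕ, (p : ℝ≥0∞)⁻¹ ^ (j * m) * ∫⁻ u, g ((p : ℚ_[p]) ^ (r + j * m) * (ω * u ^ m)) ∂(ka p)))
      (fun ω hω => by rw [hw, hsh ω hω, mul_assoc]), ← Finset.mul_sum, ← Finset.mul_sum,
      ← Summable.tsum_finsetSum (fun _ _ => ENNReal.summable)]
  rw [← ENNReal.tsum_mul_left, ← ENNReal.tsum_mul_left]
  refine tsum_congr fun j => ?_
  rw [← Finset.mul_sum, hT (fun y => g ((p : ℚ_[p]) ^ (r + j * m) * y)) (hg.comp (by fun_prop)), hf]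
  simp only []
  rw [pow_add]
  have hTc' : (T.card : ℝ≥0∞) ≠ 0 := by exact_mod_cast hT0.card_pos.ne'
  calc _ = ((T.card : ℝ≥0∞)⁻¹ * T.card) * ((p : ℝ≥0∞)⁻¹ ^ r * (p : ℝ≥0∞)⁻¹ ^ (j * m) * ∫⁻ u, g ((p : ℚ_[p]) ^ (r + j * m) * u) ∂(ka p)) := by
        rw [ENNReal.inv_mul_cancel hTc' (by simp), one_mul]
    _ = _ := by ring

end meas
end IdealZeta
end PartC3

section PartC4
open Filter Topology
open scoped NNReal ENNReal
namespace IdealZeta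
set_option linter.unusedSectionVars false
section res
open MeasureTheory
variable {p : ℕ} [Fact p.Prime] {ι : Type} [Fintype ι] [DecidableEq ι]

theorem Bx_meas : MeasurableSet (Bx p ι) := by
  have : Bx p ι = ⋂ i, {x : ι → ℚ_[p] | ‖x i‖ ≤ 1} := by ext x; simp [Bx]
  rw [this]
  exact MeasurableSet.iInter fun i => measurableSet_le (by fun_prop) (by fun_prop)

/-- integral over the polydisc -/
noncomputable def JJ (Ψ : (ι → ℚ_[p]) → ℝ≥0∞) : ℝ≥0∞ :=
  ∫⁻ x, (Bx p ι).indicator Ψ x ∂(Measure.pi fun _ : ι => nu p)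

/-- measurable on the polydisc -/
def MB (Ψ : (ι → ℚ_[p]) → ℝ≥0∞) : Prop := Measurable ((Bx p ι).indicator Ψ)

theorem MB.upd {Ψ : (ι → ℚ_[p]) → ℝ≥0∞} (h : MB Ψ) (x : ι → ℚ_[p]) (i : ι) :
    Measurable (fun t => (Bx p ι).indicator Ψ (Function.update x i t)) := Measurable.comp h (measurable_update x)

theorem JJ_congr {Ψ Φ : (ι → ℚ_[p]) → ℝ≥0∞} (h : ∀ x ∈ Bx p ι, Ψ x = Φ x) : JJ Ψ = JJ Φ := by
  unfold JJ
  rw [Set.indicator_congr h]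

theorem MB_congr {Ψ Φ : (ι → ℚ_[p]) → ℝ≥0∞} (h : ∀ x ∈ Bx p ι, Ψ x = Φ x) (hΨ : MB Ψ) : MB Φ := by
  unfold MB at *
  rw [← Set.indicator_congr h]; exact hΨ

theorem LA.meas {f : (ι → ℚ_[p]) → ℚ_[p]} (hf : LA f) : Measurable ((Bx p ι).indicator f) := by
  classical
  have h1 : ContinuousOn f (Bx p ι) := hf.continuousOn
  have := h1.measurable_piecewise (g := fun _ => 0) continuousOn_const Bx_meas
  convert this using 1
  ext x; simp [Set.indicator, Set.piecewise]

theorem MB_comp {Ψ : (ι → ℚ_[p]) → ℝ≥0∞} (hΨ : MB Ψ) (i : ι) {G : (ι → ℚ_[p]) → ℚ_[p]} (hG : LA G)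
    (hG1 : ∀ x ∈ Bx p ι, ‖G x‖ ≤ 1) : MB (fun x => Ψ (Function.update x i (G x))) := by
  have h : Measurable (fun x => (Bx p ι).indicator Ψ (Function.update x i ((Bx p ι).indicator G x))) := by
    refine hΨ.comp ?_
    have := hG.meas
    exact measurable_update'.comp (measurable_id.prodMk this)
  have h2 := h.indicator (Bx_meas (p := p) (ι := ι))
  unfold MB
  convert h2 using 1
  refine Set.indicator_congr fun x hx => ?_
  rw [Set.indicator_of_mem hx, Set.indicator_of_mem (Bx_update hx i (hG1 x hx))]

theorem MB_mul {Ψ Φ : (ι → ℚ_[p]) → ℝ≥0∞} (h : MB Ψ) (h' : MB Φ) : MB (fun x => Ψ x * Φ x) := by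
  unfold MB
  rw [show (Bx p ι).indicator (fun x => Ψ x * Φ x) = fun x => (Bx p ι).indicator Ψ x * (Bx p ι).indicator Φ x from
    Set.indicator_mul _ _ _]
  exact Measurable.mul h h'

theorem MB_enorm {f : (ι → ℚ_[p]) → ℚ_[p]} (hf : LA f) : MB (fun x => ‖f x‖ₑ) := by
  have := hf.meas.enorm
  unfold MB
  convert this using 1
  ext x
  by_cases hx : x ∈ Bx p ι <;> simp [hx]

theorem MB_ind {S : Set (ι → ℚ_[p])} (hS : MeasurableSet (S ∩ Bx p ι)) : MB (S.indicator 1) := by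
  unfold MB
  rw [Set.indicator_indicator, Set.inter_comm]
  exact measurable_one.indicator hS

theorem JJ_add {Ψ Φ : (ι → ℚ_[p]) → ℝ≥0∞} (h : MB Ψ) : JJ (fun x => Ψ x + Φ x) = JJ Ψ + JJ Φ := by
  unfold JJ
  rw [← lintegral_add_left h]
  refine lintegral_congr fun x => ?_
  rw [Set.indicator_add]

theorem J_move (i : ι) {Ψ : (ι → ℚ_[p]) → ℝ≥0∞} (hΨ : MB Ψ) {K : Type*} (S : Finset K) (c : K → ℝ≥0∞)
    (Θ : K → (ι → ℚ_[p]) → ℝ≥0∞) (hΘ : ∀ k ∈ S, MB (Θ k))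
    (h : ∀ x ∈ Bx p ι, ∫⁻ t, (Bx p ι).indicator Ψ (Function.update x i t) ∂(nu p) =
      ∑ k ∈ S, c k * ∫⁻ t, (Bx p ι).indicator (Θ k) (Function.update x i t) ∂(nu p)) :
    JJ Ψ = ∑ k ∈ S, c k * JJ (Θ k) := by
  unfold JJ
  have e1 : ∑ k ∈ S, c k * ∫⁻ x, (Bx p ι).indicator (Θ k) x ∂(Measure.pi fun _ : ι => nu p) =
      ∫⁻ x, ∑ k ∈ S, c k * (Bx p ι).indicator (Θ k) x ∂(Measure.pi fun _ : ι => nu p) := by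
    rw [lintegral_finsetSum' _ (fun k hk => ((hΘ k hk).const_mul _).aemeasurable)]
    exact Finset.sum_congr rfl fun k hk => (lintegral_const_mul _ (hΘ k hk)).symm
  rw [e1]
  refine lintegral_eq_of_lmarginal_eq {i} hΨ (Finset.measurable_sum _ fun k hk => (hΘ k hk).const_mul _) ?_
  rw [lmarginal_singleton, lmarginal_singleton]
  funext x
  have e2 : ∫⁻ t, ∑ k ∈ S, c k * (Bx p ι).indicator (Θ k) (Function.update x i t) ∂(nu p) =
      ∑ k ∈ S, c k * ∫⁻ t, (Bx p ι).indicator (Θ k) (Function.update x i t) ∂(nu p) := by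
    rw [lintegral_finsetSum' _ (fun k hk => (((hΘ k hk).upd x i).const_mul _).aemeasurable)]
    exact Finset.sum_congr rfl fun k hk => lintegral_const_mul _ ((hΘ k hk).upd x i)
  rw [e2]
  by_cases hx : Function.update x i 0 ∈ Bx p ι
  · have := h _ hx
    simpa only [Function.update_idem] using this
  · have h0 : ∀ t, Function.update x i t ∉ Bx p ι := by
      intro t ht; apply hx
      have := Bx_update ht i (t := 0) (by simp)
      simpa using this
    simp [h0]

theorem J_sub (i : ι) {Ψ : (ι → ℚ_[p]) → ℝ≥0∞} (hΨ : MB Ψ) :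
    JJ Ψ = ∑ b ∈ Finset.range p, (p : ℝ≥0∞)⁻¹ * JJ (fun x => Ψ (Function.update x i ((b : ℚ_[p]) + p * x i))) := by
  have hb1 : ∀ b : ℕ, ‖(b : ℚ_[p])‖ ≤ 1 := fun b => by
    have := Padic.norm_int_le_one (p := p) b; simpa using this
  refine J_move i hΨ (Finset.range p) (fun _ => (p : ℝ≥0∞)⁻¹) (fun b x => Ψ (Function.update x i ((b : ℚ_[p]) + p * x i))) ?_ ?_
  · intro b _
    exact MB_comp hΨ i ((LA_const _).add ((LA_const _).mul (LA_coord i))) fun x hx =>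
      norm_add_le_one (hb1 b) (norm_mul_le_one (hb1 p) (hx i))
  · intro x hx
    rw [mv_sub _ (hΨ.upd x i)]
    refine Finset.sum_congr rfl fun b _ => ?_
    congr 1
    refine nu_congr fun t ht => ?_
    rw [Set.indicator_of_mem (Bx_update hx i ht),
      Set.indicator_of_mem (Bx_update hx i (norm_add_le_one (hb1 b) (norm_mul_le_one (hb1 p) ht)))]
    simp

theorem J_shift (i : ι) {Ψ : (ι → ℚ_[p]) → ℝ≥0∞} (hΨ : MB Ψ) {φ : (ι → ℚ_[p]) → ℚ_[p]} (hφ : LA φ)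
    (hφi : ∀ x t, φ (Function.update x i t) = φ x) (hφ1 : ∀ x ∈ Bx p ι, ‖φ x‖ ≤ 1) :
    JJ Ψ = JJ (fun x => Ψ (Function.update x i (x i + φ x))) := by
  have := J_move i hΨ {()} (fun _ => 1) (fun _ x => Ψ (Function.update x i (x i + φ x))) ?_ ?_
  · simpa using this
  · intro _ _
    exact MB_comp hΨ i ((LA_coord i).add hφ) fun x hx => norm_add_le_one (hx i) (hφ1 x hx)
  · intro x hx
    simp only [Finset.sum_singleton, one_mul]
    rw [mv_shift _ (φ x) (hφ1 x hx)]
    refine nu_congr fun t ht => ?_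
    rw [Set.indicator_of_mem (Bx_update hx i ht),
      Set.indicator_of_mem (Bx_update hx i (norm_add_le_one ht (hφ1 x hx)))]
    simp [hφi]

theorem J_pow (i : ι) (m : ℕ) (hm : 1 ≤ m) : ∃ (T : Finset ℚ_[p]) (w : ℚ≥0), (∀ ε ∈ T, ‖ε‖ = 1) ∧
    ∀ {Ψ : (ι → ℚ_[p]) → ℝ≥0∞}, MB Ψ → JJ Ψ = ∑ z ∈ T ×ˢ Finset.range m,
      (((w * (p : ℚ≥0)⁻¹ ^ z.2 : ℚ≥0) : ℝ≥0) : ℝ≥0∞) *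
        JJ (fun x => ‖x i ^ (m - 1)‖ₑ * Ψ (Function.update x i (z.1 * (p : ℚ_[p]) ^ z.2 * x i ^ m))) := by
  obtain ⟨T, w, hT, h⟩ := mv_pow (p := p) m hm
  refine ⟨T, w, hT, fun {Ψ} hΨ => ?_⟩
  have hb1 : ‖(p : ℚ_[p])‖ ≤ 1 := Padic.norm_p_lt_one.le
  have hn : ∀ z ∈ T ×ˢ Finset.range m, ∀ t : ℚ_[p], ‖t‖ ≤ 1 → ‖z.1 * (p : ℚ_[p]) ^ z.2 * t ^ m‖ ≤ 1 := by
    intro z hz t ht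
    exact norm_mul_le_one (norm_mul_le_one (hT _ (Finset.mem_product.1 hz).1).le (norm_pow_le_one hb1 _)) (norm_pow_le_one ht _)
  refine J_move i hΨ (T ×ˢ Finset.range m) (fun z => (((w * (p : ℚ≥0)⁻¹ ^ z.2 : ℚ≥0) : ℝ≥0) : ℝ≥0∞))
    (fun z x => ‖x i ^ (m - 1)‖ₑ * Ψ (Function.update x i (z.1 * (p : ℚ_[p]) ^ z.2 * x i ^ m))) ?_ ?_
  · intro z hz
    refine MB_mul (MB_enorm ((LA_coord i).pow _)) (MB_comp hΨ i ((LA_const _).mul ((LA_coord i).pow _)) fun x hx => hn z hz _ (hx i))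
  · intro x hx
    rw [h _ (hΨ.upd x i), ← Finset.sum_product']
    refine Finset.sum_congr rfl fun z hz => ?_
    congr 1
    refine nu_congr fun t ht => ?_
    rw [Set.indicator_of_mem (Bx_update hx i ht),
      Set.indicator_of_mem (Bx_update hx i (hn z hz t ht))]
    simp

theorem norm_p_le_iff_aux (y : ℚ_[p]) : ‖y‖ < 1 ↔ ‖y‖ ≤ ‖(p : ℚ_[p])‖ := by
  have := Padic.norm_le_pow_iff_norm_lt_pow_add_one y (-1)
  rw [Padic.norm_p, ← zpow_neg_one, this]; simp

theorem nu_ne : ∀ᵐ t ∂(nu p), t ≠ 0 := by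
  rw [ae_iff]; simpa using nu_zero (p := p)

theorem J_blow (i j : ι) (hij : i ≠ j) {Ψ : (ι → ℚ_[p]) → ℝ≥0∞} (hΨ : MB Ψ) :
    JJ Ψ = JJ (fun x => ‖x i‖ₑ * Ψ (Function.update x j (x i * x j))) +
      (p : ℝ≥0∞)⁻¹ * JJ (fun x => ‖x j‖ₑ * Ψ (Function.update x i (p * x j * x i))) := by
  classical
  have hb1 : ‖(p : ℚ_[p])‖ ≤ 1 := Padic.norm_p_lt_one.le
  have hS : MeasurableSet {x : ι → ℚ_[p] | ‖x j‖ ≤ ‖x i‖} := measurableSet_le (by fun_prop) (by fun_prop)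
  have hnp : ‖(p : ℚ_[p])‖ₑ = (p : ℝ≥0∞)⁻¹ := by
    rw [← ofReal_norm, Padic.norm_p, ENNReal.ofReal_inv_of_pos (by exact_mod_cast (Fact.out : p.Prime).pos)]
    simp
  set S := {x : ι → ℚ_[p] | ‖x j‖ ≤ ‖x i‖} with hSd
  have hM : ∀ A : Set (ι → ℚ_[p]), MeasurableSet A → MB (A.indicator Ψ) := by
    intro A hA
    unfold MB
    rw [Set.indicator_indicator, Set.inter_comm, ← Set.indicator_indicator]
    exact hΨ.indicator hA
  have h0 : JJ Ψ = JJ (S.indicator Ψ) + JJ (Sᶜ.indicator Ψ) := by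
    rw [← JJ_add (hM S hS)]
    refine JJ_congr fun x _ => ?_
    exact (congrFun (Set.indicator_self_add_compl S Ψ) x).symm
  rw [h0]
  congr 1
  · have := J_move j (hM S hS) {()} (fun _ => 1) (fun _ x => ‖x i‖ₑ * Ψ (Function.update x j (x i * x j))) ?_ ?_
    · simpa using this
    · intro _ _
      exact MB_mul (MB_enorm (LA_coord i)) (MB_comp hΨ j ((LA_coord i).mul (LA_coord j)) fun x hx => norm_mul_le_one (hx i) (hx j))
    · intro x hx
      simp only [Finset.sum_singleton, one_mul]
      have := mv_ball (fun t => (Bx p ι).indicator Ψ (Function.update x j t)) (x i) (hx i)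
      have e1 : ∀ t : ℚ_[p], (Bx p ι).indicator (S.indicator Ψ) (Function.update x j t) =
          Set.indicator {y | ‖y‖ ≤ ‖x i‖} (fun t => (Bx p ι).indicator Ψ (Function.update x j t)) t := by
        intro t
        simp only [Set.indicator_apply, hSd, Set.mem_ofPred_eq, Function.update_self, Function.update_of_ne hij]
        split_ifs <;> rfl
      rw [lintegral_congr e1, this, ← lintegral_const_mul' _ _ (by simp)]
      refine nu_congr fun t ht => ?_
      rw [Set.indicator_of_mem (Bx_update hx j ht),
        Set.indicator_of_mem (Bx_update hx j (norm_mul_le_one (hx i) ht))]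
      simp [Function.update_of_ne hij]
  · have := J_move i (hM Sᶜ hS.compl) {()} (fun _ => (p : ℝ≥0∞)⁻¹) (fun _ x => ‖x j‖ₑ * Ψ (Function.update x i (p * x j * x i))) ?_ ?_
    · simpa using this
    · intro _ _
      exact MB_mul (MB_enorm (LA_coord j)) (MB_comp hΨ i (((LA_const _).mul (LA_coord j)).mul (LA_coord i)) fun x hx => norm_mul_le_one (norm_mul_le_one hb1 (hx j)) (hx i))
    · intro x hx
      simp only [Finset.sum_singleton]
      have := mv_ball (fun t => (Bx p ι).indicator Ψ (Function.update x i t)) (p * x j) (norm_mul_le_one hb1 (hx j))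
      have e1 : ∀ᵐ t ∂(nu p), (Bx p ι).indicator (Sᶜ.indicator Ψ) (Function.update x i t) =
          Set.indicator {y | ‖y‖ ≤ ‖(p : ℚ_[p]) * x j‖} (fun t => (Bx p ι).indicator Ψ (Function.update x i t)) t := by
        filter_upwards [nu_ne] with t ht
        have e2 : ¬ ‖x j‖ ≤ ‖t‖ ↔ ‖t‖ ≤ ‖(p : ℚ_[p]) * x j‖ := by
          by_cases hj : x j = 0
          · simp [hj, ht]
          · have hj' : 0 < ‖x j‖ := norm_pos_iff.2 hj
            have h3 := norm_p_le_iff_aux (p := p) (t / x j)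
            rw [norm_div, div_lt_one hj', div_le_iff₀ hj', ← norm_mul] at h3
            rw [not_le]; exact h3
        simp only [Set.indicator_apply, hSd, Set.mem_compl_iff, Set.mem_ofPred_eq, Function.update_self, Function.update_of_ne hij.symm, e2]
        split_ifs <;> rfl
      rw [lintegral_congr_ae e1, this, enorm_mul, hnp, mul_assoc, ← lintegral_const_mul' _ _ (by simp)]
      congr 1
      refine nu_congr fun t ht => ?_
      rw [Set.indicator_of_mem (Bx_update hx i ht),
        Set.indicator_of_mem (Bx_update hx i (norm_mul_le_one (norm_mul_le_one hb1 (hx j)) ht))]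
      simp [Function.update_of_ne hij.symm]

end res
end IdealZeta
end PartC4

section PartC5
open Filter Topology
open scoped NNReal ENNReal
namespace IdealZeta
set_option linter.unusedSectionVars false
section res
open MeasureTheory Polynomial
variable {p : ℕ} [Fact p.Prime] {ι : Type} [Fintype ι] [DecidableEq ι]

/-- rational values with rational generating function -/
def QRat (r : ℕ → ℝ≥0∞) : Prop := ∃ q : ℕ → ℚ≥0, (∀ l, r l = ((q l : ℝ≥0) : ℝ≥0∞)) ∧
  ∃ P Q : ℚ[X], Q.coeff 0 ≠ 0 ∧ (Q : PowerSeries ℚ) * PowerSeries.mk (fun l => ((q l : ℚ≥0) : ℚ)) = (P : PowerSeries ℚ)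

theorem QRat.congr {r s : ℕ → ℝ≥0∞} (h : QRat r) (e : ∀ l, s l = r l) : QRat s := by
  have : s = r := funext e
  rw [this]; exact h

theorem QRat.zero : QRat (fun _ => 0) := ⟨fun _ => 0, by simp, 0, 1, by simp, by ext; simp⟩

theorem QRat.add {r s : ℕ → ℝ≥0∞} (h : QRat r) (h' : QRat s) : QRat (fun l => r l + s l) := by
  obtain ⟨q, hq, P, Q, hQ, e⟩ := h
  obtain ⟨q', hq', P', Q', hQ', e'⟩ := h'
  refine ⟨fun l => q l + q' l, fun l => by simp only [hq, hq']; push_cast; rfl, P * Q' + P' * Q, Q * Q', ?_, ?_⟩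
  · simp [Polynomial.mul_coeff_zero, hQ, hQ']
  · have : PowerSeries.mk (fun l => ((q l + q' l : ℚ≥0) : ℚ)) = PowerSeries.mk (fun l => ((q l : ℚ≥0) : ℚ)) + PowerSeries.mk (fun l => ((q' l : ℚ≥0) : ℚ)) := by
      ext l; simp
    rw [this]; push_cast
    rw [← e, ← e']; ring

theorem QRat.sum {K : Type*} (S : Finset K) {r : K → ℕ → ℝ≥0∞} (h : ∀ k ∈ S, QRat (r k)) : QRat (fun l => ∑ k ∈ S, r k l) := by
  classical
  induction S using Finset.induction_on with
  | empty => simpa using QRat.zero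
  | insert k S hk ih =>
    simp only [Finset.sum_insert hk]
    exact (h k (Finset.mem_insert_self _ _)).add (ih fun j hj => h j (Finset.mem_insert_of_mem hj))

theorem QRat.smul {r : ℕ → ℝ≥0∞} (h : QRat r) (c : ℚ≥0) : QRat (fun l => ((c : ℝ≥0) : ℝ≥0∞) * r l) := by
  obtain ⟨q, hq, P, Q, hQ, e⟩ := h
  refine ⟨fun l => c * q l, fun l => by simp only [hq]; push_cast; rfl, Polynomial.C (c : ℚ) * P, Q, hQ, ?_⟩
  have : PowerSeries.mk (fun l => ((c * q l : ℚ≥0) : ℚ)) = PowerSeries.C (c : ℚ) * PowerSeries.mk (fun l => ((q l : ℚ≥0) : ℚ)) := by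
    ext l; simp
  rw [this]; push_cast
  rw [← e]; ring

theorem p_inv_cast : ((((p : ℚ≥0)⁻¹ : ℚ≥0) : ℝ≥0) : ℝ≥0∞) = (p : ℝ≥0∞)⁻¹ := by
  have hpN : (p : ℝ≥0) ≠ 0 := by exact_mod_cast (Fact.out : p.Prime).ne_zero
  push_cast
  simp

/-- right shift -/
noncomputable def rsh (z : ℕ) (r : ℕ → ℝ≥0∞) (l : ℕ) : ℝ≥0∞ := if z ≤ l then r (l - z) else 0

theorem mk_shift (z : ℕ) (q : ℕ → ℚ) : PowerSeries.mk (fun l => if z ≤ l then q (l - z) else 0) =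
    (PowerSeries.X : PowerSeries ℚ) ^ z * PowerSeries.mk q := by
  ext l
  rw [PowerSeries.coeff_X_pow_mul', PowerSeries.coeff_mk]
  simp

theorem QRat.rsh {r : ℕ → ℝ≥0∞} (h : QRat r) (z : ℕ) : QRat (rsh z r) := by
  obtain ⟨q, hq, P, Q, hQ, e⟩ := h
  refine ⟨fun l => if z ≤ l then q (l - z) else 0, fun l => by
    unfold IdealZeta.rsh; dsimp only; split_ifs <;> simp [hq], Polynomial.X ^ z * P, Q, hQ, ?_⟩
  have : PowerSeries.mk (fun l => ((if z ≤ l then q (l - z) else 0 : ℚ≥0) : ℚ)) = (PowerSeries.X : PowerSeries ℚ) ^ z * PowerSeries.mk (fun l => ((q l : ℚ≥0) : ℚ)) := by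
    rw [← mk_shift]; congr 1; funext l; split_ifs <;> simp
  rw [this]; push_cast
  rw [← e]; ring

theorem nnr_cast (t : ℚ≥0) : ((t : ℝ≥0) : ℝ) = (t : ℝ) := rfl

theorem QRat.rec {r s : ℕ → ℝ≥0∞} (hs : QRat s) (hr : ∀ l, r l ≠ ∞) (c : ℚ≥0) (hc : c < 1) (β : ℕ)
    (h : ∀ l, r l = s l + ((c : ℝ≥0) : ℝ≥0∞) * IdealZeta.rsh β r l) : QRat r := by
  obtain ⟨q, hq, P, Q, hQ, e⟩ := hs
  have hex : ∀ l, ∃ t : ℚ≥0, r l = ((t : ℝ≥0) : ℝ≥0∞) := by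
    intro l
    induction l using Nat.strong_induction_on with
    | _ l ih =>
      by_cases hβ : β = 0
      · subst hβ
        have h1 := h l
        simp only [IdealZeta.rsh, Nat.zero_le, if_true, Nat.sub_zero, hq] at h1
        refine ⟨q l / (1 - c), ?_⟩
        lift r l to ℝ≥0 using hr l with ρ hρ
        have h2 : ρ = (q l : ℝ≥0) + (c : ℝ≥0) * ρ := by exact_mod_cast h1
        have h3 : (ρ : ℝ) = (q l : ℝ) + (c : ℝ) * ρ := by
          have := congrArg (fun t : ℝ≥0 => (t : ℝ)) h2
          simpa only [NNReal.coe_add, NNReal.coe_mul, nnr_cast] using this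
        have hc' : (c : ℝ) < 1 := by exact_mod_cast hc
        congr 1
        apply NNReal.eq
        have h4 : (((q l / (1 - c) : ℚ≥0) : ℝ≥0) : ℝ) = (q l : ℝ) / (1 - (c : ℝ)) := by
          have h6 : ((1 - c : ℚ≥0) : ℚ) = 1 - (c : ℚ) := NNRat.coe_sub hc.le
          have h5 : ((1 - c : ℚ≥0) : ℝ) = 1 - (c : ℝ) := by
            have := congrArg (fun t : ℚ => (t : ℝ)) h6
            push_cast at this
            exact this
          rw [← h5, nnr_cast]; push_cast; rfl
        rw [h4, eq_div_iff (by linarith)]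
        linarith
      · rw [h l, hq]
        by_cases hl : β ≤ l
        · obtain ⟨t, ht⟩ := ih (l - β) (by omega)
          exact ⟨q l + c * t, by simp only [IdealZeta.rsh, if_pos hl, ht]; push_cast; rfl⟩
        · exact ⟨q l, by simp [IdealZeta.rsh, if_neg hl]⟩
  choose t ht using hex
  have hrec : ∀ l, (t l : ℚ) = (q l : ℚ) + (c : ℚ) * (if β ≤ l then (t (l - β) : ℚ) else 0) := by
    intro l
    have h1 := h l
    unfold IdealZeta.rsh at h1
    have h2 : t l = q l + c * (if β ≤ l then t (l - β) else 0) := by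
      rw [ht l, hq l] at h1
      split_ifs at h1 ⊢ with hl
      · rw [ht] at h1
        exact_mod_cast h1
      · simp only [mul_zero, add_zero] at h1 ⊢
        exact_mod_cast h1
    rw [h2]; push_cast; split_ifs <;> simp
  refine ⟨t, ht, P, Q * (1 - Polynomial.C (c : ℚ) * Polynomial.X ^ β), ?_, ?_⟩
  · rw [Polynomial.mul_coeff_zero]
    refine mul_ne_zero hQ ?_
    have : (c : ℚ) < 1 := by exact_mod_cast hc
    by_cases hβ : β = 0
    · simp [hβ]; intro h; linarith
    · simp [Polynomial.coeff_X_pow, Ne.symm hβ]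
  · have h1 : PowerSeries.mk (fun l => ((t l : ℚ≥0) : ℚ)) = PowerSeries.mk (fun l => ((q l : ℚ≥0) : ℚ)) +
        PowerSeries.C (c : ℚ) * (PowerSeries.X ^ β * PowerSeries.mk (fun l => ((t l : ℚ≥0) : ℚ))) := by
      rw [← mk_shift]
      ext l
      simp only [PowerSeries.coeff_mk, map_add, PowerSeries.coeff_C_mul]
      exact hrec l
    rw [← e]; push_cast
    calc _ = (Q : PowerSeries ℚ) * (PowerSeries.mk (fun l => ((t l : ℚ≥0) : ℚ)) - PowerSeries.C (c : ℚ) * (PowerSeries.X ^ β * PowerSeries.mk (fun l => ((t l : ℚ≥0) : ℚ)))) := by ring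
      _ = _ := by congr 1; rw [sub_eq_iff_eq_add]; exact h1

end res
end IdealZeta
end PartC5

section PartC6
open Filter Topology
open scoped NNReal ENNReal
namespace IdealZeta
set_option linter.unusedSectionVars false
section res
open MeasureTheory
variable {p : ℕ} [Fact p.Prime] {ι : Type} [Fintype ι] [DecidableEq ι]

theorem JJ_congr_ae {Ψ Φ : (ι → ℚ_[p]) → ℝ≥0∞} (h : ∀ x ∈ Bx p ι, (∀ i, x i ≠ 0) → Ψ x = Φ x) : JJ Ψ = JJ Φ := by
  unfold JJ
  apply lintegral_congr_ae
  have : ∀ i, ∀ᵐ x ∂(Measure.pi fun _ : ι => nu p), x i ≠ 0 := fun i =>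
    (Measure.tendsto_eval_ae_ae (μ := fun _ : ι => nu p) (i := i)).eventually nu_ne
  filter_upwards [ae_all_iff.2 this] with x hx
  by_cases hB : x ∈ Bx p ι
  · simp [hB, h x hB hx]
  · simp [hB]

theorem JJ_one : JJ (fun _ : ι → ℚ_[p] => 1) = 1 := by
  unfold JJ
  have h : ∀ᵐ x ∂(Measure.pi fun _ : ι => nu p), (Bx p ι).indicator (fun _ : ι → ℚ_[p] => (1 : ℝ≥0∞)) x = 1 := by
    have : ∀ i, ∀ᵐ x ∂(Measure.pi fun _ : ι => nu p), x i ∈ OO p := fun i =>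
      (Measure.tendsto_eval_ae_ae (μ := fun _ : ι => nu p) (i := i)).eventually (ae_restrict_mem OO_meas)
    filter_upwards [ae_all_iff.2 this] with x hx
    rw [Set.indicator_of_mem]
    exact hx
  rw [lintegral_congr_ae h]
  simp

theorem JJ_le_one {Ψ : (ι → ℚ_[p]) → ℝ≥0∞} (h : ∀ x ∈ Bx p ι, Ψ x ≤ 1) : JJ Ψ ≤ 1 := by
  rw [← JJ_one (p := p) (ι := ι)]
  unfold JJ
  refine lintegral_mono fun x => ?_
  by_cases hB : x ∈ Bx p ι
  · simp [hB, h x hB]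
  · simp [hB]

theorem JJ_const_mul {Ψ : (ι → ℚ_[p]) → ℝ≥0∞} (c : ℝ≥0∞) (hc : c ≠ ∞) : JJ (fun x => c * Ψ x) = c * JJ Ψ := by
  unfold JJ
  rw [← lintegral_const_mul' _ _ hc]
  refine lintegral_congr fun x => ?_
  by_cases hB : x ∈ Bx p ι <;> simp [hB]

/-- monomial integrand -/
noncomputable def rm (β ω : ι → ℕ) (s : Finset ι) (l : ℕ) (x : ι → ℚ_[p]) : ℝ≥0∞ :=
  Set.indicator {x : ι → ℚ_[p] | ∏ i ∈ s, ‖x i‖ ^ β i = ‖(p : ℚ_[p])‖ ^ l} (fun x => ∏ i ∈ s, ‖x i‖ₑ ^ ω i) x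

theorem rm_MB (β ω : ι → ℕ) (s : Finset ι) (l : ℕ) : MB (rm (p := p) β ω s l) := by
  unfold MB
  refine Measurable.indicator ?_ Bx_meas
  unfold rm
  refine Measurable.indicator (by fun_prop) ?_
  exact measurableSet_eq_fun (by fun_prop) (by fun_prop)

theorem enorm_p : ‖(p : ℚ_[p])‖ₑ = (p : ℝ≥0∞)⁻¹ := by
  rw [← ofReal_norm, Padic.norm_p, ENNReal.ofReal_inv_of_pos (by exact_mod_cast (Fact.out : p.Prime).pos)]
  simp

theorem enorm_le_one' {t : ℚ_[p]} (h : ‖t‖ ≤ 1) : ‖t‖ₑ ≤ 1 := by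
  rw [← ofReal_norm, ENNReal.ofReal_le_one]; exact h

theorem rm_QRat (β ω : ι → ℕ) (s : Finset ι) : QRat (fun l => JJ (rm (p := p) β ω s l)) := by
  have hp0 := norm_p_pos (p := p)
  have hp1 := Padic.norm_p_lt_one (p := p)
  have hpp : p.Prime := Fact.out
  induction s using Finset.induction_on with
  | empty =>
    refine ⟨fun l => if l = 0 then 1 else 0, fun l => ?_, 1, 1, by simp, ?_⟩
    · dsimp only
      by_cases hl : l = 0
      · subst hl
        rw [JJ_congr (Φ := fun _ => 1)]
        · simp [JJ_one]
        · intro x _; simp [rm]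
      · rw [JJ_congr (Φ := fun _ => 0)]
        · simp [JJ, hl]
        · intro x _
          unfold rm
          rw [Set.indicator_of_notMem]
          simp only [Set.mem_ofPred_eq, Finset.prod_empty]
          exact (pow_lt_one₀ hp0.le hp1 hl).ne'
    · ext l
      simp [PowerSeries.coeff_one]
      split_ifs <;> simp
  | insert i s hi ih =>
    have key : ∀ l, JJ (rm (p := p) β ω (insert i s) l) =
        ((((p - 1 : ℕ) * (p : ℚ≥0)⁻¹ : ℚ≥0) : ℝ≥0) : ℝ≥0∞) * JJ (rm (p := p) β ω s l) +
        ((((p : ℚ≥0)⁻¹ ^ (1 + ω i) : ℚ≥0) : ℝ≥0) : ℝ≥0∞) * rsh (β i) (fun l => JJ (rm (p := p) β ω (insert i s) l)) l := by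
      intro l
      rw [J_sub i (rm_MB _ _ _ _)]
      have hr : Finset.range p = insert 0 (Finset.Ico 1 p) := by
        ext k; simp; have := hpp.pos; omega
      rw [hr, Finset.sum_insert (by simp), add_comm]
      have hne : ∀ (x : ι → ℚ_[p]) t, ∀ k ∈ s, Function.update x i t k = x k := fun x t k hk =>
        Function.update_of_ne (fun h : k = i => hi (h ▸ hk)) _ _
      congr 1
      · rw [Finset.sum_congr rfl (g := fun _ => (p : ℝ≥0∞)⁻¹ * JJ (rm (p := p) β ω s l))]
        · rw [Finset.sum_const, nsmul_eq_mul, Nat.card_Ico, ← mul_assoc, ← p_inv_cast]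
          generalize p - 1 = k
          congr 1
          push_cast; rfl
        · intro b hb
          congr 1
          refine JJ_congr fun x hx => ?_
          have hb1 : ‖(b : ℚ_[p]) + p * x i‖ = 1 := by
            have h1 : ‖(b : ℚ_[p])‖ = 1 := by
              rw [Padic.norm_natCast_eq_one_iff, hpp.coprime_iff_not_dvd]
              intro h
              have h4 := Finset.mem_Ico.1 hb
              have := Nat.le_of_dvd (by omega) h
              omega
            have h2 : ‖(p : ℚ_[p]) * x i‖ < 1 := by
              rw [norm_mul]
              calc _ ≤ ‖(p : ℚ_[p])‖ * 1 := by gcongr; exact hx i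
                _ < 1 := by simpa using hp1
            rw [Padic.add_eq_max_of_ne (by rw [h1]; exact h2.ne'), h1, max_eq_left h2.le]
          have hb2 : ‖(b : ℚ_[p]) + p * x i‖ₑ = 1 := by rw [← ofReal_norm, hb1]; simp
          unfold rm
          simp only [Set.indicator_apply, Set.mem_ofPred_eq, Finset.prod_insert hi, Function.update_self, hb1, hb2, one_pow, one_mul]
          rw [Finset.prod_congr rfl (fun k hk => by rw [hne x _ k hk]),
            Finset.prod_congr rfl (g := fun k => ‖x k‖ₑ ^ ω k) (fun k hk => by rw [hne x _ k hk])]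
      · have e0 : (((p : ℚ≥0)⁻¹ ^ (1 + ω i) : ℚ≥0) : ℝ≥0) = (((p : ℚ≥0)⁻¹ : ℚ≥0) : ℝ≥0) ^ (1 + ω i) := by push_cast; rfl
        rw [e0, ENNReal.coe_pow, p_inv_cast, pow_add, pow_one, mul_assoc]
        congr 1
        have e1 : ∀ x ∈ Bx p ι, rm (p := p) β ω (insert i s) l (Function.update x i (((0 : ℕ) : ℚ_[p]) + p * x i)) =
            (p : ℝ≥0∞)⁻¹ ^ ω i * (if β i ≤ l then rm (p := p) β ω (insert i s) (l - β i) x else 0) := by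
          intro x hx
          unfold rm
          simp only [Set.indicator_apply, Set.mem_ofPred_eq, Finset.prod_insert hi, Function.update_self, Nat.cast_zero, zero_add, norm_mul, enorm_mul, enorm_p]
          rw [Finset.prod_congr rfl (fun k hk => by rw [hne x _ k hk]),
            Finset.prod_congr rfl (g := fun k => ‖x k‖ₑ ^ ω k) (fun k hk => by rw [hne x _ k hk])]
          rw [mul_pow, mul_pow, mul_assoc, mul_assoc]
          by_cases hl : β i ≤ l
          · have e2 : ‖(p : ℚ_[p])‖ ^ β i * (‖x i‖ ^ β i * ∏ k ∈ s, ‖x k‖ ^ β k) = ‖(p : ℚ_[p])‖ ^ l ↔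
                ‖x i‖ ^ β i * ∏ k ∈ s, ‖x k‖ ^ β k = ‖(p : ℚ_[p])‖ ^ (l - β i) := by
              conv_lhs => rw [← Nat.add_sub_cancel' hl, pow_add]
              exact mul_right_inj' (pow_pos hp0 _).ne'
            simp only [e2, if_pos hl, mul_ite, mul_zero]
          · rw [if_neg hl, mul_zero, if_neg]
            intro h
            have h1 : ‖x i‖ ^ β i * ∏ k ∈ s, ‖x k‖ ^ β k ≤ 1 :=
              mul_le_one₀ (pow_le_one₀ (norm_nonneg _) (hx i)) (Finset.prod_nonneg fun k _ => by positivity)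
                (Finset.prod_le_one (fun k _ => by positivity) fun k _ => pow_le_one₀ (norm_nonneg _) (hx k))
            have h2 : ‖(p : ℚ_[p])‖ ^ β i < ‖(p : ℚ_[p])‖ ^ l := pow_lt_pow_right_of_lt_one₀ hp0 hp1 (by omega)
            have h3 := mul_le_of_le_one_right (pow_pos hp0 (β i)).le h1
            linarith
        rw [JJ_congr e1, JJ_const_mul _ (by simp [hpp.ne_zero])]
        congr 1
        unfold rsh
        split_ifs
        · rfl
        · simp [JJ]
    refine QRat.rec (ih.smul ((p - 1 : ℕ) * (p : ℚ≥0)⁻¹)) (fun l => ne_top_of_le_ne_top ENNReal.one_ne_top (JJ_le_one fun x hx => ?_))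
      ((p : ℚ≥0)⁻¹ ^ (1 + ω i)) ?_ (β i) key
    · unfold rm
      refine (Set.indicator_le_self' (by simp) x).trans ?_
      exact Finset.prod_le_one' fun k _ => pow_le_one₀ zero_le (enorm_le_one' (hx k))
    · refine pow_lt_one₀ (by positivity) ?_ (by omega)
      exact inv_lt_one_of_one_lt₀ (by exact_mod_cast hpp.one_lt)

end res
end IdealZeta
end PartC6

section PartC7
open Filter Topology
open scoped NNReal ENNReal
namespace IdealZeta
set_option linter.unusedSectionVars false
section res
open MeasureTheory
variable {p : ℕ} [Fact p.Prime] {ι : Type} [Fintype ι] [DecidableEq ι]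

theorem dich {c1 c2 : ℝ} (h1 : 0 < c1) (h2 : 0 < c2) {γ β : ι → ℕ} (h : γ ≤ β ∨ β ≤ γ) :
    ∀ᶠ e : ℕ in atTop,
      (∀ y : ι → ℚ_[p], (∀ i, y i ≠ 0 ∧ ‖y i‖ ≤ ‖(p : ℚ_[p])‖ ^ e) → c1 * ∏ i, ‖y i‖ ^ γ i ≤ c2 * ∏ i, ‖y i‖ ^ β i) ∨
      (∀ y : ι → ℚ_[p], (∀ i, y i ≠ 0 ∧ ‖y i‖ ≤ ‖(p : ℚ_[p])‖ ^ e) → ¬ c1 * ∏ i, ‖y i‖ ^ γ i ≤ c2 * ∏ i, ‖y i‖ ^ β i) := by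
  have hp0 := norm_p_pos (p := p)
  have hp1 := Padic.norm_p_lt_one (p := p)
  have ten := tendsto_pow_atTop_nhds_zero_of_lt_one hp0.le hp1
  have hpos : ∀ y : ι → ℚ_[p], ∀ e : ℕ, (∀ i, y i ≠ 0 ∧ ‖y i‖ ≤ ‖(p : ℚ_[p])‖ ^ e) → ∀ δ : ι → ℕ, 0 < ∏ i, ‖y i‖ ^ δ i :=
    fun y e hy δ => Finset.prod_pos fun i _ => pow_pos (norm_pos_iff.2 (hy i).1) _
  have small : ∀ δ : ι → ℕ, δ ≠ 0 → ∀ y : ι → ℚ_[p], ∀ e : ℕ, (∀ i, y i ≠ 0 ∧ ‖y i‖ ≤ ‖(p : ℚ_[p])‖ ^ e) →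
      ∏ i, ‖y i‖ ^ δ i ≤ ‖(p : ℚ_[p])‖ ^ e := by
    intro δ hδ y e hy
    obtain ⟨i, hi⟩ := Function.ne_iff.1 hδ
    have hle1 : ∀ k, ‖y k‖ ≤ 1 := fun k => (hy k).2.trans (pow_le_one₀ hp0.le hp1.le)
    rw [← Finset.mul_prod_erase _ _ (Finset.mem_univ i)]
    have a1 : ‖y i‖ ^ δ i ≤ ‖(p : ℚ_[p])‖ ^ e := (pow_le_of_le_one (norm_nonneg _) (hle1 i) hi).trans (hy i).2
    have a2 : ∏ k ∈ Finset.univ.erase i, ‖y k‖ ^ δ k ≤ 1 :=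
      Finset.prod_le_one (fun k _ => by positivity) fun k _ => pow_le_one₀ (norm_nonneg _) (hle1 k)
    have a3 : 0 ≤ ∏ k ∈ Finset.univ.erase i, ‖y k‖ ^ δ k := Finset.prod_nonneg fun k _ => by positivity
    calc _ ≤ ‖(p : ℚ_[p])‖ ^ e * 1 := by gcongr
      _ = _ := mul_one _
  by_cases heq : γ = β
  · subst heq
    refine Eventually.of_forall fun e => ?_
    by_cases hc : c1 ≤ c2
    · left; intro y hy
      exact mul_le_mul_of_nonneg_right hc (hpos y e hy γ).le
    · right; intro y hy h
      exact hc (le_of_mul_le_mul_right h (hpos y e hy γ))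
  rcases h with h | h
  · obtain ⟨δ, rfl⟩ : ∃ δ, β = γ + δ := ⟨β - γ, (add_tsub_cancel_of_le h).symm⟩
    have hδ : δ ≠ 0 := by rintro rfl; simp at heq
    have : ∀ᶠ e : ℕ in atTop, ‖(p : ℚ_[p])‖ ^ e < c1 / c2 := ten.eventually (gt_mem_nhds (div_pos h1 h2))
    filter_upwards [this] with e he
    right
    intro y hy hle
    simp only [Pi.add_apply, pow_add, Finset.prod_mul_distrib] at hle
    have a1 := small δ hδ y e hy
    have a2 := hpos y e hy γ
    have a3 : c1 ≤ c2 * ∏ i, ‖y i‖ ^ δ i := by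
      refine le_of_mul_le_mul_right (hle.trans (le_of_eq ?_)) a2
      ring
    rw [lt_div_iff₀ h2] at he
    have : c2 * ∏ i, ‖y i‖ ^ δ i ≤ c2 * ‖(p : ℚ_[p])‖ ^ e := by gcongr
    linarith
  · obtain ⟨δ, rfl⟩ : ∃ δ, γ = β + δ := ⟨γ - β, (add_tsub_cancel_of_le h).symm⟩
    have hδ : δ ≠ 0 := by rintro rfl; simp at heq
    have : ∀ᶠ e : ℕ in atTop, ‖(p : ℚ_[p])‖ ^ e < c2 / c1 := ten.eventually (gt_mem_nhds (div_pos h2 h1))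
    filter_upwards [this] with e he
    left
    intro y hy
    simp only [Pi.add_apply, pow_add, Finset.prod_mul_distrib]
    have a1 := small δ hδ y e hy
    have a2 := hpos y e hy β
    rw [lt_div_iff₀ h1] at he
    have : c1 * ∏ i, ‖y i‖ ^ δ i ≤ c1 * ‖(p : ℚ_[p])‖ ^ e := by gcongr
    have a3 : c1 * ∏ i, ‖y i‖ ^ δ i ≤ c2 := by linarith
    calc _ = (c1 * ∏ i, ‖y i‖ ^ δ i) * ∏ i, ‖y i‖ ^ β i := by ring
      _ ≤ _ := by gcongr

/-- the integrand -/
noncomputable def Ph {κ : Type} (W D : (ι → ℚ_[p]) → ℚ_[p]) (f : κ → (ι → ℚ_[p]) → ℚ_[p]) (l : ℕ) (x : ι → ℚ_[p]) : ℝ≥0∞ :=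
  Set.indicator {x : ι → ℚ_[p] | ‖D x‖ = ‖(p : ℚ_[p])‖ ^ l ∧ ∀ α, ‖f α x‖ ≤ ‖D x‖} (fun x => ‖W x‖ₑ) x

theorem norm_eq_qpow {t : ℚ_[p]} (h0 : t ≠ 0) (h1 : ‖t‖ ≤ 1) : ∃ z : ℕ, ‖t‖ = ‖(p : ℚ_[p])‖ ^ z := by
  have hv := Padic.norm_eq_zpow_neg_valuation h0
  obtain ⟨k, hk⟩ := Int.eq_ofNat_of_zero_le ((Padic.norm_le_one_iff_val_nonneg t).1 h1)
  refine ⟨k, ?_⟩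
  rw [hv, hk, Padic.norm_p, inv_pow, zpow_neg]; simp

theorem enorm_rat (t : ℚ_[p]) : ∃ c : ℚ≥0, ‖t‖ₑ = ((c : ℝ≥0) : ℝ≥0∞) := by
  obtain ⟨q, hq⟩ := Padic.padicNormE.is_rat t
  have h0 : 0 ≤ q := by have := norm_nonneg t; rw [hq] at this; exact_mod_cast this
  lift q to ℚ≥0 using h0
  refine ⟨q, ?_⟩
  rw [← ofReal_norm, hq, ENNReal.ofReal]
  congr 1
  apply NNReal.eq
  rw [nnr_cast, Real.coe_toNNReal _ (by positivity)]
  push_cast; rfl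

theorem local_eval {κ : Type} [Fintype κ] {W D : (ι → ℚ_[p]) → ℚ_[p]} {f : κ → (ι → ℚ_[p]) → ℚ_[p]}
    {a : ι → ℚ_[p]} (ha : a ∈ Bx p ι) (hD1 : ∀ x ∈ Bx p ι, ‖D x‖ ≤ 1) (M : ℕ) {ω β : ι → ℕ} {γ : κ → ι → ℕ} {cW cD : ℝ} {cf : κ → ℝ}
    (cD0 : 0 < cD) (cf0 : ∀ α, 0 < cf α)
    (hW : ∀ x ∈ Bx p ι, ‖W (fun i => a i + (p : ℚ_[p]) ^ M * x i)‖ = cW * ∏ i, ‖x i‖ ^ ω i)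
    (hD : ∀ x ∈ Bx p ι, ‖D (fun i => a i + (p : ℚ_[p]) ^ M * x i)‖ = cD * ∏ i, ‖x i‖ ^ β i)
    (hf : ∀ α, ∀ x ∈ Bx p ι, ‖f α (fun i => a i + (p : ℚ_[p]) ^ M * x i)‖ = cf α * ∏ i, ‖x i‖ ^ γ α i)
    (hc : ∀ α, γ α ≤ β ∨ β ≤ γ α) :
    ∃ m, QRat (fun l => JJ (fun x => Ph W D f l (fun i => a i + (p : ℚ_[p]) ^ m * x i))) := by
  have hp0 := norm_p_pos (p := p)
  have hp1 := Padic.norm_p_lt_one (p := p)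
  obtain ⟨e, he⟩ := (eventually_all.2 fun α => dich (p := p) (cf0 α) cD0 (hc α)).exists
  refine ⟨M + e, ?_⟩
  have hpe : ‖(p : ℚ_[p]) ^ e‖ ≤ 1 := norm_pow_le_one hp1.le _
  have hmem : ∀ x ∈ Bx p ι, (fun i => (p : ℚ_[p]) ^ e * x i) ∈ Bx p ι := fun x hx i => norm_mul_le_one hpe (hx i)
  have hbx : ∀ x : ι → ℚ_[p], (fun i => a i + (p : ℚ_[p]) ^ (M + e) * x i) = fun i => a i + (p : ℚ_[p]) ^ M * ((p : ℚ_[p]) ^ e * x i) := by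
    intro x; funext i; rw [pow_add, mul_assoc]
  have hbm : ∀ x ∈ Bx p ι, (fun i => a i + (p : ℚ_[p]) ^ (M + e) * x i) ∈ Bx p ι := fun x hx i =>
    norm_add_le_one (ha i) (norm_mul_le_one (norm_pow_le_one hp1.le _) (hx i))
  have hy : ∀ x ∈ Bx p ι, (∀ i, x i ≠ 0) → ∀ i, (p : ℚ_[p]) ^ e * x i ≠ 0 ∧ ‖(p : ℚ_[p]) ^ e * x i‖ ≤ ‖(p : ℚ_[p])‖ ^ e := by
    intro x hx hx0 i
    refine ⟨mul_ne_zero (pow_ne_zero _ p_ne) (hx0 i), ?_⟩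
    rw [norm_mul, norm_pow]
    exact mul_le_of_le_one_right (by positivity) (hx i)
  have hprod : ∀ (x : ι → ℚ_[p]) (δ : ι → ℕ), ∏ i, ‖(p : ℚ_[p]) ^ e * x i‖ ^ δ i = (∏ i, ‖(p : ℚ_[p]) ^ e‖ ^ δ i) * ∏ i, ‖x i‖ ^ δ i := by
    intro x δ
    rw [← Finset.prod_mul_distrib]
    refine Finset.prod_congr rfl fun i _ => by rw [norm_mul, mul_pow]
  have h1B : (fun _ => 1 : ι → ℚ_[p]) ∈ Bx p ι := fun i => by simp
  by_cases hall : ∀ α, ∀ y : ι → ℚ_[p], (∀ i, y i ≠ 0 ∧ ‖y i‖ ≤ ‖(p : ℚ_[p])‖ ^ e) → cf α * ∏ i, ‖y i‖ ^ γ α i ≤ cD * ∏ i, ‖y i‖ ^ β i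
  · -- constants
    have nD : ∀ x ∈ Bx p ι, ‖D (fun i => a i + (p : ℚ_[p]) ^ (M + e) * x i)‖ = ‖D (fun i => a i + (p : ℚ_[p]) ^ (M + e) * 1)‖ * ∏ i, ‖x i‖ ^ β i := by
      intro x hx
      rw [hbx, hD _ (hmem x hx), hbx (fun _ => 1), hD _ (hmem _ h1B), hprod, hprod]
      simp [mul_assoc]
    have nW : ∀ x ∈ Bx p ι, ‖W (fun i => a i + (p : ℚ_[p]) ^ (M + e) * x i)‖ = ‖W (fun i => a i + (p : ℚ_[p]) ^ (M + e) * 1)‖ * ∏ i, ‖x i‖ ^ ω i := by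
      intro x hx
      rw [hbx, hW _ (hmem x hx), hbx (fun _ => 1), hW _ (hmem _ h1B), hprod, hprod]
      simp [mul_assoc]
    have D0 : D (fun i => a i + (p : ℚ_[p]) ^ (M + e) * 1) ≠ 0 := by
      rw [← norm_pos_iff, hbx (fun _ => 1), hD _ (hmem _ h1B)]
      refine mul_pos cD0 (Finset.prod_pos fun i _ => pow_pos (norm_pos_iff.2 ?_) _)
      exact mul_ne_zero (pow_ne_zero _ p_ne) one_ne_zero
    obtain ⟨z, hz⟩ := norm_eq_qpow D0 (hD1 _ (hbm _ h1B))
    obtain ⟨c, hcW⟩ := enorm_rat (W (fun i => a i + (p : ℚ_[p]) ^ (M + e) * 1))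
    refine (((rm_QRat (p := p) β ω Finset.univ).rsh z).smul c).congr fun l => ?_
    have e1 : ∀ x ∈ Bx p ι, (∀ i, x i ≠ 0) → Ph W D f l (fun i => a i + (p : ℚ_[p]) ^ (M + e) * x i) =
        ((c : ℝ≥0) : ℝ≥0∞) * (if z ≤ l then rm (p := p) β ω Finset.univ (l - z) x else 0) := by
      intro x hx hx0
      have eW : ‖W (fun i => a i + (p : ℚ_[p]) ^ (M + e) * x i)‖ₑ = ((c : ℝ≥0) : ℝ≥0∞) * ∏ i, ‖x i‖ₑ ^ ω i := by
        rw [← ofReal_norm, nW x hx, ENNReal.ofReal_mul (norm_nonneg _), ofReal_norm, hcW, ENNReal.ofReal_prod_of_nonneg (fun i _ => by positivity)]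
        congr 1
        refine Finset.prod_congr rfl fun i _ => by rw [ENNReal.ofReal_pow (norm_nonneg _), ofReal_norm]
      have ef : ∀ α, ‖f α (fun i => a i + (p : ℚ_[p]) ^ (M + e) * x i)‖ ≤ ‖D (fun i => a i + (p : ℚ_[p]) ^ (M + e) * x i)‖ := by
        intro α
        rw [hbx, hf α _ (hmem x hx), hD _ (hmem x hx)]
        exact hall α _ (hy x hx hx0)
      unfold Ph rm
      simp only [Set.indicator_apply, Set.mem_ofPred_eq, ef, implies_true, and_true, eW]
      rw [nD x hx, hz]
      by_cases hl : z ≤ l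
      · have e2 : ‖(p : ℚ_[p])‖ ^ z * ∏ i, ‖x i‖ ^ β i = ‖(p : ℚ_[p])‖ ^ l ↔ ∏ i, ‖x i‖ ^ β i = ‖(p : ℚ_[p])‖ ^ (l - z) := by
          conv_lhs => rw [← Nat.add_sub_cancel' hl, pow_add]
          exact mul_right_inj' (pow_pos hp0 _).ne'
        simp only [e2, if_pos hl, mul_ite, mul_zero]
      · rw [if_neg hl, mul_zero, if_neg]
        intro h
        have h1 : ∏ i, ‖x i‖ ^ β i ≤ 1 :=
          (Finset.prod_le_one (fun k _ => by positivity) fun k _ => pow_le_one₀ (norm_nonneg _) (hx k))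
        have h2 : ‖(p : ℚ_[p])‖ ^ z < ‖(p : ℚ_[p])‖ ^ l := pow_lt_pow_right_of_lt_one₀ hp0 hp1 (by omega)
        have h3 := mul_le_of_le_one_right (pow_pos hp0 z).le h1
        linarith
    rw [JJ_congr_ae e1, JJ_const_mul _ (by simp)]
    congr 1
    unfold rsh
    split_ifs
    · rfl
    · simp [JJ]
  · push Not at hall
    obtain ⟨α, hα⟩ := hall
    have hno := (he α).resolve_left (by push Not; exact hα)
    refine QRat.zero.congr fun l => ?_
    rw [JJ_congr_ae (Φ := fun _ => 0)]
    · simp [JJ]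
    · intro x hx hx0
      unfold Ph
      rw [Set.indicator_of_notMem]
      rintro ⟨-, h⟩
      have := h α
      rw [hbx, hf α _ (hmem x hx), hD _ (hmem x hx)] at this
      exact hno _ (hy x hx hx0) this

end res
end IdealZeta
end PartC7

section PartC8
open Filter Topology
open scoped NNReal ENNReal
namespace IdealZeta
set_option linter.unusedSectionVars false
section res
open MeasureTheory
variable {p : ℕ} [Fact p.Prime] {ι : Type} [Fintype ι] [DecidableEq ι]

theorem norm_nat_le (b : ℕ) : ‖(b : ℚ_[p])‖ ≤ 1 := by
  have := Padic.norm_int_le_one (p := p) b; simpa using this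

theorem multi_sub (s : Finset ι) : ∀ {Ψ : ℕ → (ι → ℚ_[p]) → ℝ≥0∞}, (∀ l, MB (Ψ l)) →
    (∀ b ∈ Bx p ι, QRat (fun l => JJ (fun x => Ψ l (fun i => if i ∈ s then b i + (p : ℚ_[p]) * x i else x i)))) →
    QRat (fun l => JJ (Ψ l)) := by
  induction s using Finset.induction_on with
  | empty =>
    intro Ψ _ h
    simpa using h 0 (fun i => by simp)
  | insert i s hi ih =>
    intro Ψ hΨ h
    have h1 : ∀ b ∈ Finset.range p, QRat (fun l => (((((p : ℚ≥0)⁻¹ : ℚ≥0) : ℝ≥0) : ℝ≥0∞)) * JJ (fun x => Ψ l (Function.update x i ((b : ℚ_[p]) + p * x i)))) := by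
      intro b _
      refine QRat.smul (ih (Ψ := fun l x => Ψ l (Function.update x i ((b : ℚ_[p]) + p * x i))) ?_ ?_) _
      · intro l
        exact MB_comp (hΨ l) i ((LA_const _).add ((LA_const _).mul (LA_coord i))) fun x hx =>
          norm_add_le_one (norm_nat_le b) (norm_mul_le_one (norm_nat_le p) (hx i))
      · intro b' hb'
        refine (h (Function.update b' i b) (Bx_update hb' i (norm_nat_le b))).congr fun l => ?_
        congr 1
        funext x
        congr 1
        funext j
        by_cases hj : j = i
        · subst hj; simp [hi]
        · simp [hj]
    refine (QRat.sum (Finset.range p) h1).congr fun l => ?_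
    rw [J_sub i (hΨ l), p_inv_cast]

theorem multi_shift (s : Finset ι) {b : ι → ℚ_[p]} (hb : b ∈ Bx p ι) : ∀ {Ψ : (ι → ℚ_[p]) → ℝ≥0∞}, MB Ψ →
    JJ Ψ = JJ (fun x => Ψ (fun i => if i ∈ s then x i + b i else x i)) := by
  induction s using Finset.induction_on with
  | empty => intro Ψ _; simp
  | insert i s hi ih =>
    intro Ψ hΨ
    rw [J_shift i hΨ (φ := fun _ => b i) (LA_const _) (fun _ _ => rfl) (fun _ _ => hb i),
      ih (MB_comp hΨ i ((LA_coord i).add (LA_const _)) fun x hx => norm_add_le_one (hx i) (hb i))]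
    congr 1
    funext x
    congr 1
    funext j
    by_cases hj : j = i
    · subst hj; simp [hi]
    · simp [hj]

theorem Ph_MB {κ : Type} [Fintype κ] {W D : (ι → ℚ_[p]) → ℚ_[p]} {f : κ → (ι → ℚ_[p]) → ℚ_[p]}
    (hW : LA W) (hD : LA D) (hf : ∀ α, LA (f α)) (l : ℕ) : MB (Ph W D f l) := by
  have h1 : Measurable (fun x => Ph ((Bx p ι).indicator W) ((Bx p ι).indicator D) (fun α => (Bx p ι).indicator (f α)) l x) := by
    unfold Ph
    refine Measurable.indicator hW.meas.enorm ?_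
    refine MeasurableSet.inter (measurableSet_eq_fun hD.meas.norm measurable_const) ?_
    have : {x : ι → ℚ_[p] | ∀ α, ‖(Bx p ι).indicator (f α) x‖ ≤ ‖(Bx p ι).indicator D x‖} =
        ⋂ α, {x | ‖(Bx p ι).indicator (f α) x‖ ≤ ‖(Bx p ι).indicator D x‖} := by ext x; simp
    change MeasurableSet {x : ι → ℚ_[p] | ∀ α, ‖(Bx p ι).indicator (f α) x‖ ≤ ‖(Bx p ι).indicator D x‖}
    rw [this]
    exact MeasurableSet.iInter fun α => measurableSet_le (hf α).meas.norm hD.meas.norm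
  refine MB_congr (Ψ := fun x => Ph ((Bx p ι).indicator W) ((Bx p ι).indicator D) (fun α => (Bx p ι).indicator (f α)) l x) ?_ (h1.indicator Bx_meas)
  intro x hx
  unfold Ph
  classical
  simp only [Set.indicator_apply, Set.mem_ofPred_eq, if_pos hx]

theorem MB_box {Ψ : (ι → ℚ_[p]) → ℝ≥0∞} (h : MB Ψ) {a : ι → ℚ_[p]} (ha : a ∈ Bx p ι) (m : ℕ) :
    MB (fun x => Ψ (fun i => a i + (p : ℚ_[p]) ^ m * x i)) := by
  have h1 : Measurable (fun x : ι → ℚ_[p] => (Bx p ι).indicator Ψ (fun i => a i + (p : ℚ_[p]) ^ m * x i)) :=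
    Measurable.comp h (by fun_prop)
  refine MB_congr (Ψ := fun x : ι → ℚ_[p] => (Bx p ι).indicator Ψ (fun i => a i + (p : ℚ_[p]) ^ m * x i)) ?_ (h1.indicator Bx_meas)
  intro x hx
  rw [Set.indicator_of_mem]
  exact fun i => norm_add_le_one (ha i) (norm_mul_le_one (norm_pow_le_one norm_p_le _) (hx i))

theorem base_eval {κ : Type} [Fintype κ] {W D : (ι → ℚ_[p]) → ℚ_[p]} {f : κ → (ι → ℚ_[p]) → ℚ_[p]}
    (hW : LA W) (hD : LA D) (hf : ∀ α, LA (f α)) (hD1 : ∀ x ∈ Bx p ι, ‖D x‖ ≤ 1)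
    (hM : Mono (fun x => W x * D x * (∏ α, f α x) * ∏ α, (f α x - D x))) :
    QRat (fun l => JJ (Ph W D f l)) := by
  have hMB := Ph_MB hW hD hf
  have key := konig (p := p) (ι := ι)
    (fun a m => QRat (fun l => JJ (fun x => Ph W D f l (fun i => a i + (p : ℚ_[p]) ^ m * x i)))) Finset.univ ?_ ?_ ?_
  · refine (key 0 (fun i => by simp)).congr fun l => ?_
    simp
  · intro a ha m h
    refine multi_sub Finset.univ (fun l => MB_box (hMB l) ha m) fun b hb => (h b hb).congr fun l => ?_
    congr 1
    funext x
    congr 1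
    funext i
    simp only [Finset.mem_univ, if_true]
    ring
  · intro a ha b hb m h
    refine h.congr fun l => ?_
    rw [multi_shift Finset.univ hb (MB_box (hMB l) ha m)]
    congr 1
    funext x
    congr 1
    funext i
    simp only [Finset.mem_univ, if_true]
    ring
  · intro a ha
    let h : Option (Option (κ ⊕ κ)) → (ι → ℚ_[p]) → ℚ_[p] := fun k => match k with
      | none => W
      | some none => D
      | some (some (Sum.inl α)) => f α
      | some (some (Sum.inr α)) => fun x => f α x - D x
    have hLA : ∀ k ∈ (Finset.univ : Finset (Option (Option (κ ⊕ κ)))), LA (h k) := by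
      rintro (_ | _ | α | α) _
      · exact hW
      · exact hD
      · exact hf α
      · exact (hf α).sub hD
    have hdep : ∀ k ∈ (Finset.univ : Finset (Option (Option (κ ⊕ κ)))), DependsOn (h k) ((Finset.univ : Finset ι) : Set ι) := by
      intro k _ x y hxy
      rw [show x = y from funext fun i => hxy i (by simp)]
    obtain ⟨M, hloc⟩ := locMono (Finset.univ : Finset (Option (Option (κ ⊕ κ)))) hLA hdep (by
      convert hM using 2 with x
      rw [Fintype.prod_option, Fintype.prod_option, Fintype.prod_sum_type]
      simp only [h, mul_assoc]) ha
    have hbx : ∀ x : ι → ℚ_[p], bx (ctr Finset.univ a) (exq Finset.univ M) x = fun i => a i + (p : ℚ_[p]) ^ M * x i := by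
      intro x; funext i; simp [bx, ctr, exq]
    have hl2 : ∀ k : Option (Option (κ ⊕ κ)), ∃ (γ : ι → ℕ) (C : ℝ), 0 < C ∧ ∀ x ∈ Bx p ι,
        ‖h k (fun i => a i + (p : ℚ_[p]) ^ M * x i)‖ = C * ∏ i, ‖x i‖ ^ γ i := by
      intro k
      obtain ⟨γ, g, C, hC, -, -, -, hg, he⟩ := hloc k (Finset.mem_univ _)
      refine ⟨γ, C, hC, fun x hx => ?_⟩
      rw [← hbx, he x hx, norm_mul, hg x hx, mul_comm, mon, norm_prod]
      simp only [norm_pow]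
    choose γ C hC hn using hl2
    refine local_eval (W := W) (D := D) (f := f) ha hD1 M (hC (some none)) (fun α => hC (some (some (Sum.inl α)))) (hn none) (hn (some none))
      (fun α => hn (some (some (Sum.inl α)))) fun α => ?_
    exact comparable (hC (some (some (Sum.inl α)))) (hC (some none)) (hn (some (some (Sum.inl α)))) (hn (some none))
      (Or.inr ⟨_, _, hC (some (some (Sum.inr α))), hn (some (some (Sum.inr α)))⟩)

theorem LA_upd {F : (ι → ℚ_[p]) → ℚ_[p]} (hF : LA F) (i : ι) {G : (ι → ℚ_[p]) → ℚ_[p]} (hG : LA G)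
    (hG1 : ∀ x ∈ Bx p ι, ‖G x‖ ≤ 1) : LA (fun x => F (Function.update x i (G x))) := by
  have hu : ∀ H : (ι → ℚ_[p]) → ℚ_[p], DependsOn H ((Finset.univ : Finset ι) : Set ι) := by
    intro H x y hxy
    rw [show x = y from funext fun i => hxy i (by simp)]
  exact hF.comp_move (isMove_update (s := Finset.univ) (Finset.mem_univ i) hG (LA_const 1) (hu _) (hu _) hG1)

theorem eval {κ : Type} [Fintype κ] {s : Finset ι} {F : (ι → ℚ_[p]) → ℚ_[p]} (hR : Res s F) :
    ∀ {W D : (ι → ℚ_[p]) → ℚ_[p]} {f : κ → (ι → ℚ_[p]) → ℚ_[p]},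
    LA W → LA D → (∀ α, LA (f α)) → (∀ x ∈ Bx p ι, ‖D x‖ ≤ 1) →
    (∀ x ∈ Bx p ι, ‖F x‖ = ‖W x * D x * (∏ α, f α x) * ∏ α, (f α x - D x)‖) →
    QRat (fun l => JJ (Ph W D f l)) := by
  induction hR with
  | mono F h =>
    intro W D f hW hD hf hD1 hF
    refine base_eval hW hD hf hD1 ?_
    obtain ⟨α, c, hc, h⟩ := h
    exact ⟨α, c, hc, fun x hx => by rw [← hF x hx, h x hx]⟩
  | sub F i hi h ih =>
    intro W D f hW hD hf hD1 hF
    have h1 : ∀ b ∈ Finset.range p, QRat (fun l => (((((p : ℚ≥0)⁻¹ : ℚ≥0) : ℝ≥0) : ℝ≥0∞)) * JJ (fun x => Ph W D f l (Function.update x i ((b : ℚ_[p]) + p * x i)))) := by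
      intro b _
      have hG : LA (fun x : ι → ℚ_[p] => (b : ℚ_[p]) + p * x i) := (LA_const _).add ((LA_const _).mul (LA_coord i))
      have hG1 : ∀ x ∈ Bx p ι, ‖(b : ℚ_[p]) + p * x i‖ ≤ 1 := fun x hx => norm_add_le_one (norm_nat_le b) (norm_mul_le_one (norm_nat_le p) (hx i))
      exact QRat.smul (ih b (norm_nat_le b) (LA_upd hW i hG hG1) (LA_upd hD i hG hG1) (fun α => LA_upd (hf α) i hG hG1)
        (fun x hx => hD1 _ (Bx_update hx i (hG1 x hx))) (fun x hx => hF _ (Bx_update hx i (hG1 x hx)))) _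
    refine (QRat.sum (Finset.range p) h1).congr fun l => ?_
    rw [J_sub i (Ph_MB hW hD hf l), p_inv_cast]
  | blow F i j hi hj hij h1 h2 ih1 ih2 =>
    intro W D f hW hD hf hD1 hF
    have a1 : QRat (fun l => JJ (fun x => ‖x i‖ₑ * Ph W D f l (Function.update x j (x i * x j)))) := by
      have hG : LA (fun x : ι → ℚ_[p] => x i * x j) := (LA_coord i).mul (LA_coord j)
      have hG1 : ∀ x ∈ Bx p ι, ‖x i * x j‖ ≤ 1 := fun x hx => norm_mul_le_one (hx i) (hx j)
      refine (ih1 (W := fun x => x i * W (Function.update x j (x i * x j))) ((LA_coord i).mul (LA_upd hW j hG hG1)) (LA_upd hD j hG hG1) (fun α => LA_upd (hf α) j hG hG1)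
        (fun x hx => hD1 _ (Bx_update hx j (hG1 x hx))) (fun x hx => ?_)).congr fun l => ?_
      · rw [norm_mul, hF _ (Bx_update hx j (hG1 x hx)), ← norm_mul]; congr 1; ring
      · congr 1; funext x; unfold Ph; classical
        simp only [Set.indicator_apply, Set.mem_ofPred_eq, enorm_mul, mul_ite, mul_zero]
    have a2 : QRat (fun l => JJ (fun x => ‖x j‖ₑ * Ph W D f l (Function.update x i (p * x j * x i)))) := by
      have hG : LA (fun x : ι → ℚ_[p] => p * x j * x i) := ((LA_const _).mul (LA_coord j)).mul (LA_coord i)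
      have hG1 : ∀ x ∈ Bx p ι, ‖p * x j * x i‖ ≤ 1 := fun x hx => norm_mul_le_one (norm_mul_le_one norm_p_le (hx j)) (hx i)
      refine (ih2 (W := fun x => x j * W (Function.update x i (p * x j * x i))) ((LA_coord j).mul (LA_upd hW i hG hG1)) (LA_upd hD i hG hG1) (fun α => LA_upd (hf α) i hG hG1)
        (fun x hx => hD1 _ (Bx_update hx i (hG1 x hx))) (fun x hx => ?_)).congr fun l => ?_
      · rw [norm_mul, hF _ (Bx_update hx i (hG1 x hx)), ← norm_mul]; congr 1; ring
      · congr 1; funext x; unfold Ph; classical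
        simp only [Set.indicator_apply, Set.mem_ofPred_eq, enorm_mul, mul_ite, mul_zero]
    refine (a1.add (a2.smul (p : ℚ≥0)⁻¹)).congr fun l => ?_
    rw [J_blow i j hij (Ph_MB hW hD hf l), p_inv_cast]
  | shift F i hi φ hφ hφi hφs hφ1 h ih =>
    intro W D f hW hD hf hD1 hF
    have hG : LA (fun x : ι → ℚ_[p] => x i + φ x) := (LA_coord i).add hφ
    have hG1 : ∀ x ∈ Bx p ι, ‖x i + φ x‖ ≤ 1 := fun x hx => norm_add_le_one (hx i) (hφ1 x hx)
    refine (ih (LA_upd hW i hG hG1) (LA_upd hD i hG hG1) (fun α => LA_upd (hf α) i hG hG1)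
        (fun x hx => hD1 _ (Bx_update hx i (hG1 x hx))) (fun x hx => hF _ (Bx_update hx i (hG1 x hx)))).congr fun l => ?_
    rw [J_shift i (Ph_MB hW hD hf l) hφ hφi hφ1]
    rfl
  | pow F i hi m hm h ih =>
    intro W D f hW hD hf hD1 hF
    obtain ⟨T, w, hT, hJ⟩ := J_pow (p := p) (ι := ι) i m hm
    refine (QRat.sum (T ×ˢ Finset.range m) (r := fun z l => (((w * (p : ℚ≥0)⁻¹ ^ z.2 : ℚ≥0) : ℝ≥0) : ℝ≥0∞) *
        JJ (fun x => ‖x i ^ (m - 1)‖ₑ * Ph W D f l (Function.update x i (z.1 * (p : ℚ_[p]) ^ z.2 * x i ^ m)))) ?_).congr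
        fun l => hJ (Ph_MB hW hD hf l)
    intro z hz
    have hz1 := hT _ (Finset.mem_product.1 hz).1
    have hε : ‖z.1 * (p : ℚ_[p]) ^ z.2‖ ≤ 1 := norm_mul_le_one hz1.le (norm_pow_le_one norm_p_le _)
    have hε0 : z.1 * (p : ℚ_[p]) ^ z.2 ≠ 0 := mul_ne_zero (by intro h; simp [h] at hz1) (pow_ne_zero _ p_ne)
    have hG : LA (fun x : ι → ℚ_[p] => z.1 * (p : ℚ_[p]) ^ z.2 * x i ^ m) := (LA_const _).mul ((LA_coord i).pow _)
    have hG1 : ∀ x ∈ Bx p ι, ‖z.1 * (p : ℚ_[p]) ^ z.2 * x i ^ m‖ ≤ 1 := fun x hx => norm_mul_le_one hε (norm_pow_le_one (hx i) _)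
    refine QRat.smul ?_ _
    refine (ih _ hε0 hε (W := fun x => x i ^ (m - 1) * W (Function.update x i (z.1 * (p : ℚ_[p]) ^ z.2 * x i ^ m)))
      (((LA_coord i).pow _).mul (LA_upd hW i hG hG1)) (LA_upd hD i hG hG1) (fun α => LA_upd (hf α) i hG hG1)
        (fun x hx => hD1 _ (Bx_update hx i (hG1 x hx))) (fun x hx => ?_)).congr fun l => ?_
    · rw [norm_mul, hF _ (Bx_update hx i (hG1 x hx)), ← norm_mul]; congr 1; ring
    · congr 1; funext x; unfold Ph; classical
      simp only [Set.indicator_apply, Set.mem_ofPred_eq, enorm_mul, mul_ite, mul_zero]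

end res
end IdealZeta
end PartC8

section PartD1
open Filter Topology
open scoped NNReal ENNReal
namespace IdealZeta
set_option linter.unusedSectionVars false
section res
open MeasureTheory Matrix
variable {p : ℕ} [Fact p.Prime] {ι : Type} [Fintype ι] [DecidableEq ι]

/-- product Haar measure -/
noncomputable def hp (p : ℕ) [Fact p.Prime] (ι : Type) [Fintype ι] : Measure (ι → ℚ_[p]) :=
  Measure.pi fun _ : ι => hm p

theorem scale_set (a : ℚ_[p]) (ha : a ≠ 0) {s : Set ℚ_[p]} (hs : MeasurableSet s) :
    ‖a‖ₑ * hm p ((a * ·) ⁻¹' s) = hm p s := by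
  have h := scale a ha (s.indicator 1)
  have hs' : MeasurableSet ((a * ·) ⁻¹' s) := (measurable_const_mul a) hs
  rw [lintegral_indicator_one hs] at h
  rw [h, ← lintegral_indicator_one hs']
  rfl

theorem hp_diag {D : ι → ℚ_[p]} (h : det (diagonal D) ≠ 0) :
    ‖det (diagonal D)‖ₑ • Measure.map (toLin' (diagonal D)) (hp p ι) = hp p ι := by
  refine (Measure.pi_eq fun s hs => ?_).symm
  simp only [det_diagonal, Measure.coe_smul, smul_eq_mul, Pi.smul_apply]
  rw [Measure.map_apply _ (MeasurableSet.univ_pi hs)]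
  swap; · exact Continuous.measurable (LinearMap.continuous_on_pi _)
  have : (Matrix.toLin' (diagonal D) ⁻¹' Set.pi Set.univ fun i : ι => s i) =
      Set.pi Set.univ fun i : ι => (D i * ·) ⁻¹' s i := by
    ext f
    simp only [LinearMap.coe_proj, smul_eq_mul, LinearMap.smul_apply, Set.mem_univ_pi,
      Set.mem_preimage, LinearMap.pi_apply, diagonal_toLin']
  have A : ∀ i, D i ≠ 0 := fun i => by
    simp only [det_diagonal, Ne] at h
    exact Finset.prod_ne_zero_iff.1 h i (Finset.mem_univ i)
  rw [this, hp, Measure.pi_pi, ← ofReal_norm, norm_prod,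
    ENNReal.ofReal_prod_of_nonneg fun i _ => norm_nonneg (D i), ← Finset.prod_mul_distrib]
  refine Finset.prod_congr rfl fun i _ => ?_
  rw [ofReal_norm, scale_set _ (A i) (hs i)]

theorem hp_trans (t : TransvectionStruct ι ℚ_[p]) : Measure.map (toLin' t.toMatrix) (hp p ι) = hp p ι := by
  have ht : Measurable (toLin' t.toMatrix) := Continuous.measurable (LinearMap.continuous_on_pi _)
  refine (Measure.pi_eq fun s hs ↦ ?_).symm
  have h2s : MeasurableSet (Set.univ.pi s) := .pi Set.countable_univ fun i _ ↦ hs i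
  rw [← Measure.pi_pi, ← lintegral_indicator_one h2s, ← lintegral_indicator_one h2s]
  rw [lintegral_map (measurable_one.indicator h2s) ht, hp]
  refine lintegral_eq_of_lmarginal_eq {t.i} ((measurable_one.indicator h2s).comp ht)
    (measurable_one.indicator h2s) ?_
  simp_rw [lmarginal_singleton]
  ext x
  cases t with | mk t_i t_j t_hij t_c =>
  simp [transvection, single_mulVec, t_hij.symm, ← Function.update_add,
    lintegral_add_right_eq_self fun xᵢ ↦ Set.indicator (Set.univ.pi s) 1 (Function.update x t_i xᵢ)]

theorem hp_matrix {M : Matrix ι ι ℚ_[p]} (hM : det M ≠ 0) :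
    ‖det M‖ₑ • Measure.map (toLin' M) (hp p ι) = hp p ι := by
  apply diagonal_transvection_induction_of_det_ne_zero _ M hM
  · intro D hD
    exact hp_diag hD
  · intro t
    rw [hp_trans t, Matrix.TransvectionStruct.det]; simp
  · intro A B _ _ IHA IHB
    have hA : Measurable (toLin' A) := Continuous.measurable (LinearMap.continuous_on_pi _)
    have hB : Measurable (toLin' B) := Continuous.measurable (LinearMap.continuous_on_pi _)
    rw [toLin'_mul, det_mul, LinearMap.coe_comp, ← Measure.map_map hA hB, enorm_mul, mul_smul, ← Measure.map_smul,
      IHB, IHA]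

theorem hp_image {M : Matrix ι ι ℚ_[p]} (hM : det M ≠ 0) {s : Set (ι → ℚ_[p])} (hs : MeasurableSet s) :
    hp p ι s = ‖det M‖ₑ * hp p ι {x | M *ᵥ x ∈ s} := by
  have hA : Measurable (toLin' M) := Continuous.measurable (LinearMap.continuous_on_pi _)
  conv_lhs => rw [← hp_matrix hM]
  rw [Measure.smul_apply, Measure.map_apply hA hs]
  rfl

theorem hp_restrict : Measure.pi (fun _ : ι => nu p) = (hp p ι).restrict (Bx p ι) := by
  have h : Bx p ι = Set.pi Set.univ (fun _ : ι => OO p) := by ext x; simp [Bx, OO]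
  rw [h, hp, Measure.restrict_pi_pi]; rfl

theorem JJ_ind {S : Set (ι → ℚ_[p])} (hS : MeasurableSet S) (hS1 : S ⊆ Bx p ι) {Ψ : (ι → ℚ_[p]) → ℝ≥0∞}
    (h : ∀ x ∈ Bx p ι, Ψ x = S.indicator 1 x) : JJ Ψ = hp p ι S := by
  rw [JJ_congr h, JJ, hp_restrict, Set.indicator_indicator, Set.inter_eq_right.2 hS1, lintegral_indicator_one hS, Measure.restrict_apply hS, Set.inter_eq_left.2 hS1]

instance : (hp p ι).IsAddHaarMeasure := by unfold hp; infer_instance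

theorem hp_Bx : hp p ι (Bx p ι) = 1 := by
  have h : Bx p ι = Set.pi Set.univ (fun _ : ι => OO p) := by ext x; simp [Bx, OO]
  rw [h, hp, Measure.pi_pi]; simp [hm_OO]

end res
end IdealZeta
end PartD1

section PartD2
open Filter Topology
open scoped NNReal ENNReal
namespace IdealZeta
set_option linter.unusedSectionVars false
section res
open MeasureTheory Matrix
variable {p : ℕ} [Fact p.Prime] {ν : Type} [Fintype ν] [DecidableEq ν]

/-- vector as matrix -/
def mat (x : ν × ν → ℚ_[p]) : Matrix ν ν ℚ_[p] := Matrix.of fun i j => x (i, j)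

/-- integral matrix -/
def IM (A : Matrix ν ν ℚ_[p]) : Prop := ∀ i j, ‖A i j‖ ≤ 1

theorem IM_iff (A : Matrix ν ν ℚ_[p]) : IM A ↔ ∃ A' : Matrix ν ν ℤ_[p], A = (PadicInt.Coe.ringHom (p := p)).mapMatrix A' := by
  constructor
  · intro h
    exact ⟨fun i j => ⟨A i j, h i j⟩, rfl⟩
  · rintro ⟨A', rfl⟩ i j
    exact (A' i j).2

theorem IM.mul {A B : Matrix ν ν ℚ_[p]} (hA : IM A) (hB : IM B) : IM (A * B) := by
  rw [IM_iff] at *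
  obtain ⟨A, rfl⟩ := hA
  obtain ⟨B, rfl⟩ := hB
  exact ⟨A * B, by rw [map_mul]⟩

theorem IM.add {A B : Matrix ν ν ℚ_[p]} (hA : IM A) (hB : IM B) : IM (A + B) := by
  rw [IM_iff] at *
  obtain ⟨A, rfl⟩ := hA
  obtain ⟨B, rfl⟩ := hB
  exact ⟨A + B, by rw [map_add]⟩

theorem IM.adj {A : Matrix ν ν ℚ_[p]} (hA : IM A) : IM A.adjugate := by
  rw [IM_iff] at *
  obtain ⟨A, rfl⟩ := hA
  exact ⟨A.adjugate, by rw [RingHom.map_adjugate]⟩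

theorem IM.det_le {A : Matrix ν ν ℚ_[p]} (hA : IM A) : ‖A.det‖ ≤ 1 := by
  rw [IM_iff] at hA
  obtain ⟨A, rfl⟩ := hA
  rw [← RingHom.map_det]
  exact A.det.2

theorem IM.smul {A : Matrix ν ν ℚ_[p]} (hA : IM A) {c : ℚ_[p]} (hc : ‖c‖ ≤ 1) : IM (c • A) := fun i j => by
  rw [Matrix.smul_apply, smul_eq_mul]
  exact norm_mul_le_one hc (hA i j)

theorem IM_one : IM (1 : Matrix ν ν ℚ_[p]) := by
  rw [IM_iff]; exact ⟨1, by simp⟩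

theorem IM_int (A : Matrix ν ν ℤ) : IM ((Int.castRingHom ℚ_[p]).mapMatrix A) := fun i j => by
  simpa using Padic.norm_int_le_one (p := p) (A i j)

/-- integral invertible -/
def GM (A : Matrix ν ν ℚ_[p]) : Prop := IM A ∧ ‖A.det‖ = 1

theorem GM.inv {A : Matrix ν ν ℚ_[p]} (h : GM A) : GM A⁻¹ := by
  constructor
  · rw [inv_def]
    refine h.1.adj.smul ?_
    rw [Ring.inverse_eq_inv', norm_inv, h.2]; simp
  · rw [det_nonsing_inv, Ring.inverse_eq_inv', norm_inv, h.2]; simp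

theorem GM.mul {A B : Matrix ν ν ℚ_[p]} (h : GM A) (h' : GM B) : GM (A * B) :=
  ⟨h.1.mul h'.1, by rw [det_mul, norm_mul, h.2, h'.2, one_mul]⟩

theorem GM.det_ne {A : Matrix ν ν ℚ_[p]} (h : GM A) : A.det ≠ 0 := by
  intro h0; have := h.2; simp [h0] at this

theorem GM_of_mul {A B : Matrix ν ν ℚ_[p]} (h : IM A) (h' : IM B) (e : A * B = 1) : GM A := by
  refine ⟨h, le_antisymm h.det_le ?_⟩
  have h1 : ‖A.det‖ * ‖B.det‖ = 1 := by rw [← norm_mul, ← det_mul, e]; simp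
  rw [← h1]
  exact mul_le_of_le_one_right (norm_nonneg _) h'.det_le

/-- integral invertible, vectors -/
def GS (p : ℕ) [Fact p.Prime] (ν : Type) [Fintype ν] [DecidableEq ν] : Set (ν × ν → ℚ_[p]) := {x | GM (mat x)}

/-- coset -/
def SB (B : Matrix ν ν ℚ_[p]) : Set (ν × ν → ℚ_[p]) := {x | GM (mat x * B⁻¹)}

theorem mat_cont : Continuous (mat : (ν × ν → ℚ_[p]) → Matrix ν ν ℚ_[p]) :=
  continuous_matrix fun i j => continuous_apply (i, j)

theorem SB_meas (B : Matrix ν ν ℚ_[p]) : MeasurableSet (SB B) := by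
  have hc : Continuous fun x : ν × ν → ℚ_[p] => mat x * B⁻¹ := mat_cont.matrix_mul continuous_const
  have : IsClosed (SB B) := by
    have : SB B = (⋂ i, ⋂ j, {x | ‖(mat x * B⁻¹) i j‖ ≤ 1}) ∩ {x | ‖(mat x * B⁻¹).det‖ = 1} := by
      ext x; simp [SB, GM, IM]
    rw [this]
    refine IsClosed.inter (isClosed_iInter fun i => isClosed_iInter fun j => ?_) ?_
    · exact isClosed_le (hc.matrix_elem i j).norm continuous_const
    · exact isClosed_eq hc.matrix_det.norm continuous_const
  exact this.measurableSet

theorem GS_eq : GS p ν = SB 1 := by ext x; simp [GS, SB]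

theorem GS_meas : MeasurableSet (GS p ν) := by rw [GS_eq]; exact SB_meas _

theorem GS_le : hp p (ν × ν) (GS p ν) ≤ 1 := by
  rw [← hp_Bx (p := p) (ι := ν × ν)]
  exact measure_mono fun x hx i => hx.1 i.1 i.2

theorem GS_pos : hp p (ν × ν) (GS p ν) ≠ 0 := by
  have hc : Continuous fun x : ν × ν → ℚ_[p] => (mat x).det := mat_cont.matrix_det
  have hU : IsOpen (Bx p (ν × ν) ∩ {x | ‖(mat x).det - 1‖ < 1}) :=
    Bx_isOpen.inter (isOpen_lt (hc.sub continuous_const).norm continuous_const)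
  have h1 : mat (p := p) (fun q : ν × ν => (1 : Matrix ν ν ℚ_[p]) q.1 q.2) = 1 := by ext i j; simp [mat]
  have hn : (Bx p (ν × ν) ∩ {x | ‖(mat x).det - 1‖ < 1}).Nonempty := by
    refine ⟨fun q => (1 : Matrix ν ν ℚ_[p]) q.1 q.2, fun q => IM_one q.1 q.2, ?_⟩
    simp [h1]
  have h := hU.measure_pos (hp p (ν × ν)) hn
  refine (h.trans_le (measure_mono ?_)).ne'
  rintro x ⟨hx, hx1⟩
  have hI : IM (mat x) := fun i j => hx (i, j)
  refine ⟨hI, le_antisymm hI.det_le ?_⟩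
  by_contra hlt
  push Not at hlt
  have : ‖(1 : ℚ_[p])‖ < 1 := by
    have e : (1 : ℚ_[p]) = (mat x).det + (-((mat x).det - 1)) := by ring
    rw [e]
    refine (Padic.nonarchimedean _ _).trans_lt (max_lt hlt ?_)
    rw [norm_neg]; exact hx1
  simp at this

theorem SB_vol (B : Matrix ν ν ℚ_[p]) (hB : B.det ≠ 0) :
    hp p (ν × ν) (SB B) = ‖B.det‖ₑ ^ Fintype.card ν * hp p (ν × ν) (GS p ν) := by
  have hd : (kronecker (1 : Matrix ν ν ℚ_[p]) Bᵀ).det = B.det ^ Fintype.card ν := by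
    rw [kronecker, det_kronecker]; simp
  have hd0 : (kronecker (1 : Matrix ν ν ℚ_[p]) Bᵀ).det ≠ 0 := by rw [hd]; exact pow_ne_zero _ hB
  rw [hp_image hd0 (SB_meas B), hd, enorm_pow]
  congr 2
  ext x
  have e : mat (kronecker (1 : Matrix ν ν ℚ_[p]) Bᵀ *ᵥ x) = mat x * B := by
    ext i j
    simp [mat, mulVec, dotProduct, Fintype.sum_prod_type, kronecker_apply, Matrix.mul_apply, Matrix.one_apply, mul_comm]
  rw [Set.mem_ofPred_eq, SB, Set.mem_ofPred_eq, e, Matrix.mul_assoc, Matrix.mul_nonsing_inv _ (isUnit_iff_ne_zero.2 hB), Matrix.mul_one]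
  rfl

end res
end IdealZeta
end PartD2

section PartD3
open Filter Topology
open scoped NNReal ENNReal
namespace IdealZeta
set_option linter.unusedSectionVars false
section res
open MeasureTheory Matrix
variable {p : ℕ} [Fact p.Prime] {ν : Type} [Fintype ν] [DecidableEq ν]

/-- cast of an integer matrix -/
noncomputable def cz (p : ℕ) [Fact p.Prime] (A : Matrix ν ν ℤ) : Matrix ν ν ℚ_[p] := (Int.castRingHom ℚ_[p]).mapMatrix A

theorem cz_mul (A B : Matrix ν ν ℤ) : cz p (A * B) = cz p A * cz p B := map_mul _ _ _
theorem cz_det (A : Matrix ν ν ℤ) : (cz p A).det = (A.det : ℚ_[p]) := ((Int.castRingHom ℚ_[p]).map_det A).symm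
theorem cz_IM (A : Matrix ν ν ℤ) : IM (cz p A) := IM_int A
theorem cz_apply (A : Matrix ν ν ℤ) (i j : ν) : cz p A i j = (A i j : ℚ_[p]) := rfl
theorem cz_adj (A : Matrix ν ν ℤ) : cz p A.adjugate = (cz p A).adjugate := RingHom.map_adjugate _ _

theorem IM_inv_iff (N M : Matrix ν ν ℚ_[p]) (h : M.det ≠ 0) :
    IM (N * M⁻¹) ↔ ∀ i j, ‖(N * M.adjugate) i j‖ ≤ ‖M.det‖ := by
  unfold IM
  refine forall_congr' fun i => forall_congr' fun j => ?_
  rw [inv_def, Ring.inverse_eq_inv', Matrix.mul_smul, Matrix.smul_apply, smul_eq_mul, norm_mul, norm_inv,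
    inv_mul_le_iff₀ (norm_pos_iff.2 h), mul_one]

theorem norm_pp (l : ℕ) (z : ℤ) (hz : z.natAbs = p ^ l) : ‖(z : ℚ_[p])‖ = ‖(p : ℚ_[p])‖ ^ l := by
  rw [← norm_pow]
  rcases Int.natAbs_eq z with h | h
  · rw [h, hz]; push_cast; rfl
  · rw [h, hz]; push_cast; rw [norm_neg]

theorem det_ne_of {B : Matrix ν ν ℤ} {l : ℕ} (hB : B.det.natAbs = p ^ l) : (cz p B).det ≠ 0 := by
  rw [cz_det, ← norm_pos_iff, norm_pp l _ hB]
  exact pow_pos norm_p_pos _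

theorem int_div {N B : Matrix ν ν ℤ} {l : ℕ} (hB : B.det.natAbs = p ^ l) (h : IM (cz p N * (cz p B)⁻¹)) :
    ∃ C : Matrix ν ν ℤ, N = C * B := by
  rw [IM_inv_iff _ _ (det_ne_of hB), ← cz_adj, ← cz_mul, cz_det, norm_pp l _ hB] at h
  have hd : ∀ i j, ∃ c : ℤ, (N * B.adjugate) i j = B.det * c := by
    intro i j
    have h1 := h i j
    rw [cz_apply, Padic.norm_p, inv_pow, ← zpow_natCast, ← _root_.zpow_neg, Padic.norm_int_le_pow_iff_dvd] at h1
    have : B.det ∣ (N * B.adjugate) i j := by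
      rw [← Int.natAbs_dvd, hB]; exact_mod_cast h1
    exact this
  choose C hC using hd
  refine ⟨of C, ?_⟩
  have h0 : B.det ≠ 0 := by
    intro h0
    rw [h0] at hB
    simp at hB
    exact (pow_ne_zero l (Fact.out : p.Prime).ne_zero) hB.symm
  have h1 : N * B.adjugate = B.det • of C := by ext i j; simp [hC]
  have h2 : B.det • N = B.det • (of C * B) := by
    rw [← Matrix.smul_mul, ← h1, Matrix.mul_assoc, adjugate_mul, Matrix.mul_smul, Matrix.mul_one]
  ext i j
  have h3 := congrFun (congrFun h2 i) j
  simp only [Matrix.smul_apply, smul_eq_mul] at h3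
  exact mul_left_cancel₀ h0 h3

variable {R : Type} [CommRing R] (b : Module.Basis ν ℤ R)

/-- structure matrices -/
noncomputable def mm (k : ν) : Matrix ν ν ℤ := of fun i j => b.repr (b i * b k) j

theorem repr_mul (r : R) (k : ν) : ⇑(b.repr (r * b k)) = ⇑(b.repr r) ᵥ* mm b k := by
  have h : r * b k = ∑ i, b.repr r i • (b i * b k) := by
    conv_lhs => rw [← b.sum_repr r, Finset.sum_mul]
    exact Finset.sum_congr rfl fun i _ => by rw [smul_mul_assoc]
  rw [h]
  ext j
  simp [vecMul, dotProduct, mm, Finset.sum_apply', -zsmul_eq_mul]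

/-- rows of B form a basis of I -/
def IsB (I : Ideal R) (B : Matrix ν ν ℤ) : Prop := ∀ r, r ∈ I ↔ ∃ c : ν → ℤ, ⇑(b.repr r) = c ᵥ* B

theorem IsB_row {I : Ideal R} {B : Matrix ν ν ℤ} (h : IsB b I B) (C : Matrix ν ν ℤ)
    (hC : ∀ i, b.equivFun.symm (C i) ∈ I) : ∃ C' : Matrix ν ν ℤ, C = C' * B := by
  have : ∀ i, ∃ c : ν → ℤ, C i = c ᵥ* B := fun i => by
    obtain ⟨c, hc⟩ := (h _).1 (hC i)
    refine ⟨c, ?_⟩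
    rw [← hc]
    exact (b.equivFun.apply_symm_apply (C i)).symm
  choose C' hC' using this
  refine ⟨of C', ?_⟩
  ext i j
  rw [hC' i]; rfl

theorem IsB_self {I : Ideal R} {B : Matrix ν ν ℤ} (h : IsB b I B) (i : ν) : b.equivFun.symm (B i) ∈ I := by
  rw [h]
  refine ⟨Pi.single i 1, ?_⟩
  rw [single_one_vecMul]
  exact b.equivFun.apply_symm_apply (B i)

theorem exists_B (I : Ideal R) [Finite (R ⧸ I)] : ∃ B : Matrix ν ν ℤ, B.det.natAbs = Nat.card (R ⧸ I) ∧ IsB b I B := by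
  have : Module.Free ℤ R := Module.Free.of_basis b
  have : Module.Finite ℤ R := Module.Finite.of_basis b
  let N := I.restrictScalars ℤ
  have hfin : Finite (R ⧸ N) := ‹Finite (R ⧸ I)›
  have hr := (Submodule.finiteQuotient_iff N).1 hfin
  have hc : Fintype.card (Module.Free.ChooseBasisIndex ℤ N) = Fintype.card ν := by
    rw [← Module.finrank_eq_card_chooseBasisIndex, hr, Module.finrank_eq_card_basis b]
  let bN : Module.Basis ν ℤ N := (Module.Free.chooseBasis ℤ N).reindex (Fintype.equivOfCardEq hc)
  refine ⟨of fun i j => b.repr (bN i : R) j, ?_, ?_⟩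
  · have h := Submodule.natAbs_det_basis_change b N bN
    rw [Module.Basis.det_apply, ← det_transpose] at h
    exact h
  · intro r
    have key : ∀ c : ν → ℤ, c ᵥ* (of fun i j => b.repr (bN i : R) j) = ⇑(b.repr (((∑ i, c i • bN i : N)) : R)) := by
      intro c
      ext j
      simp [vecMul, dotProduct, Finset.sum_apply', -zsmul_eq_mul]
    constructor
    · intro hr
      refine ⟨bN.repr ⟨r, hr⟩, ?_⟩
      rw [key, bN.sum_repr]
    · rintro ⟨c, hc⟩
      rw [key] at hc
      have : r = ((∑ i, c i • bN i : N) : R) := b.repr.injective (DFunLike.coe_injective hc)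
      rw [this]
      exact (∑ i, c i • bN i : N).2

end res
end IdealZeta
end PartD3

section PartD4
open Filter Topology
open scoped NNReal ENNReal
namespace IdealZeta
set_option linter.unusedSectionVars false
section res
open MeasureTheory Matrix
variable {p : ℕ} [Fact p.Prime] {ν : Type} [Fintype ν] [DecidableEq ν]
variable {R : Type} [CommRing R] (b : Module.Basis ν ℤ R)

/-- the cone set -/
def TT (p : ℕ) [Fact p.Prime] (l : ℕ) : Set (ν × ν → ℚ_[p]) := {x | IM (mat x) ∧ ‖(mat x).det‖ = ‖(p : ℚ_[p])‖ ^ l ∧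
  ∀ k i j, ‖(mat x * cz p (mm b k) * (mat x).adjugate) i j‖ ≤ ‖(mat x).det‖}

theorem mul_eq_of_inv {M B U : Matrix ν ν ℚ_[p]} (hB : B.det ≠ 0) (h : U = M * B⁻¹) : M = U * B := by
  rw [h, Matrix.mul_assoc, nonsing_inv_mul _ (isUnit_iff_ne_zero.2 hB), Matrix.mul_one]

theorem SB_sub {I : Ideal R} {B : Matrix ν ν ℤ} {l : ℕ} (hB : B.det.natAbs = p ^ l) (h : IsB b I B) :
    SB (cz p B) ⊆ TT b p l := by
  intro x hx
  obtain ⟨U, hU⟩ : ∃ U, U = mat x * (cz p B)⁻¹ := ⟨_, rfl⟩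
  have hx' : GM U := by rw [hU]; exact hx
  have hB0 := det_ne_of hB
  have hM := mul_eq_of_inv hB0 hU
  have hd : ‖(mat x).det‖ = ‖(p : ℚ_[p])‖ ^ l := by
    rw [hM, det_mul, norm_mul, hx'.2, one_mul, cz_det, norm_pp l _ hB]
  have hd0 : (mat x).det ≠ 0 := by rw [← norm_pos_iff, hd]; exact pow_pos norm_p_pos _
  refine ⟨by rw [hM]; exact hx'.1.mul (cz_IM B), hd, fun k => ?_⟩
  rw [← IM_inv_iff _ _ hd0]
  obtain ⟨C, hC⟩ := IsB_row b h (B * mm b k) (fun i => by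
    have h1 : b.equivFun.symm ((B * mm b k) i) = b.equivFun.symm (B i) * b k := by
      apply b.equivFun.injective
      rw [b.equivFun.apply_symm_apply]
      have h2 := repr_mul b (b.equivFun.symm (B i)) k
      have h3 : ⇑(b.repr (b.equivFun.symm (B i))) = B i := b.equivFun.apply_symm_apply (B i)
      rw [h3] at h2
      exact h2.symm
    rw [h1]
    exact I.mul_mem_right _ (IsB_self b h i))
  have e : mat x * cz p (mm b k) * (mat x)⁻¹ = U * cz p C * U⁻¹ := by
    rw [hM, Matrix.mul_inv_rev, Matrix.mul_assoc U, ← cz_mul, hC, cz_mul]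
    simp only [Matrix.mul_assoc]
    rw [← Matrix.mul_assoc (cz p B) (cz p B)⁻¹, mul_nonsing_inv _ (isUnit_iff_ne_zero.2 hB0), Matrix.one_mul]
  rw [e]
  exact (hx'.1.mul (cz_IM C)).mul hx'.inv.1

theorem SB_le {I I' : Ideal R} {B B' : Matrix ν ν ℤ} {l l' : ℕ} (hB : B.det.natAbs = p ^ l) (h : IsB b I B)
    (hB' : B'.det.natAbs = p ^ l') (h' : IsB b I' B') {x : ν × ν → ℚ_[p]} (hx : x ∈ SB (cz p B)) (hx' : x ∈ SB (cz p B')) :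
    I' ≤ I := by
  have hB0 := det_ne_of hB
  have hB0' := det_ne_of hB'
  obtain ⟨U, hU⟩ : ∃ U, U = mat x * (cz p B)⁻¹ := ⟨_, rfl⟩
  obtain ⟨U', hU'⟩ : ∃ U, U = mat x * (cz p B')⁻¹ := ⟨_, rfl⟩
  have hG : GM U := by rw [hU]; exact hx
  have hG' : GM U' := by rw [hU']; exact hx'
  have e1 := mul_eq_of_inv hB0' hU'
  have e : cz p B' * (cz p B)⁻¹ = U'⁻¹ * U := by
    rw [hU, e1, Matrix.mul_assoc, ← Matrix.mul_assoc U'⁻¹, nonsing_inv_mul _ (isUnit_iff_ne_zero.2 hG'.det_ne), Matrix.one_mul]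
  obtain ⟨C, hC⟩ := int_div (N := B') hB (by rw [e]; exact (hG'.inv.mul hG).1)
  intro r hr
  obtain ⟨c, hc⟩ := (h' r).1 hr
  exact (h r).2 ⟨c ᵥ* C, by rw [hc, hC, vecMul_vecMul]⟩

/-- integral vectors -/
def IV (v : ν → ℚ_[p]) : Prop := ∀ j, ‖v j‖ ≤ 1

theorem IV.vecMul {v : ν → ℚ_[p]} (hv : IV v) {A : Matrix ν ν ℚ_[p]} (hA : IM A) : IV (v ᵥ* A) := by
  intro j
  rw [Matrix.vecMul, dotProduct]
  exact IsUltrametricDist.norm_sum_le_of_forall_le_of_nonneg zero_le_one fun i _ => norm_mul_le_one (hv i) (hA i j)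

/-- coordinates -/
noncomputable def cv (p : ℕ) [Fact p.Prime] (r : R) : ν → ℚ_[p] := fun i => (b.repr r i : ℚ_[p])

theorem cv_mul (r : R) (k : ν) : cv b p (r * b k) = cv b p r ᵥ* cz p (mm b k) := by
  ext j
  unfold cv
  rw [repr_mul]
  simp [Matrix.vecMul, dotProduct, cz]

/-- the additive group of a matrix -/
noncomputable def gA (M : Matrix ν ν ℚ_[p]) : AddSubgroup R where
  carrier := {r | IV (cv b p r ᵥ* M⁻¹)}
  zero_mem' := by
    have : cv b p 0 = 0 := by ext; simp [cv]
    rw [Set.mem_ofPred_eq, this, zero_vecMul]; intro j; simp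
  add_mem' := by
    intro r s hr hs
    have : cv b p (r + s) = cv b p r + cv b p s := by ext; simp [cv]
    rw [Set.mem_ofPred_eq, this, add_vecMul]
    exact fun j => norm_add_le_one (hr j) (hs j)
  neg_mem' := by
    intro r hr
    have : cv b p (-r) = - cv b p r := by ext; simp [cv]
    rw [Set.mem_ofPred_eq, this, neg_vecMul]
    intro j
    rw [Pi.neg_apply, norm_neg]; exact hr j

/-- the ideal of a matrix -/
noncomputable def gI (M : Matrix ν ν ℚ_[p]) (h0 : M.det ≠ 0) (h : ∀ k, IM (M * cz p (mm b k) * M⁻¹)) : Ideal R where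
  carrier := gA b M
  zero_mem' := (gA b M).zero_mem
  add_mem' := (gA b M).add_mem
  smul_mem' := by
    intro s r hr
    have key : ∀ k, r * b k ∈ gA b M := by
      intro k
      have e : cv b p (r * b k) ᵥ* M⁻¹ = (cv b p r ᵥ* M⁻¹) ᵥ* (M * cz p (mm b k) * M⁻¹) := by
        rw [vecMul_vecMul, cv_mul, vecMul_vecMul, Matrix.mul_assoc M, ← Matrix.mul_assoc M⁻¹,
          nonsing_inv_mul _ (isUnit_iff_ne_zero.2 h0), Matrix.one_mul]
      change IV _
      rw [e]
      exact IV.vecMul hr (h k)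
    have e : s • r = ∑ k, b.repr s k • (r * b k) := by
      conv_lhs => rw [← b.sum_repr s, smul_eq_mul, mul_comm, Finset.mul_sum]
      exact Finset.sum_congr rfl fun i _ => by rw [mul_smul_comm]
    rw [e]
    exact (gA b M).sum_mem fun k _ => (gA b M).zsmul_mem (key k) _

theorem appr_mat {M : Matrix ν ν ℚ_[p]} (hM : IM M) (l : ℕ) : ∃ (N : Matrix ν ν ℤ) (E : Matrix ν ν ℚ_[p]), IM E ∧
    M = cz p N + (p : ℚ_[p]) ^ l • E := by
  have : ∀ i j, ∃ (z : ℤ) (e : ℤ_[p]), M i j = z + (p : ℚ_[p]) ^ l * e := by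
    intro i j
    obtain ⟨Y, hY⟩ : ∃ Y : ℤ_[p], (Y : ℚ_[p]) = M i j := ⟨⟨M i j, hM i j⟩, rfl⟩
    have h := PadicInt.appr_spec l Y
    rw [Ideal.mem_span_singleton] at h
    obtain ⟨e, he⟩ := h
    refine ⟨((PadicInt.appr Y l : ℕ) : ℤ), e, ?_⟩
    have h2 := congrArg (fun z : ℤ_[p] => (z : ℚ_[p])) he
    push_cast at h2 ⊢
    rw [← h2, hY]; ring
  choose z e h using this
  refine ⟨of z, of fun i j => (e i j : ℚ_[p]), fun i j => (e i j).2, ?_⟩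
  ext i j
  simp [h, cz]

theorem TT_cover (l : ℕ) {x : ν × ν → ℚ_[p]} (hx : x ∈ TT b p l) :
    ∃ I : Ideal R, Nat.card (R ⧸ I) = p ^ l ∧ ∀ B : Matrix ν ν ℤ, B.det.natAbs = Nat.card (R ⧸ I) → IsB b I B → x ∈ SB (cz p B) := by
  obtain ⟨hI, hd, hc⟩ := hx
  obtain ⟨M, hM⟩ : ∃ M, M = mat x := ⟨_, rfl⟩
  rw [← hM] at hI hd hc
  have hu : ∀ {A : Matrix ν ν ℚ_[p]}, A.det ≠ 0 → IsUnit A.det := fun h => isUnit_iff_ne_zero.2 h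
  have h0 : M.det ≠ 0 := by rw [← norm_pos_iff, hd]; exact pow_pos norm_p_pos _
  have hc' : ∀ k, IM (M * cz p (mm b k) * M⁻¹) := fun k => (IM_inv_iff _ _ h0).2 (hc k)
  have hpM : IM ((p : ℚ_[p]) ^ l • M⁻¹) := by
    rw [inv_def, Ring.inverse_eq_inv', smul_smul]
    refine hI.adj.smul ?_
    rw [norm_mul, norm_inv, hd, norm_pow, mul_inv_cancel₀ (pow_pos norm_p_pos l).ne']
  -- the ideal
  obtain ⟨I, hIdef⟩ : ∃ I, I = gI b M h0 hc' := ⟨_, rfl⟩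
  have hmem : ∀ r, r ∈ I ↔ IV (cv b p r ᵥ* M⁻¹) := fun r => by rw [hIdef]; rfl
  have hrow : ∀ C : Matrix ν ν ℤ, IM (cz p C * M⁻¹) ↔ ∀ i, b.equivFun.symm (C i) ∈ I := by
    intro C
    unfold IM
    refine forall_congr' fun i => ?_
    rw [hmem]
    unfold IV
    have : cv b p (b.equivFun.symm (C i)) = (cz p C) i := by
      ext j
      have h3 : ⇑(b.repr (b.equivFun.symm (C i))) = C i := b.equivFun.apply_symm_apply (C i)
      rw [cv, h3]; rfl
    rw [this]; rfl
  have hpl : ∀ r : R, (p ^ l : ℤ) • r ∈ I := by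
    intro r
    rw [hmem]
    have : cv b p ((p ^ l : ℤ) • r) = (p : ℚ_[p]) ^ l • cv b p r := by ext; simp [cv, -zsmul_eq_mul]
    rw [this, smul_vecMul, ← vecMul_smul]
    refine IV.vecMul (fun j => ?_) hpM
    exact Padic.norm_int_le_one _
  have hfg : Module.Finite ℤ R := Module.Finite.of_basis b
  have hp0 : (p ^ l : ℤ) ≠ 0 := pow_ne_zero _ (by exact_mod_cast (Fact.out : p.Prime).ne_zero)
  have hfin : Finite (R ⧸ I) := by
    have : Module.Finite ℤ (R ⧸ I) := Module.Finite.of_surjective (Submodule.mkQ (I.restrictScalars ℤ)) (Submodule.mkQ_surjective _)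
    refine Module.finite_of_fg_torsion (R ⧸ I) ?_
    intro q
    obtain ⟨r, rfl⟩ := Ideal.Quotient.mk_surjective q
    refine ⟨⟨(p ^ l : ℤ), mem_nonZeroDivisors_of_ne_zero hp0⟩, ?_⟩
    change (p ^ l : ℤ) • (Ideal.Quotient.mk I r) = 0
    rw [← map_zsmul, Ideal.Quotient.eq_zero_iff_mem]
    exact hpl r
  have main : ∀ B : Matrix ν ν ℤ, IsB b I B → GM (M * (cz p B)⁻¹) ∧ B.det.natAbs = p ^ l := by
    intro B hB
    obtain ⟨D, hD⟩ := IsB_row b hB ((p ^ l : ℤ) • (1 : Matrix ν ν ℤ)) (fun i => by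
      have : b.equivFun.symm (((p ^ l : ℤ) • (1 : Matrix ν ν ℤ)) i) = (p ^ l : ℤ) • b.equivFun.symm ((1 : Matrix ν ν ℤ) i) := by
        rw [← map_smul]; rfl
      rw [this]; exact hpl _)
    have hdet := congrArg Matrix.det hD
    rw [det_smul, det_one, mul_one, det_mul] at hdet
    obtain ⟨m, _, hm⟩ : ∃ m ≤ l * Fintype.card ν, B.det.natAbs = p ^ m := by
      rw [← Nat.dvd_prime_pow (Fact.out : p.Prime)]
      have : B.det.natAbs ∣ ((p ^ l : ℤ) ^ Fintype.card ν).natAbs := Int.natAbs_dvd_natAbs.2 ⟨D.det, by rw [hdet]; ring⟩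
      rw [← pow_mul] at this
      simpa [Int.natAbs_pow] using this
    have hB0 := det_ne_of hm
    have h1 : IM (cz p B * M⁻¹) := (hrow B).2 fun i => IsB_self b hB i
    obtain ⟨N, E, hE, hN⟩ := appr_mat hI l
    have hN1 : IM (cz p N * M⁻¹) := by
      have e : cz p N * M⁻¹ = 1 + (-1 : ℚ_[p]) • (E * ((p : ℚ_[p]) ^ l • M⁻¹)) := by
        have : cz p N = M + (-1 : ℚ_[p]) • ((p : ℚ_[p]) ^ l • E) := by rw [hN]; simp
        rw [this, Matrix.add_mul, mul_nonsing_inv _ (hu h0), Matrix.smul_mul, Matrix.smul_mul, Matrix.mul_smul]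
      rw [e]
      exact IM_one.add ((hE.mul hpM).smul (by simp))
    obtain ⟨C, hC⟩ := IsB_row b hB N ((hrow N).1 hN1)
    have hDB : cz p D = (p : ℚ_[p]) ^ l • (cz p B)⁻¹ := by
      have : (p : ℚ_[p]) ^ l • (1 : Matrix ν ν ℚ_[p]) = cz p D * cz p B := by
        rw [← cz_mul, ← hD]
        ext i j
        rw [cz_apply, Matrix.smul_apply, Matrix.smul_apply, smul_eq_mul, smul_eq_mul, Matrix.one_apply, Matrix.one_apply]
        split_ifs <;> simp
      calc cz p D = (cz p D * cz p B) * (cz p B)⁻¹ := by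
            rw [Matrix.mul_assoc, mul_nonsing_inv _ (hu hB0), Matrix.mul_one]
        _ = _ := by rw [← this, Matrix.smul_mul, Matrix.one_mul]
    have h2 : IM (M * (cz p B)⁻¹) := by
      have e : M * (cz p B)⁻¹ = cz p C + E * cz p D := by
        rw [hDB]
        conv_lhs => rw [hN]
        rw [hC, cz_mul, Matrix.add_mul, Matrix.mul_assoc, mul_nonsing_inv _ (hu hB0), Matrix.mul_one,
          Matrix.smul_mul, Matrix.mul_smul]
      rw [e]
      exact (cz_IM C).add (hE.mul (cz_IM D))
    have hG : GM (M * (cz p B)⁻¹) := by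
      refine GM_of_mul h2 h1 ?_
      rw [Matrix.mul_assoc, ← Matrix.mul_assoc _ (cz p B), nonsing_inv_mul _ (hu hB0), Matrix.one_mul, mul_nonsing_inv _ (hu h0)]
    refine ⟨hG, ?_⟩
    have h3 := hG.2
    rw [det_mul, det_nonsing_inv, Ring.inverse_eq_inv', norm_mul, norm_inv, hd, cz_det, norm_pp m _ hm,
      mul_inv_eq_one₀ (pow_pos norm_p_pos m).ne'] at h3
    have : l = m := (pow_right_injective₀ norm_p_pos (Padic.norm_p_lt_one.ne)) h3
    rw [hm, this]
  obtain ⟨B, hB1, hB2⟩ := exists_B b I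
  refine ⟨I, by rw [← hB1]; exact (main B hB2).2, fun B' _ hB' => ?_⟩
  change GM _
  rw [← hM]
  exact (main B' hB').1

end res
end IdealZeta
end PartD4

section PartD5
open Filter Topology
open scoped NNReal ENNReal
namespace IdealZeta
set_option linter.unusedSectionVars false
section res
open MeasureTheory Matrix
variable {p : ℕ} [Fact p.Prime] {ν : Type} [Fintype ν] [DecidableEq ν]
variable {R : Type} [CommRing R] (b : Module.Basis ν ℤ R)

theorem TT_meas (l : ℕ) : MeasurableSet (TT b p l) := by
  have hd : Continuous fun x : ν × ν → ℚ_[p] => (mat x).det := mat_cont.matrix_det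
  have : IsClosed (TT b p l) := by
    have : TT b p l = (⋂ i, ⋂ j, {x | ‖mat x i j‖ ≤ 1}) ∩ ({x | ‖(mat x).det‖ = ‖(p : ℚ_[p])‖ ^ l} ∩
        ⋂ k, ⋂ i, ⋂ j, {x | ‖(mat x * cz p (mm b k) * (mat x).adjugate) i j‖ ≤ ‖(mat x).det‖}) := by
      ext x; simp [TT, IM]
    rw [this]
    refine IsClosed.inter (isClosed_iInter fun i => isClosed_iInter fun j => ?_)
      (IsClosed.inter ?_ (isClosed_iInter fun k => isClosed_iInter fun i => isClosed_iInter fun j => ?_))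
    · exact isClosed_le (mat_cont.matrix_elem i j).norm continuous_const
    · exact isClosed_eq hd.norm continuous_const
    · exact isClosed_le ((((mat_cont.matrix_mul continuous_const).matrix_mul mat_cont.matrix_adjugate).matrix_elem i j).norm) hd.norm
  exact this.measurableSet

theorem TT_Bx (l : ℕ) : TT b p l ⊆ Bx p (ν × ν) := fun _ hx q => hx.1 q.1 q.2

theorem TT_vol (l : ℕ) : hp p (ν × ν) (TT b p l) = ({I : Ideal R | Nat.card (R ⧸ I) = p ^ l}.ncard : ℝ≥0∞) *
    ((‖(p : ℚ_[p])‖ₑ ^ l) ^ Fintype.card ν * hp p (ν × ν) (GS p ν)) := by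
  obtain ⟨T, hT⟩ : ∃ T : Set (Ideal R), T = {I : Ideal R | Nat.card (R ⧸ I) = p ^ l} := ⟨_, rfl⟩
  rw [← hT]
  have hT' : ∀ I : T, Nat.card (R ⧸ (I : Ideal R)) = p ^ l := fun I => by
    exact hT.subset I.2
  have hex : ∀ I : T, ∃ B : Matrix ν ν ℤ, B.det.natAbs = Nat.card (R ⧸ (I : Ideal R)) ∧ IsB b I B := fun I => by
    have : Finite (R ⧸ (I : Ideal R)) := Nat.finite_of_card_ne_zero (by
      rw [hT' I]; exact pow_ne_zero _ (Fact.out : p.Prime).ne_zero)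
    exact exists_B b I
  choose B hB1 hB2 using hex
  have hB3 : ∀ I, (B I).det.natAbs = p ^ l := fun I => by rw [hB1, hT']
  have hU : TT b p l = ⋃ I : T, SB (cz p (B I)) := by
    apply Set.Subset.antisymm
    · intro x hx
      obtain ⟨I, hI, h⟩ := TT_cover b l hx
      have hIT : I ∈ T := by rw [hT]; exact hI
      exact Set.mem_iUnion.2 ⟨⟨I, hIT⟩, h _ (hB1 ⟨I, hIT⟩) (hB2 ⟨I, hIT⟩)⟩
    · exact Set.iUnion_subset fun I => SB_sub b (hB3 I) (hB2 I)
  have hdis : Pairwise (Function.onFun Disjoint fun I : T => SB (cz p (B I))) := by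
    intro I J hIJ
    rw [Function.onFun, Set.disjoint_left]
    intro x hx hx'
    exact hIJ (Subtype.ext (le_antisymm (SB_le b (hB3 J) (hB2 J) (hB3 I) (hB2 I) hx' hx) (SB_le b (hB3 I) (hB2 I) (hB3 J) (hB2 J) hx hx')))
  have hvol : ∀ I : T, hp p (ν × ν) (SB (cz p (B I))) = (‖(p : ℚ_[p])‖ₑ ^ l) ^ Fintype.card ν * hp p (ν × ν) (GS p ν) := by
    intro I
    rw [SB_vol _ (det_ne_of (hB3 I)), cz_det]
    congr 2
    rw [← ofReal_norm, norm_pp l _ (hB3 I), ← norm_pow, ofReal_norm, enorm_pow]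
  have hpos : 0 < (‖(p : ℚ_[p])‖ₑ ^ l) ^ Fintype.card ν * hp p (ν × ν) (GS p ν) := by
    refine pos_iff_ne_zero.2 (mul_ne_zero (pow_ne_zero _ (pow_ne_zero _ ?_)) GS_pos)
    exact enorm_ne_zero.2 p_ne
  have hle : hp p (ν × ν) (TT b p l) ≤ 1 := by
    rw [← hp_Bx (p := p) (ι := ν × ν)]
    exact measure_mono (TT_Bx b l)
  have hfin : Finite T := by
    have h := Measure.finite_const_le_meas_of_disjoint_iUnion (hp p (ν × ν)) hpos (fun I : T => SB_meas (cz p (B I))) hdis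
      (by rw [← hU]; exact (hle.trans_lt ENNReal.one_lt_top).ne)
    refine Set.finite_univ_iff.1 (h.subset fun I _ => ?_)
    exact (hvol I).ge
  have := Fintype.ofFinite T
  rw [hU, measure_iUnion hdis fun I => SB_meas _, tsum_congr hvol, tsum_fintype, Finset.sum_const, nsmul_eq_mul,
    Finset.card_univ, ← Nat.card_eq_fintype_card, Nat.card_coe_set_eq]

end res
end IdealZeta
end PartD5

section PartD6
open Filter Topology
open scoped NNReal ENNReal
namespace IdealZeta
set_option linter.unusedSectionVars false
section res
open MeasureTheory Matrix
variable {p : ℕ} [Fact p.Prime] {ν : Type} [Fintype ν] [DecidableEq ν]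
variable {R : Type} [CommRing R] (b : Module.Basis ν ℤ R)

theorem LA_poly {ι : Type} [Fintype ι] [DecidableEq ι] (P : MvPolynomial ι ℚ_[p]) : LA (fun x : ι → ℚ_[p] => MvPolynomial.eval x P) :=
  (AnalyticOnNhd.eval_mvPolynomial P).mono (Set.subset_univ _)

theorem NLZ_poly {ι : Type} [Fintype ι] [DecidableEq ι] (P : MvPolynomial ι ℚ_[p]) (hP : P ≠ 0) :
    NLZ (fun x : ι → ℚ_[p] => MvPolynomial.eval x P) := by
  intro x _ h
  apply hP
  obtain ⟨ε, hε, hb⟩ := Metric.eventually_nhds_iff_ball.1 h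
  refine MvPolynomial.funext_set (fun i => Metric.ball (x i) ε) (fun i => ?_) fun z hz => ?_
  · exact infinite_of_mem_nhds (x i) (Metric.ball_mem_nhds _ hε)
  · rw [map_zero]
    refine hb z ?_
    rw [ball_pi _ hε]
    exact hz

/-- polynomials for the conditions -/
noncomputable def PD (p : ℕ) [Fact p.Prime] (ν : Type) [Fintype ν] [DecidableEq ν] : MvPolynomial (ν × ν) ℚ_[p] :=
  (mvPolynomialX ν ν ℚ_[p]).det

/-- polynomials for the conditions -/
noncomputable def PC (p : ℕ) [Fact p.Prime] (q : ν × ν × ν) : MvPolynomial (ν × ν) ℚ_[p] :=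
  (mvPolynomialX ν ν ℚ_[p] * (MvPolynomial.C (σ := ν × ν)).mapMatrix (cz p (mm b q.1)) * (mvPolynomialX ν ν ℚ_[p]).adjugate) q.2.1 q.2.2

theorem ev_X (x : ν × ν → ℚ_[p]) : (MvPolynomial.eval x).mapMatrix (mvPolynomialX ν ν ℚ_[p]) = mat x :=
  mvPolynomialX_mapMatrix_eval (mat x)

theorem PD_eval (x : ν × ν → ℚ_[p]) : MvPolynomial.eval x (PD p ν) = (mat x).det := by
  rw [PD, RingHom.map_det, ev_X]

theorem PC_eval (x : ν × ν → ℚ_[p]) (q : ν × ν × ν) : MvPolynomial.eval x (PC b p q) =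
    (mat x * cz p (mm b q.1) * (mat x).adjugate) q.2.1 q.2.2 := by
  have h : ∀ A : Matrix ν ν (MvPolynomial (ν × ν) ℚ_[p]), ∀ i j, MvPolynomial.eval x (A i j) = (MvPolynomial.eval x).mapMatrix A i j := fun _ _ _ => rfl
  rw [PC, h, map_mul, map_mul, RingHom.map_adjugate, ev_X]
  have : (MvPolynomial.eval x).mapMatrix ((MvPolynomial.C (σ := ν × ν)).mapMatrix (cz p (mm b q.1))) = cz p (mm b q.1) := by
    ext i j; simp
  rw [this]

theorem TT_QRat : QRat (fun l => hp p (ν × ν) (TT b p l)) := by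
  classical
  let κ := {q : ν × ν × ν // PC b p q ≠ 0 ∧ PC b p q - PD p ν ≠ 0}
  let D : (ν × ν → ℚ_[p]) → ℚ_[p] := fun x => MvPolynomial.eval x (PD p ν)
  let f : κ → (ν × ν → ℚ_[p]) → ℚ_[p] := fun q x => MvPolynomial.eval x (PC b p q.1)
  let FP : MvPolynomial (ν × ν) ℚ_[p] := PD p ν * (∏ q : κ, PC b p q.1) * ∏ q : κ, (PC b p q.1 - PD p ν)
  have hFP : FP ≠ 0 := by
    refine mul_ne_zero (mul_ne_zero ?_ ?_) ?_
    · exact det_mvPolynomialX_ne_zero ν ℚ_[p]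
    · exact Finset.prod_ne_zero_iff.2 fun q _ => q.2.1
    · exact Finset.prod_ne_zero_iff.2 fun q _ => q.2.2
  have hR := Mon_all (p := p) (Finset.univ : Finset (ν × ν)) (fun x => MvPolynomial.eval x FP) (LA_poly FP)
    (fun x y hxy => by
      have : x = y := funext fun i => hxy i (by simp)
      rw [this]) (NLZ_poly FP hFP)
  have h := eval (κ := κ) hR (W := fun _ => 1) (D := D) (f := f) (LA_const _) (LA_poly _) (fun q => LA_poly _)
    (fun x hx => by
      simp only [D, PD_eval]
      exact IM.det_le fun i j => hx (i, j))
    (fun x hx => by simp only [FP, D, f, map_mul, map_prod, map_sub, one_mul])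
  refine h.congr fun l => ?_
  symm
  refine JJ_ind (TT_meas b l) (TT_Bx b l) fun x hx => ?_
  unfold Ph
  simp only [Set.indicator_apply, Set.mem_ofPred_eq, enorm_one, Pi.one_apply]
  refine if_congr ?_ rfl rfl
  have hI : IM (mat x) := fun i j => hx (i, j)
  simp only [D, f, PD_eval, TT, Set.mem_ofPred_eq, hI, true_and]
  refine and_congr_right fun _ => ?_
  constructor
  · intro h k i j
    by_cases h1 : PC b p (k, i, j) = 0
    · have := PC_eval b x (k, i, j)
      rw [h1, map_zero] at this
      rw [← this]; simp
    · by_cases h2 : PC b p (k, i, j) - PD p ν = 0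
      · have := PC_eval b x (k, i, j)
        rw [sub_eq_zero.1 h2, PD_eval] at this
        rw [← this]
      · have := h ⟨(k, i, j), h1, h2⟩
        rw [PC_eval] at this
        exact this
  · rintro h ⟨⟨k, i, j⟩, hq⟩
    rw [PC_eval]
    exact h k i j

end res
end IdealZeta
end PartD6

section PartE
open Filter Topology
open scoped NNReal ENNReal
namespace IdealZeta
set_option linter.unusedSectionVars false
section fatou

theorem coeff_shift (Q : Polynomial ℤ) (v : ℕ → ℤ) (l : ℕ) (hl : Q.natDegree < l + 1) :
    PowerSeries.coeff (l + 1) ((Q : PowerSeries ℤ) * PowerSeries.mk v) =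
      PowerSeries.coeff l ((Q : PowerSeries ℤ) * PowerSeries.mk (fun i => v (i + 1))) := by
  have h : PowerSeries.mk v = PowerSeries.C (v 0) + PowerSeries.mk (fun i => v (i + 1)) * PowerSeries.X := by
    ext i
    cases i with
    | zero => simp
    | succ i => 
      rw [map_add, PowerSeries.coeff_succ_mul_X, PowerSeries.coeff_C, if_neg (by omega), PowerSeries.coeff_mk,
        PowerSeries.coeff_mk, zero_add]
  rw [h, mul_add, map_add, ← mul_assoc, PowerSeries.coeff_succ_mul_X, PowerSeries.coeff_mul_C, Polynomial.coeff_coe,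
    Polynomial.coeff_eq_zero_of_natDegree_lt hl, zero_mul, zero_add]

/-- sequences with a recurrence -/
def rec_mod (Q : Polynomial ℤ) (K : ℕ) : Submodule ℤ (ℕ → ℤ) where
  carrier := {v | ∀ l, K ≤ l → PowerSeries.coeff l ((Q : PowerSeries ℤ) * PowerSeries.mk v) = 0}
  zero_mem' := by
    intro l _
    have : PowerSeries.mk (0 : ℕ → ℤ) = 0 := by ext; simp
    rw [this]; simp
  add_mem' := by
    intro v w hv hw l hl
    have : PowerSeries.mk (v + w) = PowerSeries.mk v + PowerSeries.mk w := by ext; simp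
    rw [this, mul_add, map_add, hv l hl, hw l hl, add_zero]
  smul_mem' := by
    intro c v hv l hl
    have : PowerSeries.mk (c • v) = c • PowerSeries.mk v := by
      ext i; rw [map_smul]; simp only [PowerSeries.coeff_mk]; rfl
    rw [this, mul_smul_comm, map_smul, hv l hl, smul_zero]

theorem fatou_int (Q P : Polynomial ℤ) (hQ : Q.coeff 0 ≠ 0) (a : ℕ → ℤ)
    (h : (Q : PowerSeries ℤ) * PowerSeries.mk a = P) :
    ∃ P' Q' : Polynomial ℤ, Q'.coeff 0 = 1 ∧ (Q' : PowerSeries ℤ) * PowerSeries.mk a = P' := by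
  obtain ⟨K, hK⟩ : ∃ K, K = max Q.natDegree P.natDegree + 1 := ⟨_, rfl⟩
  have hKQ : Q.natDegree < K := by rw [hK]; omega
  have hKP : P.natDegree < K := by rw [hK]; omega
  -- shift
  let T : rec_mod Q K →ₗ[ℤ] rec_mod Q K :=
    { toFun := fun v => ⟨fun i => v.1 (i + 1), fun l hl => by
        rw [← coeff_shift Q v.1 l (by omega)]
        exact v.2 (l + 1) (by omega)⟩
      map_add' := fun v w => rfl
      map_smul' := fun c v => rfl }
  let ρ : rec_mod Q K →ₗ[ℤ] (Fin K → ℤ) :=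
    { toFun := fun v i => v.1 i
      map_add' := fun v w => rfl
      map_smul' := fun c v => rfl }
  have hρ : Function.Injective ρ := by
    rw [← LinearMap.ker_eq_bot, LinearMap.ker_eq_bot']
    intro v hv
    have : ∀ l, v.1 l = 0 := by
      intro l
      induction l using Nat.strong_induction_on with
      | _ l ih =>
        by_cases hl : l < K
        · exact congrFun hv ⟨l, hl⟩
        · have h1 := v.2 l (not_lt.1 hl)
          rw [PowerSeries.coeff_mul, Finset.sum_eq_single (0, l)] at h1
          · simp only [Polynomial.coeff_coe, PowerSeries.coeff_mk] at h1
            exact (mul_eq_zero.1 h1).resolve_left hQ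
          · rintro ⟨i, j⟩ hij hne
            rw [Finset.HasAntidiagonal.mem_antidiagonal] at hij
            simp only at hij
            have : j < l := by
              rcases Nat.eq_zero_or_pos i with h0 | h0
              · exfalso; apply hne; subst h0; simp at hij; rw [hij]
              · omega
            simp only [PowerSeries.coeff_mk]
            rw [ih j this, mul_zero]
          · intro h; simp at h
    exact Subtype.ext (funext this)
  have hfin : Module.Finite ℤ (rec_mod Q K) := Module.Finite.of_injective ρ hρ
  obtain ⟨χ, hχ, hχ0⟩ := LinearMap.exists_monic_and_aeval_eq_zero ℤ T
  have ha : a ∈ rec_mod Q K := by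
    intro l hl
    rw [h, Polynomial.coeff_coe]
    exact Polynomial.coeff_eq_zero_of_natDegree_lt (by omega)
  have hpow : ∀ (i : ℕ) (v : rec_mod Q K) (l : ℕ), ((T ^ i) v).1 l = v.1 (l + i) := by
    intro i
    induction i with
    | zero => intro v l; rfl
    | succ i ih =>
      intro v l
      rw [pow_succ', Module.End.mul_apply]
      change ((T ^ i) v).1 (l + 1) = _
      rw [ih, show l + 1 + i = l + (i + 1) by omega]
  have hrec : ∀ l, ∑ i ∈ Finset.range (χ.natDegree + 1), χ.coeff i * a (l + i) = 0 := by
    intro l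
    have h1 : ((Polynomial.aeval T χ) ⟨a, ha⟩ : rec_mod Q K).1 l = 0 := by rw [hχ0]; rfl
    rw [Polynomial.aeval_eq_sum_range, LinearMap.sum_apply] at h1
    rw [← h1]
    simp only [AddSubmonoidClass.coe_finsetSum, Finset.sum_apply]
    refine Finset.sum_congr rfl fun i _ => ?_
    rw [LinearMap.smul_apply]
    change _ = χ.coeff i * ((T ^ i) (⟨a, ha⟩ : rec_mod Q K)).1 l
    rw [hpow]
  obtain ⟨d, hd⟩ : ∃ d, d = χ.natDegree := ⟨_, rfl⟩
  rw [← hd] at hrec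
  obtain ⟨Q', hQ'⟩ : ∃ Q' : Polynomial ℤ, Q' = ∑ i ∈ Finset.range (d + 1), Polynomial.C (χ.coeff i) * Polynomial.X ^ (d - i) := ⟨_, rfl⟩
  have hc : ∀ l, d ≤ l → PowerSeries.coeff l ((Q' : PowerSeries ℤ) * PowerSeries.mk a) = 0 := by
    intro l hl
    have e : (Q' : PowerSeries ℤ) = ∑ i ∈ Finset.range (d + 1), PowerSeries.C (χ.coeff i) * PowerSeries.X ^ (d - i) := by
      rw [hQ']
      rw [← Polynomial.coeToPowerSeries.ringHom_apply, map_sum]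
      refine Finset.sum_congr rfl fun i _ => ?_
      rw [Polynomial.coeToPowerSeries.ringHom_apply, Polynomial.coe_mul, Polynomial.coe_C, Polynomial.coe_pow, Polynomial.coe_X]
    rw [e, Finset.sum_mul, map_sum, ← hrec (l - d)]
    refine Finset.sum_congr rfl fun i hi => ?_
    have hi' := Finset.mem_range.1 hi
    rw [mul_assoc, PowerSeries.coeff_C_mul, PowerSeries.coeff_X_pow_mul', if_pos (by omega), PowerSeries.coeff_mk]
    congr 2; omega
  refine ⟨PowerSeries.trunc d ((Q' : PowerSeries ℤ) * PowerSeries.mk a), Q', ?_, ?_⟩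
  · rw [hQ', Polynomial.finsetSum_coeff, Finset.sum_eq_single d]
    · simp only [Polynomial.coeff_C_mul, Polynomial.coeff_X_pow]
      rw [hd]; simp [hχ.coeff_natDegree]
    · intro i hi hne
      have hi' := Finset.mem_range.1 hi
      rw [Polynomial.coeff_C_mul, Polynomial.coeff_X_pow, if_neg (by omega), mul_zero]
    · simp
  · ext l
    rw [Polynomial.coeff_coe, PowerSeries.coeff_trunc]
    split_ifs with h1
    · rfl
    · exact hc l (not_lt.1 h1)

theorem clear_den (F : Polynomial ℚ) : ∃ m : ℤ, m ≠ 0 ∧ ∃ F1 : Polynomial ℤ,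
    ∀ i, ((F1.coeff i : ℤ) : ℚ) = (m : ℚ) * F.coeff i := by
  obtain ⟨m, hm, h⟩ := IsLocalization.integerNormalization_spec (nonZeroDivisors ℤ) F
  refine ⟨m, nonZeroDivisors.ne_zero hm, IsLocalization.integerNormalization (nonZeroDivisors ℤ) F, fun i => ?_⟩
  have := congrArg (fun G => Polynomial.coeff G i) h
  simp only [Polynomial.coeff_map, Polynomial.coeff_smul] at this
  rw [zsmul_eq_mul] at this
  exact this

theorem fatou (Q P : Polynomial ℚ) (hQ : Q.coeff 0 ≠ 0) (a : ℕ → ℤ)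
    (h : (Q : PowerSeries ℚ) * PowerSeries.mk (fun l => (a l : ℚ)) = P) :
    ∃ P' Q' : Polynomial ℤ, Q'.coeff 0 = 1 ∧ (Q' : PowerSeries ℤ) * PowerSeries.mk a = P' := by
  obtain ⟨m, hm, Q1, hQ1⟩ := clear_den Q
  obtain ⟨k, hk, P1, hP1⟩ := clear_den P
  refine fatou_int (Polynomial.C k * Q1) (Polynomial.C m * P1) ?_ a ?_
  · rw [Polynomial.coeff_C_mul]
    refine mul_ne_zero hk fun h0 => ?_
    have := hQ1 0
    rw [h0, Int.cast_zero] at this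
    exact mul_ne_zero (Int.cast_ne_zero.2 hm) hQ this.symm
  · ext l
    have h1 := congrArg (PowerSeries.coeff l) h
    rw [PowerSeries.coeff_mul, Polynomial.coeff_coe] at h1
    simp only [PowerSeries.coeff_mk, Polynomial.coeff_coe] at h1
    rw [PowerSeries.coeff_mul]
    simp only [PowerSeries.coeff_mk, Polynomial.coeff_coe, Polynomial.coeff_C_mul]
    have : ((k : ℚ)) * (m : ℚ) * P.coeff l = m * ((P1.coeff l : ℤ) : ℚ) := by rw [hP1]; ring
    rw [← h1, Finset.mul_sum] at this
    apply Int.cast_injective (α := ℚ)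
    push_cast
    rw [← this]
    refine Finset.sum_congr rfl fun i _ => ?_
    rw [hQ1]; ring

end fatou
end IdealZeta
end PartE

section PartF
open Filter Topology
open scoped NNReal ENNReal
namespace IdealZeta
set_option linter.unusedSectionVars false
section fin
variable {p : ℕ} [Fact p.Prime] {ν : Type} [Fintype ν] [DecidableEq ν]
variable {R : Type} [CommRing R]

theorem ncard_top : ({I : Ideal R | Nat.card (R ⧸ I) = p ^ 0}).ncard = 1 := by
  rw [Set.ncard_eq_one]
  refine ⟨⊤, ?_⟩
  ext I
  simp only [Set.mem_ofPred_eq, Set.mem_singleton_iff, pow_zero]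
  constructor
  · intro h
    rw [Nat.card_eq_one_iff_unique] at h
    exact Ideal.Quotient.subsingleton_iff.1 h.1
  · rintro rfl
    have : Subsingleton (R ⧸ (⊤ : Ideal R)) := Ideal.Quotient.subsingleton_iff.2 rfl
    exact Nat.card_of_subsingleton 0

theorem final_aux (b : Module.Basis ν ℤ R) : ∃ P' Q' : Polynomial ℤ, Q'.coeff 0 = 1 ∧ (Q' : PowerSeries ℤ) *
    PowerSeries.mk (fun l => (({I : Ideal R | Nat.card (R ⧸ I) = p ^ l}.ncard : ℕ) : ℤ)) = P' := by
  obtain ⟨q, hq, P, Q, hQ0, hPQ⟩ := TT_QRat (p := p) b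
  beta_reduce at hq
  have hv := TT_vol (p := p) b
  obtain ⟨A, hA⟩ : ∃ A : ℕ → ℕ, A = fun l => {I : Ideal R | Nat.card (R ⧸ I) = p ^ l}.ncard := ⟨_, rfl⟩
  have hA' : ∀ l, {I : Ideal R | Nat.card (R ⧸ I) = p ^ l}.ncard = A l := fun l => by rw [hA]
  have hA0 : A 0 = 1 := by rw [← hA', ncard_top]
  simp only [hA'] at hv ⊢
  have hg : hp p (ν × ν) (GS p ν) = ((q 0 : ℝ≥0) : ℝ≥0∞) := by
    rw [← hq 0, hv, hA0]; simp
  have hq0 : q 0 ≠ 0 := by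
    intro h0
    apply GS_pos (p := p) (ν := ν)
    rw [hg, h0]; simp
  have hql : ∀ l, q l = (A l : ℚ≥0) * ((((p : ℚ≥0)⁻¹) ^ l) ^ Fintype.card ν * q 0) := by
    intro l
    have h1 := hq l
    rw [hv, hg, enorm_p, ← p_inv_cast] at h1
    have h2 : (((A l : ℚ≥0) * ((((p : ℚ≥0)⁻¹) ^ l) ^ Fintype.card ν * q 0) : ℚ≥0) : ℝ≥0) = (q l : ℝ≥0) := by
      rw [← ENNReal.coe_inj, ← h1, NNRat.cast_mul, NNRat.cast_mul, NNRat.cast_pow, NNRat.cast_pow, NNRat.cast_natCast,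
        ENNReal.coe_mul, ENNReal.coe_mul, ENNReal.coe_pow, ENNReal.coe_pow, ENNReal.coe_natCast]
    exact (NNRat.cast_injective h2).symm
  have hp0 : (p : ℚ) ≠ 0 := by exact_mod_cast (Fact.out : p.Prime).ne_zero
  have hq0' : ((q 0 : ℚ≥0) : ℚ) ≠ 0 := by exact_mod_cast hq0
  obtain ⟨c, hc⟩ : ∃ c : ℚ, c = (p : ℚ) ^ Fintype.card ν := ⟨_, rfl⟩
  have hAl : ∀ l, ((q 0 : ℚ≥0) : ℚ) * (A l : ℚ) = c ^ l * ((q l : ℚ≥0) : ℚ) := by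
    intro l
    rw [hql l]
    push_cast
    rw [hc, ← pow_mul, ← pow_mul, mul_comm l, inv_pow]
    field_simp
  refine fatou (Polynomial.C ((q 0 : ℚ≥0) : ℚ) * Q.comp (Polynomial.C c * Polynomial.X))
    (P.comp (Polynomial.C c * Polynomial.X)) ?_ _ ?_
  · rw [Polynomial.coeff_C_mul, Polynomial.comp_C_mul_X_coeff, pow_zero, mul_one]
    exact mul_ne_zero hq0' hQ0
  · ext l
    have h1 := congrArg (PowerSeries.coeff l) hPQ
    rw [PowerSeries.coeff_mul, Polynomial.coeff_coe] at h1
    simp only [PowerSeries.coeff_mk, Polynomial.coeff_coe] at h1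
    rw [PowerSeries.coeff_mul]
    simp only [PowerSeries.coeff_mk, Polynomial.coeff_coe, Polynomial.coeff_C_mul, Polynomial.comp_C_mul_X_coeff]
    rw [← h1, Finset.sum_mul]
    refine Finset.sum_congr rfl fun i hi => ?_
    rw [Finset.HasAntidiagonal.mem_antidiagonal] at hi
    rw [← hi, pow_add]
    have := hAl i.2
    push_cast
    linear_combination (Q.coeff i.1 * c ^ i.1) * this

end fin
end IdealZeta
end PartF

/-- If `R` is a commutative ring whose additive group is free abelian of finite rank `n`
and `p` is a prime, then the local generating function `∑_{l ≥ 0} a_R(p^l) X^l` is a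
rational function of `X`. -/
theorem ideal_count_local_factor_rational (R : Type) [CommRing R]
    [Module.Free ℤ R] [Module.Finite ℤ R] (n : ℕ) (hrank : Module.finrank ℤ R = n)
    (p : ℕ) (hp : p.Prime) :
    ∃ P Q : Polynomial ℤ, Q.coeff 0 = 1 ∧
      (Q : PowerSeries ℤ) * PowerSeries.mk (fun l => (idealCount R (p ^ l) : ℤ)) =
        (P : PowerSeries ℤ) := by
  haveI : Fact p.Prime := ⟨hp⟩
  exact IdealZeta.final_aux (p := p) (Module.finBasis ℤ R)
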